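/- Let d ≥ 4 be an integer, ζ ∈ {0,1}, and if ζ = 1 assume 4 ≤ d ≤ 5 and 1 + 4/(d−1) ≤ p ≤ 1 + 4/(d−2). Let u be a classical finite-energy solution of the Coulomb wave equation ∂ₜ²u − Δₓu + u/|x| + ζ|u|^{p−1}u = 0 on ℝ^d with conserved energy E. Define the inward energy E₋(t) := ∫_{ℝ^d} e₋(x,t) dx. Then E₋ is a nonincreasing function of t with lim_{t→+∞} E₋(t) = 0 and lim_{t→−∞} E₋(t) = E, and the Morawetz identity ∫_ℝ ∫_{ℝ^d} M(x,t) dx dt = E holds. -/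

import Mathlib

open MeasureTheory Filter

/-- The Laplacian of `u : ℝ^d → ℝ`, as the sum of second derivatives in the
coordinate directions. -/
noncomputable def lap {d : ℕ} (u : EuclideanSpace ℝ (Fin d) → ℝ)
    (x : EuclideanSpace ℝ (Fin d)) : ℝ :=
  ∑ i : Fin d, iteratedFDeriv ℝ 2 u x ![EuclideanSpace.single i 1, EuclideanSpace.single i 1]

/-- The radial derivative `u_r(x) = (x/|x|) · ∇u(x)`. -/
noncomputable def rderiv {d : ℕ} (u : EuclideanSpace ℝ (Fin d) → ℝ)
    (x : EuclideanSpace ℝ (Fin d)) : ℝ :=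
  @inner ℝ _ _ (‖x‖⁻¹ • x) (gradient u x)

/-- The angular part `∇̸u = ∇u - u_r · x/|x|` of the gradient. -/
noncomputable def angGrad {d : ℕ} (u : EuclideanSpace ℝ (Fin d) → ℝ)
    (x : EuclideanSpace ℝ (Fin d)) : EuclideanSpace ℝ (Fin d) :=
  gradient u x - rderiv u x • (‖x‖⁻¹ • x)

/-- `λ = (d-1)(d-3)/4`. -/
noncomputable def lam (d : ℕ) : ℝ := ((d : ℝ) - 1) * ((d : ℝ) - 3) / 4

/-- The energy density
`e = ½|∇ₓu|² + ½|∂ₜu|² + u²/(2|x|) + ζ|u|^{p+1}/(p+1)` of the Coulomb wave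
equation `∂ₜ²u - Δu + u/|x| + ζ|u|^{p-1}u = 0`. -/
noncomputable def eDen {d : ℕ} (p ζ : ℝ) (u : EuclideanSpace ℝ (Fin d) → ℝ → ℝ)
    (x : EuclideanSpace ℝ (Fin d)) (t : ℝ) : ℝ :=
  (1 / 2) * ‖gradient (fun y => u y t) x‖ ^ 2 + (1 / 2) * (deriv (u x) t) ^ 2
    + (u x t) ^ 2 / (2 * ‖x‖) + ζ * |u x t| ^ (p + 1) / (p + 1)

/-- `u` is a classical finite-energy solution of the Coulomb wave equation
`∂ₜ²u - Δu + u/|x| + ζ|u|^{p-1}u = 0` with conserved energy `E`: it is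
continuous on `ℝ^d × ℝ`, `C²` on `(ℝ^d∖{0}) × ℝ`, solves the equation away
from `x = 0`, and its total energy equals `E` at every time. -/
def IsCoulombSolution {d : ℕ} (p ζ : ℝ)
    (u : EuclideanSpace ℝ (Fin d) → ℝ → ℝ) (E : ℝ) : Prop :=
  Continuous (fun q : EuclideanSpace ℝ (Fin d) × ℝ => u q.1 q.2) ∧
  ContDiffOn ℝ 2 (fun q : EuclideanSpace ℝ (Fin d) × ℝ => u q.1 q.2)
    ({(0 : EuclideanSpace ℝ (Fin d))}ᶜ ×ˢ Set.univ) ∧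
  (∀ x : EuclideanSpace ℝ (Fin d), x ≠ 0 → ∀ t : ℝ,
    deriv (deriv (u x)) t - lap (fun y => u y t) x + u x t / ‖x‖
      + ζ * |u x t| ^ (p - 1) * u x t = 0) ∧
  (∀ t : ℝ, Integrable (fun x => eDen p ζ u x t)) ∧
  (∀ t : ℝ, ∫ x, eDen p ζ u x t = E)

/-- The non-directional energy density
`e' = ½|∇̸u|² + (λ/2)u²/|x|² + u²/(2|x|) + ζ|u|^{p+1}/(p+1)`. -/
noncomputable def ePrime {d : ℕ} (p ζ : ℝ) (u : EuclideanSpace ℝ (Fin d) → ℝ → ℝ)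
    (x : EuclideanSpace ℝ (Fin d)) (t : ℝ) : ℝ :=
  (1 / 2) * ‖angGrad (fun y => u y t) x‖ ^ 2 + lam d / 2 * (u x t) ^ 2 / ‖x‖ ^ 2
    + (u x t) ^ 2 / (2 * ‖x‖) + ζ * |u x t| ^ (p + 1) / (p + 1)

/-- `L₊u = u_r + ((d-1)/2)·u/|x| + ∂ₜu`. -/
noncomputable def Lplus {d : ℕ} (u : EuclideanSpace ℝ (Fin d) → ℝ → ℝ)
    (x : EuclideanSpace ℝ (Fin d)) (t : ℝ) : ℝ :=
  rderiv (fun y => u y t) x + ((d : ℝ) - 1) / 2 * u x t / ‖x‖ + deriv (u x) t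

/-- The inward energy density `e₋ = ¼|L₊u|² + ½e'`. -/
noncomputable def eMinus {d : ℕ} (p ζ : ℝ) (u : EuclideanSpace ℝ (Fin d) → ℝ → ℝ)
    (x : EuclideanSpace ℝ (Fin d)) (t : ℝ) : ℝ :=
  (1 / 4) * (Lplus u x t) ^ 2 + (1 / 2) * ePrime p ζ u x t

/-- The Morawetz density
`M = ½|∇̸u|²/|x| + (λ/2)u²/|x|³ + ζ(d-1)(p-1)|u|^{p+1}/(4(p+1)|x|) + u²/(4|x|²)`. -/
noncomputable def Mden {d : ℕ} (p ζ : ℝ) (u : EuclideanSpace ℝ (Fin d) → ℝ → ℝ)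
    (x : EuclideanSpace ℝ (Fin d)) (t : ℝ) : ℝ :=
  (1 / 2) * ‖angGrad (fun y => u y t) x‖ ^ 2 / ‖x‖ + lam d / 2 * (u x t) ^ 2 / ‖x‖ ^ 3
    + ζ * ((d : ℝ) - 1) * (p - 1) * |u x t| ^ (p + 1) / (4 * (p + 1) * ‖x‖)
    + (u x t) ^ 2 / (4 * ‖x‖ ^ 2)

namespace Coulomb
section
open Set Topology

/-- The Euclidean space `ℝ^d`. -/
abbrev Sp (d : ℕ) : Type := EuclideanSpace ℝ (Fin d)

variable {d : ℕ}


/-- Functions that are continuous on `ℝ^d × ℝ` and `C²` away from the time axis. -/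
structure Reg (v : Sp d → ℝ → ℝ) : Prop where
  cont : Continuous (fun q : Sp d × ℝ => v q.1 q.2)
  smooth : ContDiffOn ℝ 2 (fun q : Sp d × ℝ => v q.1 q.2) ({(0 : Sp d)}ᶜ ×ˢ univ)

/-- The complement of the time axis. -/
def off (d : ℕ) : Set (EuclideanSpace ℝ (Fin d) × ℝ) := {(0 : EuclideanSpace ℝ (Fin d))}ᶜ ×ˢ univ

/-- The spatial gradient as a function on space-time. -/
noncomputable def gr (v : Sp d → ℝ → ℝ) (q : Sp d × ℝ) : Sp d := gradient (fun y => v y q.2) q.1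

/-- The time derivative as a function on space-time. -/
noncomputable def vt (v : Sp d → ℝ → ℝ) (q : Sp d × ℝ) : ℝ := deriv (v q.1) q.2

theorem isOpen_off : IsOpen (off d) :=
  isOpen_compl_singleton.prod isOpen_univ

theorem mem_off {q : Sp d × ℝ} : q ∈ off d ↔ q.1 ≠ 0 := by
  simp [off]

namespace Reg

variable {v : Sp d → ℝ → ℝ} (hv : Reg v) {q : Sp d × ℝ}
include hv

theorem contDiffAt (hq : q ∈ off d) : ContDiffAt ℝ 2 (fun q : Sp d × ℝ => v q.1 q.2) q :=
  hv.smooth.contDiffAt (isOpen_off.mem_nhds hq)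

theorem hasFDerivAt (hq : q ∈ off d) :
    HasFDerivAt (fun q : Sp d × ℝ => v q.1 q.2) (fderiv ℝ (fun q : Sp d × ℝ => v q.1 q.2) q) q :=
  ((hv.contDiffAt hq).differentiableAt (by norm_num)).hasFDerivAt

theorem fderiv_contDiffAt (hq : q ∈ off d) :
    ContDiffAt ℝ 1 (fderiv ℝ (fun q : Sp d × ℝ => v q.1 q.2)) q :=
  (hv.contDiffAt hq).fderiv_right (by norm_num)

theorem hasFDerivAt_left (hq : q ∈ off d) :
    HasFDerivAt (fun y => v y q.2)
      ((fderiv ℝ (fun q : Sp d × ℝ => v q.1 q.2) q).comp (ContinuousLinearMap.inl ℝ (Sp d) ℝ)) q.1 := by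
  have h : HasFDerivAt (fun y : Sp d => (y, q.2)) (ContinuousLinearMap.inl ℝ (Sp d) ℝ) q.1 :=
    hasFDerivAt_prodMk_left q.1 q.2
  exact (hv.hasFDerivAt hq).comp q.1 h

theorem gr_eq (hq : q ∈ off d) :
    gr v q = (InnerProductSpace.toDual ℝ (Sp d)).symm
      ((fderiv ℝ (fun q : Sp d × ℝ => v q.1 q.2) q).comp (ContinuousLinearMap.inl ℝ (Sp d) ℝ)) := by
  rw [gr, gradient, (hv.hasFDerivAt_left hq).fderiv]

theorem inner_gr (hq : q ∈ off d) (y : Sp d) :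
    inner ℝ (gr v q) y = fderiv ℝ (fun q : Sp d × ℝ => v q.1 q.2) q (y, 0) := by
  rw [hv.gr_eq hq, InnerProductSpace.toDual_symm_apply]
  simp

theorem hasDerivAt_right (hq : q ∈ off d) :
    HasDerivAt (v q.1) (fderiv ℝ (fun q : Sp d × ℝ => v q.1 q.2) q (0, 1)) q.2 := by
  have h : HasDerivAt (fun s : ℝ => (q.1, s)) ((0 : Sp d), (1 : ℝ)) q.2 :=
    (hasDerivAt_const _ _).prodMk (hasDerivAt_id _)
  exact (hv.hasFDerivAt hq).comp_hasDerivAt q.2 h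

theorem vt_eq (hq : q ∈ off d) :
    vt v q = fderiv ℝ (fun q : Sp d × ℝ => v q.1 q.2) q (0, 1) :=
  (hv.hasDerivAt_right hq).deriv

theorem fderiv_apply (hq : q ∈ off d) (y : Sp d) (s : ℝ) :
    fderiv ℝ (fun q : Sp d × ℝ => v q.1 q.2) q (y, s) = inner ℝ (gr v q) y + s * vt v q := by
  rw [hv.inner_gr hq, hv.vt_eq hq, ← smul_eq_mul, ← map_smul, ← map_add]
  simp

theorem gr_eventuallyEq (hq : q ∈ off d) :
    gr v =ᶠ[𝓝 q] fun q => (InnerProductSpace.toDual ℝ (Sp d)).symm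
      ((fderiv ℝ (fun q : Sp d × ℝ => v q.1 q.2) q).comp (ContinuousLinearMap.inl ℝ (Sp d) ℝ)) := by
  filter_upwards [isOpen_off.mem_nhds hq] with q hq using hv.gr_eq hq

theorem vt_eventuallyEq (hq : q ∈ off d) :
    vt v =ᶠ[𝓝 q] fun q => fderiv ℝ (fun q : Sp d × ℝ => v q.1 q.2) q (0, 1) := by
  filter_upwards [isOpen_off.mem_nhds hq] with q hq using hv.vt_eq hq

theorem gr_contDiffAt (hq : q ∈ off d) : ContDiffAt ℝ 1 (gr v) q := by
  refine ContDiffAt.congr_of_eventuallyEq ?_ (hv.gr_eventuallyEq hq)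
  have h := hv.fderiv_contDiffAt hq
  refine ((InnerProductSpace.toDual ℝ (Sp d)).symm.toContinuousLinearEquiv.contDiff).contDiffAt.comp q ?_
  exact h.clm_comp contDiffAt_const

theorem vt_contDiffAt (hq : q ∈ off d) : ContDiffAt ℝ 1 (vt v) q := by
  refine ContDiffAt.congr_of_eventuallyEq ?_ (hv.vt_eventuallyEq hq)
  exact (hv.fderiv_contDiffAt hq).clm_apply contDiffAt_const

theorem hasFDerivAt_gr (hq : q ∈ off d) : HasFDerivAt (gr v) (fderiv ℝ (gr v) q) q :=
  ((hv.gr_contDiffAt hq).differentiableAt (by norm_num)).hasFDerivAt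

theorem hasFDerivAt_vt (hq : q ∈ off d) : HasFDerivAt (vt v) (fderiv ℝ (vt v) q) q :=
  ((hv.vt_contDiffAt hq).differentiableAt (by norm_num)).hasFDerivAt

theorem hasFDerivAt_fderiv (hq : q ∈ off d) :
    HasFDerivAt (fderiv ℝ (fun q : Sp d × ℝ => v q.1 q.2))
      (fderiv ℝ (fderiv ℝ (fun q : Sp d × ℝ => v q.1 q.2)) q) q :=
  ((hv.fderiv_contDiffAt hq).differentiableAt (by norm_num)).hasFDerivAt

theorem inner_fderiv_gr (hq : q ∈ off d) (w : Sp d × ℝ) (y : Sp d) :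
    inner ℝ (fderiv ℝ (gr v) q w) y
      = fderiv ℝ (fderiv ℝ (fun q : Sp d × ℝ => v q.1 q.2)) q w (y, 0) := by
  have h1 : HasFDerivAt (fun q => inner ℝ (gr v q) y)
      ((innerSL ℝ y).comp (fderiv ℝ (gr v) q)) q := by
    have := (innerSL ℝ y).hasFDerivAt.comp q (hv.hasFDerivAt_gr hq)
    refine this.congr_of_eventuallyEq (Eventually.of_forall fun q => ?_)
    simp [real_inner_comm]
  have h2 : HasFDerivAt (fun q => inner ℝ (gr v q) y)
      ((fderiv ℝ (fderiv ℝ (fun q : Sp d × ℝ => v q.1 q.2)) q).flip (y, 0)) q := by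
    have := (hv.hasFDerivAt_fderiv hq).clm_apply (hasFDerivAt_const ((y, 0) : Sp d × ℝ) q)
    simp only [ContinuousLinearMap.comp_zero, zero_add] at this
    refine this.congr_of_eventuallyEq ?_
    filter_upwards [isOpen_off.mem_nhds hq] with q hq using hv.inner_gr hq y
  have := congrArg (fun L => L w) (h1.unique h2)
  simpa [real_inner_comm] using this

theorem fderiv_vt (hq : q ∈ off d) (w : Sp d × ℝ) :
    fderiv ℝ (vt v) q w = fderiv ℝ (fderiv ℝ (fun q : Sp d × ℝ => v q.1 q.2)) q w (0, 1) := by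
  have h2 : HasFDerivAt (vt v)
      ((fderiv ℝ (fderiv ℝ (fun q : Sp d × ℝ => v q.1 q.2)) q).flip (0, 1)) q := by
    have := (hv.hasFDerivAt_fderiv hq).clm_apply (hasFDerivAt_const ((0, 1) : Sp d × ℝ) q)
    simp only [ContinuousLinearMap.comp_zero, zero_add] at this
    exact this.congr_of_eventuallyEq (hv.vt_eventuallyEq hq)
  rw [h2.fderiv]
  rfl

theorem snd_symm (hq : q ∈ off d) (w z : Sp d × ℝ) :
    fderiv ℝ (fderiv ℝ (fun q : Sp d × ℝ => v q.1 q.2)) q w z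
      = fderiv ℝ (fderiv ℝ (fun q : Sp d × ℝ => v q.1 q.2)) q z w :=
  (hv.contDiffAt hq).isSymmSndFDerivAt (by simp) w z

theorem inner_fderiv_gr_symm (hq : q ∈ off d) (y z : Sp d) :
    inner ℝ (fderiv ℝ (gr v) q (y, 0)) z = inner ℝ (fderiv ℝ (gr v) q (z, 0)) y := by
  rw [hv.inner_fderiv_gr hq, hv.inner_fderiv_gr hq, hv.snd_symm hq]

theorem inner_fderiv_gr_time (hq : q ∈ off d) (y : Sp d) :
    inner ℝ (fderiv ℝ (gr v) q (0, 1)) y = fderiv ℝ (vt v) q (y, 0) := by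
  rw [hv.inner_fderiv_gr hq, hv.fderiv_vt hq, hv.snd_symm hq]

theorem deriv_deriv (hq : q ∈ off d) :
    deriv (deriv (v q.1)) q.2 = fderiv ℝ (vt v) q (0, 1) := by
  have h : HasDerivAt (fun s : ℝ => (q.1, s)) ((0 : Sp d), (1 : ℝ)) q.2 :=
    (hasDerivAt_const _ _).prodMk (hasDerivAt_id _)
  exact ((hv.hasFDerivAt_vt hq).comp_hasDerivAt q.2 h).deriv

theorem lap_eq (hq : q ∈ off d) :
    lap (fun y => v y q.2) q.1
      = ∑ i : Fin d, inner ℝ (fderiv ℝ (gr v) q (EuclideanSpace.single i 1, 0))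
          (EuclideanSpace.single i 1) := by
  unfold lap
  refine Finset.sum_congr rfl fun i _ => ?_
  rw [hv.inner_fderiv_gr hq, iteratedFDeriv_two_apply]
  simp only [Matrix.cons_val_zero, Matrix.cons_val_one]
  have hp : HasFDerivAt (fun y : Sp d => (y, q.2)) (ContinuousLinearMap.inl ℝ (Sp d) ℝ) q.1 :=
    hasFDerivAt_prodMk_left q.1 q.2
  have h1 : HasFDerivAt (fun y : Sp d => fderiv ℝ (fun q : Sp d × ℝ => v q.1 q.2) (y, q.2))
      ((fderiv ℝ (fderiv ℝ (fun q : Sp d × ℝ => v q.1 q.2)) q).comp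
        (ContinuousLinearMap.inl ℝ (Sp d) ℝ)) q.1 :=
    (hv.hasFDerivAt_fderiv hq).comp q.1 hp
  have h2 : fderiv ℝ (fun y => v y q.2) =ᶠ[𝓝 q.1] fun y =>
      (fderiv ℝ (fun q : Sp d × ℝ => v q.1 q.2) (y, q.2)).comp (ContinuousLinearMap.inl ℝ (Sp d) ℝ) := by
    filter_upwards [isOpen_compl_singleton.mem_nhds (mem_off.1 hq)] with y hy
    exact (hv.hasFDerivAt_left (q := (y, q.2)) (mem_off.2 hy)).fderiv
  have h3 := h1.clm_comp (hasFDerivAt_const (ContinuousLinearMap.inl ℝ (Sp d) ℝ) q.1)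
  rw [(h3.congr_of_eventuallyEq h2).fderiv]
  simp

end Reg
end
end Coulomb
namespace Coulomb
section
open Set Topology
variable {d : ℕ}

theorem contDiff_of_vanish {F : Type*} [NormedAddCommGroup F] [NormedSpace ℝ F] {Y : Sp d → F}
    {a : ℝ} (ha : 0 < a) (h : ∀ x, x ≠ 0 → ContDiffAt ℝ 1 Y x) (h0 : ∀ x, ‖x‖ < a → Y x = 0) :
    ContDiff ℝ 1 Y := by
  rw [contDiff_iff_contDiffAt]
  intro x
  by_cases hx : x = 0
  · have : Y =ᶠ[𝓝 x] fun _ => 0 := by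
      have hm : Metric.ball (0 : Sp d) a ∈ 𝓝 x := by
        rw [hx]; exact Metric.ball_mem_nhds _ ha
      filter_upwards [hm] with y hy
      exact h0 y (by simpa using hy)
    exact contDiffAt_const.congr_of_eventuallyEq this
  · exact h x hx

theorem hasCompactSupport_of_vanish {F : Type*} [Zero F] {Y : Sp d → F} {b : ℝ}
    (h1 : ∀ x, b < ‖x‖ → Y x = 0) : HasCompactSupport Y := by
  refine HasCompactSupport.intro (isCompact_closedBall (0 : Sp d) b) fun x hx => h1 x ?_
  simpa using hx

theorem integral_fderiv_eq_zero {P : Sp d → ℝ} (hP : ContDiff ℝ 1 P) (hc : HasCompactSupport P)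
    (w : Sp d) : ∫ x, fderiv ℝ P x w = 0 := by
  have hc' : Continuous fun x => fderiv ℝ P x w :=
    (hP.continuous_fderiv (by norm_num)).clm_apply continuous_const
  have hs : HasCompactSupport fun x => fderiv ℝ P x w :=
    (hc.fderiv ℝ).comp_left (g := fun L : Sp d →L[ℝ] ℝ => L w) (by simp)
  have h := integral_mul_fderiv_eq_neg_fderiv_mul_of_integrable (μ := (volume : Measure (Sp d)))
    (𝕜 := ℝ) (f := fun _ => (1 : ℝ)) (g := P) (v := w) (by simp)
    (by simpa using hc'.integrable_of_hasCompactSupport hs)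
    (by simpa using hP.continuous.integrable_of_hasCompactSupport hc)
    (fun _ _ => by fun_prop) (fun x _ => hP.differentiable (by norm_num) x)
  simpa using h

theorem integral_div_eq_zero {Y : Sp d → Sp d} (hY : ContDiff ℝ 1 Y) (hc : HasCompactSupport Y) :
    ∫ x, ∑ i : Fin d, inner ℝ (fderiv ℝ Y x (EuclideanSpace.single i 1))
      (EuclideanSpace.single i 1) = 0 := by
  have hd : ∀ (i : Fin d) x, fderiv ℝ (fun x => inner ℝ (Y x) (EuclideanSpace.single i 1)) x
      (EuclideanSpace.single i 1) = inner ℝ (fderiv ℝ Y x (EuclideanSpace.single i 1))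
      (EuclideanSpace.single i 1) := by
    intro i x
    rw [fderiv_inner_apply ℝ (hY.differentiable (by norm_num) x) (by fun_prop)]
    simp
  have hC : ∀ i : Fin d, ContDiff ℝ 1 fun x => inner ℝ (Y x) (EuclideanSpace.single i 1) :=
    fun i => hY.inner ℝ contDiff_const
  have hS : ∀ i : Fin d, HasCompactSupport fun x => inner ℝ (Y x) (EuclideanSpace.single i 1) :=
    fun i => hc.comp_left (g := fun y : Sp d => inner ℝ y (EuclideanSpace.single i 1)) (by simp)
  rw [integral_finsetSum]
  · refine Finset.sum_eq_zero fun i _ => ?_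
    simp_rw [← hd]
    exact integral_fderiv_eq_zero (hC i) (hS i) _
  · intro i _
    simp_rw [← hd]
    exact (((hC i).continuous_fderiv (by norm_num)).clm_apply
      continuous_const).integrable_of_hasCompactSupport
        (((hS i).fderiv ℝ).comp_left (g := fun L : Sp d →L[ℝ] ℝ => L _) (by simp))

theorem sum_inner_single (L : Sp d →L[ℝ] ℝ) (x : Sp d) :
    ∑ i : Fin d, L (EuclideanSpace.single i 1) * inner ℝ x (EuclideanSpace.single i 1) = L x := by
  conv_rhs => rw [← (EuclideanSpace.basisFun (Fin d) ℝ).sum_repr' x]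
  rw [map_sum]
  refine Finset.sum_congr rfl fun i _ => ?_
  rw [map_smul, real_inner_comm, EuclideanSpace.basisFun_apply, smul_eq_mul, mul_comm]

theorem integral_div_radial_add_eq_zero {α β : Sp d → ℝ} {G : Sp d → Sp d} {a b : ℝ} (ha : 0 < a)
    (hα : ∀ x, x ≠ 0 → ContDiffAt ℝ 1 α x) (hβ : ∀ x, x ≠ 0 → ContDiffAt ℝ 1 β x)
    (hG : ∀ x, x ≠ 0 → ContDiffAt ℝ 1 G x)
    (hα0 : ∀ x, ‖x‖ < a → α x = 0) (hα1 : ∀ x, b < ‖x‖ → α x = 0)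
    (hβ0 : ∀ x, ‖x‖ < a → β x = 0) (hβ1 : ∀ x, b < ‖x‖ → β x = 0) :
    ∫ x, (fderiv ℝ α x x + d * α x + fderiv ℝ β x (G x) +
      β x * ∑ i : Fin d, inner ℝ (fderiv ℝ G x (EuclideanSpace.single i 1))
      (EuclideanSpace.single i 1)) = 0 := by
  have hY : ContDiff ℝ 1 fun x => α x • x + β x • G x := by
    refine contDiff_of_vanish ha (fun x hx => ?_) fun x hx => ?_
    · exact ((hα x hx).smul contDiffAt_id).add ((hβ x hx).smul (hG x hx))
    · simp [hα0 x hx, hβ0 x hx]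
  have hc : HasCompactSupport fun x => α x • x + β x • G x :=
    hasCompactSupport_of_vanish (b := b) fun x hx => by simp [hα1 x hx, hβ1 x hx]
  rw [← integral_div_eq_zero hY hc]
  congr 1
  funext x
  by_cases hx : x = 0
  · have hm : Metric.ball (0 : Sp d) a ∈ 𝓝 x := by
      rw [hx]; exact Metric.ball_mem_nhds _ ha
    have h1 : α =ᶠ[𝓝 x] fun _ => 0 := by
      filter_upwards [hm] with y hy using hα0 y (by simpa using hy)
    have h2 : β =ᶠ[𝓝 x] fun _ => 0 := by
      filter_upwards [hm] with y hy using hβ0 y (by simpa using hy)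
    have h3 : (fun x => α x • x + β x • G x) =ᶠ[𝓝 x] fun _ => 0 := by
      filter_upwards [h1, h2] with y e1 e2
      simp [e1, e2]
    rw [h1.fderiv_eq, h2.fderiv_eq, h3.fderiv_eq, h1.eq_of_nhds, h2.eq_of_nhds]
    simp
  · have h1 := ((hα x hx).differentiableAt (by norm_num)).hasFDerivAt
    have h2 := ((hβ x hx).differentiableAt (by norm_num)).hasFDerivAt
    have h3 := ((hG x hx).differentiableAt (by norm_num)).hasFDerivAt
    have h := (h1.smul (hasFDerivAt_id x)).add (h2.smul h3)
    have h' : HasFDerivAt (fun x => α x • x + β x • G x) _ x := h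
    rw [h'.fderiv]
    have key : ∀ i : Fin d, inner ℝ ((EuclideanSpace.single i 1 : Sp d)) (EuclideanSpace.single i 1)
        = (1 : ℝ) := by
      intro i; simp
    simp only [id, add_apply, smul_apply,
      ContinuousLinearMap.smulRight_apply, inner_add_left, real_inner_smul_left,
      Finset.sum_add_distrib, sum_inner_single, ContinuousLinearMap.id_apply, key,
      ← Finset.mul_sum]
    simp
    ring

end
end Coulomb
namespace Coulomb
section
open Set Topology
variable {d : ℕ}

/-- The product of `|x|` with the radial derivative. -/
noncomputable def Qf (v : Sp d → ℝ → ℝ) (q : Sp d × ℝ) : ℝ := inner ℝ q.1 (gr v q)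

/-- The function `u_r + ((d-1)/2)·u/|x| + σ ∂ₜu`. -/
noncomputable def Lf (σ : ℝ) (v : Sp d → ℝ → ℝ) (q : Sp d × ℝ) : ℝ :=
  Qf v q / ‖q.1‖ + ((d : ℝ) - 1) / 2 * v q.1 q.2 / ‖q.1‖ + σ * vt v q

/-- The density `e'` as a function on space-time. -/
noncomputable def ef (p ζ : ℝ) (v : Sp d → ℝ → ℝ) (q : Sp d × ℝ) : ℝ :=
  1 / 2 * (‖gr v q‖ ^ 2 - (Qf v q / ‖q.1‖) ^ 2) + lam d / 2 * (v q.1 q.2) ^ 2 / ‖q.1‖ ^ 2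
    + (v q.1 q.2) ^ 2 / (2 * ‖q.1‖) + ζ * |v q.1 q.2| ^ (p + 1) / (p + 1)

/-- The inward (`σ = 1`) and outward (`σ = -1`) energy densities. -/
noncomputable def eS (p ζ σ : ℝ) (v : Sp d → ℝ → ℝ) (q : Sp d × ℝ) : ℝ :=
  1 / 4 * (Lf σ v q) ^ 2 + 1 / 2 * ef p ζ v q

/-- The Morawetz density as a function on space-time. -/
noncomputable def Mf (p ζ : ℝ) (v : Sp d → ℝ → ℝ) (q : Sp d × ℝ) : ℝ :=
  1 / 2 * (‖gr v q‖ ^ 2 - (Qf v q / ‖q.1‖) ^ 2) / ‖q.1‖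
    + lam d / 2 * (v q.1 q.2) ^ 2 / ‖q.1‖ ^ 3
    + ζ * ((d : ℝ) - 1) * (p - 1) * |v q.1 q.2| ^ (p + 1) / (4 * (p + 1) * ‖q.1‖)
    + (v q.1 q.2) ^ 2 / (4 * ‖q.1‖ ^ 2)

/-- The left-hand side of the Coulomb wave equation. -/
noncomputable def Sf (p ζ : ℝ) (v : Sp d → ℝ → ℝ) (q : Sp d × ℝ) : ℝ :=
  deriv (deriv (v q.1)) q.2 - lap (fun y => v y q.2) q.1 + v q.1 q.2 / ‖q.1‖
      + ζ * |v q.1 q.2| ^ (p - 1) * v q.1 q.2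

theorem rderiv_eq (v : Sp d → ℝ → ℝ) (q : Sp d × ℝ) :
    rderiv (fun y => v y q.2) q.1 = Qf v q / ‖q.1‖ := by
  rw [rderiv, Qf, gr, real_inner_smul_left]; ring

theorem norm_angGrad_sq (v : Sp d → ℝ → ℝ) (q : Sp d × ℝ) :
    ‖angGrad (fun y => v y q.2) q.1‖ ^ 2 = ‖gr v q‖ ^ 2 - (Qf v q / ‖q.1‖) ^ 2 := by
  rw [angGrad, rderiv_eq, norm_sub_sq_real]
  change ‖gr v q‖ ^ 2 - 2 * inner ℝ (gr v q) _ + _ = _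
  rw [real_inner_smul_right, real_inner_smul_right, real_inner_comm, norm_smul, norm_smul]
  change ‖gr v q‖ ^ 2 - 2 * (_ * (_ * Qf v q)) + _ = _
  rcases eq_or_ne q.1 0 with h | h
  · simp [h]
  · have : ‖q.1‖ ≠ 0 := by simpa using h
    simp only [norm_inv, Real.norm_eq_abs, abs_norm]
    rw [inv_mul_cancel₀ this, mul_one, sq_abs]
    field_simp
    ring

theorem ePrime_eq (p ζ : ℝ) (v : Sp d → ℝ → ℝ) (x : Sp d) (t : ℝ) :
    ePrime p ζ v x t = ef p ζ v (x, t) := by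
  have h := norm_angGrad_sq v (x, t)
  simp only [ePrime, ef] at h ⊢
  rw [h]

theorem eMinus_eq (p ζ : ℝ) (v : Sp d → ℝ → ℝ) (x : Sp d) (t : ℝ) :
    eMinus p ζ v x t = eS p ζ 1 v (x, t) := by
  have h := rderiv_eq v (x, t)
  simp only [eMinus, eS, ePrime_eq, Lplus, Lf, vt] at h ⊢
  rw [h, one_mul]

theorem Mden_eq (p ζ : ℝ) (v : Sp d → ℝ → ℝ) (x : Sp d) (t : ℝ) :
    Mden p ζ v x t = Mf p ζ v (x, t) := by
  have h := norm_angGrad_sq v (x, t)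
  simp only [Mden, Mf] at h ⊢
  rw [h]

theorem Sf_eq {v : Sp d → ℝ → ℝ} (hv : Reg v) (p ζ : ℝ) {q : Sp d × ℝ} (hq : q ∈ off d) :
    Sf p ζ v q = fderiv ℝ (vt v) q (0, 1) -
      ∑ i : Fin d, inner ℝ (fderiv ℝ (gr v) q (EuclideanSpace.single i 1, 0))
          (EuclideanSpace.single i 1) + v q.1 q.2 / ‖q.1‖
      + ζ * |v q.1 q.2| ^ (p - 1) * v q.1 q.2 := by
  rw [Sf, hv.deriv_deriv hq, hv.lap_eq hq]

/-- The admissible exponents and coefficients. -/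
def Adm (p ζ : ℝ) : Prop := 0 ≤ ζ ∧ (ζ = 0 ∨ 1 < p)

theorem contDiff_potential {p ζ : ℝ} (h : Adm p ζ) :
    ContDiff ℝ 1 fun y : ℝ => ζ * |y| ^ (p + 1) / (p + 1) := by
  rcases h.2 with h | h
  · simp only [h, zero_mul, zero_div]; exact contDiff_const
  · have h2 := contDiff_norm_rpow (E := ℝ) (p := p + 1) (by linarith)
    simp only [Real.norm_eq_abs] at h2
    exact (contDiff_const.mul h2).div_const _

theorem hasDerivAt_potential {p ζ : ℝ} (h : Adm p ζ) (y : ℝ) :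
    HasDerivAt (fun y : ℝ => ζ * |y| ^ (p + 1) / (p + 1)) (ζ * |y| ^ (p - 1) * y) y := by
  rcases h.2 with h | h
  · simp only [h, zero_mul, zero_div]; exact hasDerivAt_const _ _
  · have h2 := ((hasDerivAt_abs_rpow y (p := p + 1) (by linarith)).const_mul ζ).div_const (p + 1)
    have e : p + 1 - 2 = p - 1 := by ring
    rw [e] at h2
    have h0 : p + 1 ≠ 0 := by linarith
    refine h2.congr_deriv ?_
    field_simp

theorem potential_mul {p ζ : ℝ} (h : Adm p ζ) (y : ℝ) :
    ζ * |y| ^ (p - 1) * y * y = ζ * |y| ^ (p + 1) := by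
  rcases h.2 with h | h
  · simp [h]
  · have : |y| ^ (p + 1) = |y| ^ (p - 1) * |y| ^ (2 : ℝ) := by
      rw [← Real.rpow_add' (abs_nonneg _) (by linarith)]; ring_nf
    rw [this, Real.rpow_two, sq_abs]; ring

/-- A weight `γ` with continuous derivative `γ'` on the half-line. -/
structure Wt (γ γ' : ℝ → ℝ) : Prop where
  hasDeriv : ∀ r, 0 < r → HasDerivAt γ (γ' r) r
  cont : ContinuousOn γ' (Ioi 0)

theorem Wt.contDiffOn {γ γ' : ℝ → ℝ} (h : Wt γ γ') : ContDiffOn ℝ 1 γ (Ioi 0) := by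
  have : (1 : WithTop ℕ∞) = 0 + 1 := by simp
  rw [this, contDiffOn_succ_iff_deriv_of_isOpen isOpen_Ioi]
  refine ⟨fun r hr => (h.hasDeriv r hr).differentiableAt.differentiableWithinAt, by simp, ?_⟩
  rw [contDiffOn_zero]
  exact h.cont.congr fun r hr => (h.hasDeriv r hr).deriv

theorem Wt.mul {γ γ' δ δ' : ℝ → ℝ} (h : Wt γ γ') (k : Wt δ δ') :
    Wt (fun r => γ r * δ r) (fun r => γ' r * δ r + γ r * δ' r) :=
  ⟨fun r hr => (h.hasDeriv r hr).mul (k.hasDeriv r hr),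
    (h.cont.mul k.contDiffOn.continuousOn).add (h.contDiffOn.continuousOn.mul k.cont)⟩

theorem Wt.contDiffAt {γ γ' : ℝ → ℝ} (h : Wt γ γ') {q : Sp d × ℝ} (hq : q ∈ off d) :
    ContDiffAt ℝ 1 (fun q : Sp d × ℝ => γ ‖q.1‖) q := by
  have h1 : ContDiffAt ℝ 1 (fun q : Sp d × ℝ => ‖q.1‖) q :=
    contDiffAt_fst.norm ℝ (mem_off.1 hq)
  exact (h.contDiffOn.contDiffAt (Ioi_mem_nhds (by simpa using mem_off.1 hq))).comp q h1

section
variable {v : Sp d → ℝ → ℝ} (hv : Reg v) {q : Sp d × ℝ} (hq : q ∈ off d)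
include hq

theorem norm_contDiffAt : ContDiffAt ℝ 1 (fun q : Sp d × ℝ => ‖q.1‖) q :=
  contDiffAt_fst.norm ℝ (mem_off.1 hq)

include hv

theorem Reg.contDiffAt_one : ContDiffAt ℝ 1 (fun q : Sp d × ℝ => v q.1 q.2) q :=
  (hv.contDiffAt hq).of_le (by norm_num)

theorem Qf_contDiffAt : ContDiffAt ℝ 1 (Qf v) q :=
  contDiffAt_fst.inner ℝ (hv.gr_contDiffAt hq)

theorem Lf_contDiffAt (σ : ℝ) : ContDiffAt ℝ 1 (Lf σ v) q := by
  have h0 : ‖q.1‖ ≠ 0 := by simpa using mem_off.1 hq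
  exact (((Qf_contDiffAt hv hq).div (norm_contDiffAt hq) h0).add
    ((contDiffAt_const.mul (hv.contDiffAt_one hq)).div (norm_contDiffAt hq) h0)).add
    (contDiffAt_const.mul (hv.vt_contDiffAt hq))

theorem ef_contDiffAt {p ζ : ℝ} (h : Adm p ζ) : ContDiffAt ℝ 1 (ef p ζ v) q := by
  have h0 : ‖q.1‖ ≠ 0 := by simpa using mem_off.1 hq
  have hn := norm_contDiffAt hq
  have hu := hv.contDiffAt_one hq
  refine (((contDiffAt_const.mul (((hv.gr_contDiffAt hq).norm_sq ℝ).sub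
    (((Qf_contDiffAt hv hq).div hn h0).pow 2))).add
    ((contDiffAt_const.mul (hu.pow 2)).div (hn.pow 2) (by positivity))).add
    ((hu.pow 2).div (contDiffAt_const.mul hn) (by positivity))).add ?_
  exact ((contDiff_potential h).contDiffAt).comp q hu

theorem eS_contDiffAt {p ζ : ℝ} (h : Adm p ζ) (σ : ℝ) : ContDiffAt ℝ 1 (eS p ζ σ v) q :=
  (contDiffAt_const.mul ((Lf_contDiffAt hv hq σ).pow 2)).add
    (contDiffAt_const.mul (ef_contDiffAt hv hq h))

end

/-- First-order data of `v` along a curve in space-time suffices to differentiate `Lf`. -/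
theorem hasDerivAt_line {F : Type*} [NormedAddCommGroup F] [NormedSpace ℝ F] {f : Sp d × ℝ → F}
    {q : Sp d × ℝ} (w : Sp d × ℝ) (hf : ContDiffAt ℝ 1 f q) :
    HasDerivAt (fun s : ℝ => f (q + s • w)) (fderiv ℝ f q w) 0 := by
  have h1 : HasDerivAt (fun s : ℝ => q + s • w) w 0 := by
    simpa using ((hasDerivAt_id (0 : ℝ)).smul_const w).const_add q
  have h2 : HasFDerivAt f (fderiv ℝ f q) (q + (0 : ℝ) • w) := by
    simpa using (hf.differentiableAt (by norm_num)).hasFDerivAt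
  exact h2.comp_hasDerivAt (0 : ℝ) h1

theorem fderiv_eq_of_line {F : Type*} [NormedAddCommGroup F] [NormedSpace ℝ F] {f : Sp d × ℝ → F}
    {q w : Sp d × ℝ} (hf : ContDiffAt ℝ 1 f q) {D : F}
    (h : HasDerivAt (fun s : ℝ => f (q + s • w)) D 0) : fderiv ℝ f q w = D :=
  (hasDerivAt_line w hf).unique h

theorem fderiv_slice {F : Type*} [NormedAddCommGroup F] [NormedSpace ℝ F] {f : Sp d × ℝ → F}
    {x : Sp d} {t : ℝ} (hf : ContDiffAt ℝ 1 f (x, t)) (y : Sp d) :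
    fderiv ℝ (fun x => f (x, t)) x y = fderiv ℝ f (x, t) (y, 0) := by
  have hp : HasFDerivAt (fun y : Sp d => (y, t)) (ContinuousLinearMap.inl ℝ (Sp d) ℝ) x :=
    hasFDerivAt_prodMk_left x t
  have h2 : HasFDerivAt f (fderiv ℝ f (x, t)) (x, t) :=
    (hf.differentiableAt (by norm_num)).hasFDerivAt
  have h3 : HasFDerivAt (fun x => f (x, t)) _ x := h2.comp x hp
  rw [h3.fderiv]
  simp

end
end Coulomb
namespace Coulomb
section
open Set Topology
variable {d : ℕ}

section
variable {v : Sp d → ℝ → ℝ} (hv : Reg v) {q : Sp d × ℝ} (hq : q ∈ off d) (w : Sp d × ℝ)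
include hq

theorem norm_line : HasDerivAt (fun s : ℝ => ‖(q + s • w).1‖) (inner ℝ q.1 w.1 / ‖q.1‖) 0 := by
  have h1 : HasDerivAt (fun s : ℝ => (q + s • w).1) w.1 0 := by
    simpa using ((hasDerivAt_id (0 : ℝ)).smul_const w.1).const_add q.1
  have h2 := h1.norm_sq
  have h3 := h2.sqrt (by simpa using mem_off.1 hq)
  simp only [Real.sqrt_sq (norm_nonneg _)] at h3
  refine h3.congr_deriv ?_
  simp only [zero_smul, add_zero]
  field_simp

include hv

theorem val_line : HasDerivAt (fun s : ℝ => v (q + s • w).1 (q + s • w).2)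
    (inner ℝ (gr v q) w.1 + w.2 * vt v q) 0 := by
  rw [← hv.fderiv_apply hq]
  exact hasDerivAt_line w (hv.contDiffAt_one hq)

theorem Qf_line : HasDerivAt (fun s : ℝ => Qf v (q + s • w))
    (inner ℝ w.1 (gr v q) + inner ℝ q.1 (fderiv ℝ (gr v) q w)) 0 := by
  have h1 : HasDerivAt (fun s : ℝ => (q + s • w).1) w.1 0 := by
    simpa using ((hasDerivAt_id (0 : ℝ)).smul_const w.1).const_add q.1
  refine (h1.inner ℝ (hasDerivAt_line w (hv.gr_contDiffAt hq))).congr_deriv ?_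
  simp only [zero_smul, add_zero]
  ring

theorem gr_sq_line : HasDerivAt (fun s : ℝ => ‖gr v (q + s • w)‖ ^ 2)
    (2 * inner ℝ (gr v q) (fderiv ℝ (gr v) q w)) 0 := by
  refine (hasDerivAt_line w (hv.gr_contDiffAt hq)).norm_sq.congr_deriv ?_
  simp only [zero_smul, add_zero]

theorem Lf_line (σ : ℝ) : HasDerivAt (fun s : ℝ => Lf σ v (q + s • w))
    ((inner ℝ w.1 (gr v q) + inner ℝ q.1 (fderiv ℝ (gr v) q w)) / ‖q.1‖
      - Qf v q * (inner ℝ q.1 w.1 / ‖q.1‖) / ‖q.1‖ ^ 2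
      + ((d : ℝ) - 1) / 2 * ((inner ℝ (gr v q) w.1 + w.2 * vt v q) / ‖q.1‖
        - v q.1 q.2 * (inner ℝ q.1 w.1 / ‖q.1‖) / ‖q.1‖ ^ 2)
      + σ * fderiv ℝ (vt v) q w) 0 := by
  have h0 : ‖q.1‖ ≠ 0 := by simpa using mem_off.1 hq
  have hr := norm_line hq w
  have h := (((Qf_line hv hq w).div hr (by simpa using mem_off.1 hq)).add
    (((val_line hv hq w).const_mul (((d : ℝ) - 1) / 2)).div hr (by simpa using mem_off.1 hq))).add
    ((hasDerivAt_line w (hv.vt_contDiffAt hq)).const_mul σ)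
  refine h.congr_deriv ?_
  simp only [zero_smul, add_zero]
  field_simp

theorem ef_line {p ζ : ℝ} (hA : Adm p ζ) : HasDerivAt (fun s : ℝ => ef p ζ v (q + s • w))
    (inner ℝ (gr v q) (fderiv ℝ (gr v) q w)
      - Qf v q / ‖q.1‖ * ((inner ℝ w.1 (gr v q) + inner ℝ q.1 (fderiv ℝ (gr v) q w)) / ‖q.1‖
        - Qf v q * (inner ℝ q.1 w.1 / ‖q.1‖) / ‖q.1‖ ^ 2)
      + lam d * v q.1 q.2 * (inner ℝ (gr v q) w.1 + w.2 * vt v q) / ‖q.1‖ ^ 2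
      - lam d * v q.1 q.2 ^ 2 * (inner ℝ q.1 w.1 / ‖q.1‖) / ‖q.1‖ ^ 3
      + v q.1 q.2 * (inner ℝ (gr v q) w.1 + w.2 * vt v q) / ‖q.1‖
      - v q.1 q.2 ^ 2 * (inner ℝ q.1 w.1 / ‖q.1‖) / (2 * ‖q.1‖ ^ 2)
      + ζ * |v q.1 q.2| ^ (p - 1) * v q.1 q.2 * (inner ℝ (gr v q) w.1 + w.2 * vt v q)) 0 := by
  have h0 : ‖q.1‖ ≠ 0 := by simpa using mem_off.1 hq
  have h0' : ‖(q + (0 : ℝ) • w).1‖ ≠ 0 := by simpa using mem_off.1 hq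
  have hr := norm_line hq w
  have hu := val_line hv hq w
  have hW : HasDerivAt (fun y : ℝ => ζ * |y| ^ (p + 1) / (p + 1)) (ζ * |v q.1 q.2| ^ (p - 1) *
      v q.1 q.2) (v (q + (0 : ℝ) • w).1 (q + (0 : ℝ) • w).2) := by
    simpa using hasDerivAt_potential hA (v q.1 q.2)
  have h := ((((((gr_sq_line hv hq w).sub (((Qf_line hv hq w).div hr h0').pow 2)).const_mul
    (1 / 2)).add
    (((hu.pow 2).const_mul (lam d / 2)).div (hr.pow 2) (pow_ne_zero 2 h0'))).add
    ((hu.pow 2).div (hr.const_mul 2) (mul_ne_zero two_ne_zero h0')))).add (hW.comp (0 : ℝ) hu)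
  refine h.congr_deriv ?_
  simp only [zero_smul, add_zero, Pi.pow_apply, Pi.div_apply]
  generalize ζ * |v q.1 q.2| ^ (p - 1) * v q.1 q.2 = f
  generalize v q.1 q.2 = u
  generalize Qf v q = Q
  generalize vt v q = b
  generalize ‖q.1‖ = r at h0
  push_cast
  field_simp
  ring

end

/-- The radial coefficient of the multiplier vector field. -/
noncomputable def alf (γ : ℝ → ℝ) (p ζ σ : ℝ) (v : Sp d → ℝ → ℝ) (q : Sp d × ℝ) : ℝ :=
  γ ‖q.1‖ * ((1 / 4 * Lf σ v q ^ 2 - 1 / 2 * ef p ζ v q) / ‖q.1‖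
    - 1 / 2 * Lf σ v q * Qf v q / ‖q.1‖ ^ 2)

/-- The gradient coefficient of the multiplier vector field. -/
noncomputable def bet (γ : ℝ → ℝ) (σ : ℝ) (v : Sp d → ℝ → ℝ) (q : Sp d × ℝ) : ℝ :=
  1 / 2 * γ ‖q.1‖ * Lf σ v q

section
variable {γ γ' : ℝ → ℝ} (hγ : Wt γ γ') {p ζ : ℝ} (hA : Adm p ζ) (σ : ℝ)
  {v : Sp d → ℝ → ℝ} (hv : Reg v) {q : Sp d × ℝ} (hq : q ∈ off d)
include hγ hv hq

theorem bet_contDiffAt : ContDiffAt ℝ 1 (bet γ σ v) q :=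
  (contDiffAt_const.mul (hγ.contDiffAt hq)).mul (Lf_contDiffAt hv hq σ)

theorem alf_contDiffAt (hA : Adm p ζ) : ContDiffAt ℝ 1 (alf γ p ζ σ v) q := by
  have h0 : ‖q.1‖ ≠ 0 := by simpa using mem_off.1 hq
  have hL := Lf_contDiffAt hv hq σ
  have hn := norm_contDiffAt hq
  exact (hγ.contDiffAt hq).mul ((((contDiffAt_const.mul (hL.pow 2)).sub
    (contDiffAt_const.mul (ef_contDiffAt hv hq hA))).div hn h0).sub
    (((contDiffAt_const.mul hL).mul (Qf_contDiffAt hv hq)).div (hn.pow 2) (by positivity)))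

theorem pointwise_identity (hA : Adm p ζ) (hσ : σ ^ 2 = 1) :
    fderiv ℝ (alf γ p ζ σ v) q (q.1, 0) + d * alf γ p ζ σ v q + fderiv ℝ (bet γ σ v) q (gr v q, 0)
      + bet γ σ v q * ∑ i : Fin d, inner ℝ (fderiv ℝ (gr v) q (EuclideanSpace.single i 1, 0))
          (EuclideanSpace.single i 1)
    = σ * (γ ‖q.1‖ * fderiv ℝ (eS p ζ σ v) q (0, 1))
      + γ' ‖q.1‖ * (1 / 4 * Lf σ v q ^ 2 - 1 / 2 * ef p ζ v q)
      + γ ‖q.1‖ * Mf p ζ v q - 1 / 2 * γ ‖q.1‖ * Lf σ v q * Sf p ζ v q := by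
  have h0 : ‖q.1‖ ≠ 0 := by simpa using mem_off.1 hq
  have hrp : 0 < ‖q.1‖ := by positivity
  have hg : ∀ w : Sp d × ℝ, HasDerivAt (fun s : ℝ => γ ‖(q + s • w).1‖)
      (γ' ‖q.1‖ * (inner ℝ q.1 w.1 / ‖q.1‖)) 0 := by
    intro w
    have h1 : HasDerivAt γ (γ' ‖q.1‖) ‖(q + (0 : ℝ) • w).1‖ := by
      simpa using hγ.hasDeriv _ hrp
    exact h1.comp (0 : ℝ) (norm_line hq w)
  have e1 : fderiv ℝ (eS p ζ σ v) q (0, 1) = _ := fderiv_eq_of_line (eS_contDiffAt hv hq hA σ)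
    ((((Lf_line hv hq (0, 1) σ).pow 2).const_mul (1 / 4)).add
      ((ef_line hv hq (0, 1) hA).const_mul (1 / 2)))
  have e2 : fderiv ℝ (bet γ σ v) q (gr v q, 0) = _ := fderiv_eq_of_line
    (bet_contDiffAt hγ σ hv hq)
    (((hg (gr v q, 0)).const_mul (1 / 2)).mul (Lf_line hv hq (gr v q, 0) σ))
  have hL := Lf_line hv hq (q.1, 0) σ
  have hr := norm_line hq (q.1, 0)
  have e3 : fderiv ℝ (alf γ p ζ σ v) q (q.1, 0) = _ := fderiv_eq_of_line
    (alf_contDiffAt hγ σ hv hq hA)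
    ((hg (q.1, 0)).mul (((((hL.pow 2).const_mul (1 / 4)).sub
      ((ef_line hv hq (q.1, 0) hA).const_mul (1 / 2))).div hr (by simpa using mem_off.1 hq)).sub
      (((hL.const_mul (1 / 2)).mul (Qf_line hv hq (q.1, 0))).div (hr.pow 2)
        (by simpa using mem_off.1 hq))))
  rw [e1, e2, e3, Sf_eq hv p ζ hq]
  have a1 : inner ℝ q.1 q.1 = ‖q.1‖ ^ 2 := real_inner_self_eq_norm_sq _
  have a2 : inner ℝ q.1 (gr v q) = Qf v q := rfl
  have a3 : inner ℝ (gr v q) q.1 = Qf v q := real_inner_comm _ _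
  have a4 : inner ℝ (gr v q) (gr v q) = ‖gr v q‖ ^ 2 := real_inner_self_eq_norm_sq _
  have a5 : inner ℝ (gr v q) (fderiv ℝ (gr v) q (q.1, 0))
      = inner ℝ q.1 (fderiv ℝ (gr v) q (gr v q, 0)) := by
    rw [real_inner_comm, hv.inner_fderiv_gr_symm hq, real_inner_comm]
  have a6 : inner ℝ q.1 (fderiv ℝ (gr v) q (0, 1)) = fderiv ℝ (vt v) q (q.1, 0) := by
    rw [real_inner_comm, hv.inner_fderiv_gr_time hq]
  have a7 : inner ℝ (gr v q) (fderiv ℝ (gr v) q (0, 1)) = fderiv ℝ (vt v) q (gr v q, 0) := by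
    rw [real_inner_comm, hv.inner_fderiv_gr_time hq]
  have a8 := potential_mul hA (v q.1 q.2)
  have a9 : (p + 1) ≠ 0 ∨ ζ = 0 := by
    rcases hA.2 with h | h
    · exact Or.inr h
    · left; linarith
  simp only [zero_smul, add_zero, Pi.pow_apply, Pi.mul_apply, Pi.sub_apply, a1, a2, a3, a4, a5, a6,
    a7, inner_zero_right, inner_zero_left, zero_div, mul_zero, zero_mul, one_mul, zero_add]
  generalize hX : fderiv ℝ (vt v) q (q.1, 0) = Bx
  generalize hY : fderiv ℝ (vt v) q (gr v q, 0) = Bg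
  generalize hZ : fderiv ℝ (vt v) q (0, 1) = Bt
  generalize hU : inner ℝ q.1 (fderiv ℝ (gr v) q (gr v q, 0)) = Hg
  generalize hV : inner ℝ q.1 (fderiv ℝ (gr v) q (q.1, 0)) = Hx
  generalize (∑ i : Fin d, inner ℝ (fderiv ℝ (gr v) q (EuclideanSpace.single i 1, 0))
          (EuclideanSpace.single i 1)) = Δ
  have b1 : Mf p ζ v q = 1 / 2 * (‖gr v q‖ ^ 2 - (Qf v q / ‖q.1‖) ^ 2) / ‖q.1‖
    + lam d / 2 * (v q.1 q.2) ^ 2 / ‖q.1‖ ^ 3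
    + ((d : ℝ) - 1) / (4 * ‖q.1‖) * (ζ * |v q.1 q.2| ^ (p - 1) * v q.1 q.2 * v q.1 q.2
      - 2 * (ζ * |v q.1 q.2| ^ (p + 1) / (p + 1)))
    + (v q.1 q.2) ^ 2 / (4 * ‖q.1‖ ^ 2) := by
    rw [a8, Mf]
    rcases a9 with h | h
    · field_simp
      ring
    · simp [h]
  simp only [alf, bet, b1, ef, Lf, lam]
  generalize ζ * |v q.1 q.2| ^ (p + 1) / (p + 1) = W
  generalize ζ * |v q.1 q.2| ^ (p - 1) * v q.1 q.2 = f
  generalize v q.1 q.2 = u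
  generalize γ ‖q.1‖ = g
  generalize γ' ‖q.1‖ = g'
  generalize Qf v q = Q
  generalize ‖gr v q‖ = n
  generalize vt v q = b
  generalize ‖q.1‖ = r at h0
  have hs : σ = 1 ∨ σ = -1 := by
    rwa [← sq_eq_sq_iff_eq_or_eq_neg, one_pow]
  push_cast
  generalize (d : ℝ) = D
  rcases hs with rfl | rfl <;> field_simp <;> ring

end
end
end Coulomb
namespace Coulomb
section
open Set Topology
variable {d : ℕ}

/-- Lebesgue measure on the space-time slab `ℝ^d × (t₁, t₂]`. -/
noncomputable def slab (d : ℕ) (t1 t2 : ℝ) : Measure (Sp d × ℝ) :=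
  (volume : Measure (Sp d)).prod (volume.restrict (Ioc t1 t2))

instance (t1 t2 : ℝ) : SFinite (slab d t1 t2) := by unfold slab; infer_instance

theorem slab_eq (t1 t2 : ℝ) : slab d t1 t2 = (volume : Measure (Sp d × ℝ)).restrict (univ ×ˢ Ioc t1 t2) := by
  rw [slab, Measure.volume_eq_prod, ← Measure.prod_restrict, Measure.restrict_univ]

/-- A weight supported in the annulus `a ≤ |x| ≤ b`. -/
structure WtC (γ γ' : ℝ → ℝ) (a b : ℝ) : Prop extends Wt γ γ' where
  pos : 0 < a
  low : ∀ r, r < a → γ r = 0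
  high : ∀ r, b < r → γ r = 0
  low' : ∀ r, r < a → γ' r = 0
  high' : ∀ r, b < r → γ' r = 0

theorem WtC.mul {γ γ' δ δ' : ℝ → ℝ} {a b : ℝ} (h : WtC γ γ' a b) (k : Wt δ δ') :
    WtC (fun r => γ r * δ r) (fun r => γ' r * δ r + γ r * δ' r) a b where
  toWt := h.toWt.mul k
  pos := h.pos
  low r hr := by simp [h.low r hr]
  high r hr := by simp [h.high r hr]
  low' r hr := by simp [h.low r hr, h.low' r hr]
  high' r hr := by simp [h.high r hr, h.high' r hr]

theorem continuous_of_vanish {F : Sp d × ℝ → ℝ} {a : ℝ} (ha : 0 < a) (hF : ContinuousOn F (off d))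
    (h0 : ∀ q : Sp d × ℝ, ‖q.1‖ < a → F q = 0) : Continuous F := by
  rw [continuous_iff_continuousAt]
  intro q
  by_cases hq : q ∈ off d
  · exact hF.continuousAt (isOpen_off.mem_nhds hq)
  · have hm : {q : Sp d × ℝ | ‖q.1‖ < a} ∈ 𝓝 q := by
      refine IsOpen.mem_nhds (isOpen_lt (by fun_prop) continuous_const) ?_
      simp only [mem_off, not_not] at hq
      simpa [hq] using ha
    have : F =ᶠ[𝓝 q] fun _ => 0 := by
      filter_upwards [hm] with y hy using h0 y hy
    exact continuousAt_const.congr this.symm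

theorem integrable_slab_of_continuous {F : Sp d × ℝ → ℝ} (hF : Continuous F) {b : ℝ}
    (h1 : ∀ q : Sp d × ℝ, b < ‖q.1‖ → F q = 0) (t1 t2 : ℝ) : Integrable F (slab d t1 t2) := by
  rw [slab_eq]
  have hc : IsCompact (Metric.closedBall (0 : Sp d) b ×ˢ Icc t1 t2) :=
    (isCompact_closedBall _ _).prod isCompact_Icc
  refine (hF.continuousOn.integrableOn_compact (μ := volume) hc).of_forall_sdiff_eq_zero
    (MeasurableSet.univ.prod measurableSet_Ioc) fun q hq => h1 q ?_
  by_contra hcon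
  exact hq.2 ⟨by simpa using hcon, Ioc_subset_Icc_self hq.1.2⟩

theorem continuousOn_of_contDiffAt {F : Sp d × ℝ → ℝ} (h : ∀ q ∈ off d, ContDiffAt ℝ 1 F q) :
    ContinuousOn F (off d) := fun q hq => (h q hq).continuousAt.continuousWithinAt

theorem continuousOn_fderiv_of_contDiffAt {E : Type*} [NormedAddCommGroup E] [NormedSpace ℝ E]
    {F : Sp d × ℝ → E} (h : ∀ q ∈ off d, ContDiffAt ℝ 1 F q) :
    ContinuousOn (fderiv ℝ F) (off d) :=
  ContDiffOn.continuousOn_fderiv_of_isOpen (fun q hq => (h q hq).contDiffWithinAt) isOpen_off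
    (by norm_num)

section
variable {v : Sp d → ℝ → ℝ} (hv : Reg v)

theorem norm_pos_of_mem_off {q : Sp d × ℝ} (hq : q ∈ off d) : 0 < ‖q.1‖ := by
  simpa using mem_off.1 hq

theorem norm_ne_of_mem_off {q : Sp d × ℝ} (hq : q ∈ off d) : ‖q.1‖ ≠ 0 :=
  (norm_pos_of_mem_off hq).ne'

theorem ContinuousOn.comp_norm {g : ℝ → ℝ} (hg : ContinuousOn g (Ioi 0)) :
    ContinuousOn (fun q : Sp d × ℝ => g ‖q.1‖) (off d) :=
  hg.comp (by fun_prop) fun _ hq => norm_pos_of_mem_off hq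

include hv

theorem continuousOn_gr : ContinuousOn (gr v) (off d) :=
  fun q hq => (hv.gr_contDiffAt hq).continuousAt.continuousWithinAt

theorem continuousOn_vt : ContinuousOn (vt v) (off d) :=
  fun q hq => (hv.vt_contDiffAt hq).continuousAt.continuousWithinAt

theorem continuousOn_Lf (σ : ℝ) : ContinuousOn (Lf σ v) (off d) :=
  continuousOn_of_contDiffAt fun _ hq => Lf_contDiffAt hv hq σ

theorem continuousOn_Qf : ContinuousOn (Qf v) (off d) :=
  continuousOn_of_contDiffAt fun _ hq => Qf_contDiffAt hv hq

theorem continuousOn_ef {p ζ : ℝ} (hA : Adm p ζ) : ContinuousOn (ef p ζ v) (off d) :=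
  continuousOn_of_contDiffAt fun _ hq => ef_contDiffAt hv hq hA

theorem continuousOn_eS {p ζ : ℝ} (hA : Adm p ζ) (σ : ℝ) : ContinuousOn (eS p ζ σ v) (off d) :=
  continuousOn_of_contDiffAt fun _ hq => eS_contDiffAt hv hq hA σ

omit hv in
theorem continuous_abs_rpow_mul {p ζ : ℝ} (hA : Adm p ζ) :
    Continuous fun y : ℝ => ζ * |y| ^ (p - 1) * y := by
  rcases hA.2 with h | h
  · simp only [h, zero_mul]; exact continuous_const
  · exact (continuous_const.mul (continuous_abs.rpow_const fun _ => Or.inr (by linarith))).mul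
      continuous_id

theorem continuousOn_Mf {p ζ : ℝ} (hA : Adm p ζ) : ContinuousOn (Mf p ζ v) (off d) := by
  have hg := continuousOn_gr hv
  have hQ := continuousOn_Qf hv
  have hu : Continuous fun q : Sp d × ℝ => v q.1 q.2 := hv.cont
  have hW : Continuous fun q : Sp d × ℝ =>
      ((d : ℝ) - 1) * (p - 1) * (ζ * |v q.1 q.2| ^ (p + 1) / (p + 1)) :=
    continuous_const.mul ((contDiff_potential hA).continuous.comp hu)
  have hn : Continuous fun q : Sp d × ℝ => ‖q.1‖ := by fun_prop
  have h0 : ∀ q ∈ off d, ‖q.1‖ ≠ 0 := fun q hq => norm_ne_of_mem_off hq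
  have := ((((continuousOn_const (c := (1 / 2 : ℝ))).mul ((hg.norm.pow 2).sub
    ((hQ.div hn.continuousOn h0).pow 2))).div hn.continuousOn h0).add
    (((continuousOn_const (c := lam d / 2)).mul (hu.continuousOn.pow 2)).div (hn.continuousOn.pow 3)
    fun q hq => pow_ne_zero 3 (h0 q hq))).add
    (hW.continuousOn.div ((continuousOn_const (c := (4 : ℝ))).mul hn.continuousOn)
      fun q hq => mul_ne_zero four_ne_zero (h0 q hq))
  refine (this.add ((hu.continuousOn.pow 2).div ((continuousOn_const (c := (4 : ℝ))).mul
    (hn.continuousOn.pow 2)) fun q hq => mul_ne_zero four_ne_zero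
      (pow_ne_zero 2 (h0 q hq)))).congr fun q hq => ?_
  simp only [Mf, Pi.add_apply, Pi.mul_apply, Pi.div_apply, Pi.pow_apply, Pi.sub_apply]
  rcases hA.2 with h | h
  · simp [h]
  · have : p + 1 ≠ 0 := by linarith
    have := h0 q hq
    field_simp

theorem continuousOn_Sf {p ζ : ℝ} (hA : Adm p ζ) : ContinuousOn (Sf p ζ v) (off d) := by
  have hu : Continuous fun q : Sp d × ℝ => v q.1 q.2 := hv.cont
  have hn : Continuous fun q : Sp d × ℝ => ‖q.1‖ := by fun_prop
  have h1 := continuousOn_fderiv_of_contDiffAt fun q hq => hv.vt_contDiffAt (q := q) hq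
  have h2 := continuousOn_fderiv_of_contDiffAt fun q hq => hv.gr_contDiffAt (q := q) hq
  refine ContinuousOn.congr ?_ fun q hq => Sf_eq hv p ζ hq
  refine (((h1.clm_apply continuousOn_const).sub (continuousOn_finsetSum _ fun i _ =>
    (h2.clm_apply continuousOn_const).inner continuousOn_const)).add
    (hu.continuousOn.div hn.continuousOn fun q hq => norm_ne_of_mem_off hq)).add
    ((continuous_abs_rpow_mul hA).comp hu).continuousOn

end

section
variable {γ γ' : ℝ → ℝ} {a b : ℝ} {F : Sp d × ℝ → ℝ}

theorem continuous_weight (hγ : ContinuousOn γ (Ioi 0)) (ha : 0 < a) (h0 : ∀ r, r < a → γ r = 0)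
    (hF : ContinuousOn F (off d)) : Continuous fun q : Sp d × ℝ => γ ‖q.1‖ * F q :=
  continuous_of_vanish ha ((ContinuousOn.comp_norm hγ).mul hF) fun q hq => by simp [h0 _ hq]

theorem integrable_slab_weight (hγ : ContinuousOn γ (Ioi 0)) (ha : 0 < a)
    (h0 : ∀ r, r < a → γ r = 0) (h1 : ∀ r, b < r → γ r = 0)
    (hF : ContinuousOn F (off d)) (t1 t2 : ℝ) :
    Integrable (fun q : Sp d × ℝ => γ ‖q.1‖ * F q) (slab d t1 t2) :=
  integrable_slab_of_continuous (continuous_weight hγ ha h0 hF) (b := b)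
    (fun q hq => by simp [h1 _ hq]) t1 t2

theorem integrable_slice_weight (hγ : ContinuousOn γ (Ioi 0)) (ha : 0 < a)
    (h0 : ∀ r, r < a → γ r = 0) (h1 : ∀ r, b < r → γ r = 0)
    (hF : ContinuousOn F (off d)) (t : ℝ) :
    Integrable (fun x : Sp d => γ ‖x‖ * F (x, t)) :=
  ((continuous_weight hγ ha h0 hF).comp (by fun_prop : Continuous fun x : Sp d => (x, t))
    ).integrable_of_hasCompactSupport (hasCompactSupport_of_vanish (b := b) fun x hx => by
      simp [h1 _ hx])

theorem slice_contDiffAt {E : Type*} [NormedAddCommGroup E] [NormedSpace ℝ E] {f : Sp d × ℝ → E}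
    (hf : ∀ q ∈ off d, ContDiffAt ℝ 1 f q) (t : ℝ) (x : Sp d) (hx : x ≠ 0) :
    ContDiffAt ℝ 1 (fun x => f (x, t)) x :=
  (hf (x, t) (mem_off.2 hx)).comp x (contDiffAt_id.prodMk contDiffAt_const)

theorem slice_identity [NeZero d] (hγ : WtC γ γ' a b) {p ζ σ : ℝ} (hA : Adm p ζ) (hσ : σ ^ 2 = 1)
    {v : Sp d → ℝ → ℝ} (hv : Reg v) (t : ℝ) :
    ∫ x, (σ * (γ ‖x‖ * fderiv ℝ (eS p ζ σ v) (x, t) (0, 1))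
      + γ' ‖x‖ * (1 / 4 * Lf σ v (x, t) ^ 2 - 1 / 2 * ef p ζ v (x, t))
      + γ ‖x‖ * Mf p ζ v (x, t) - 1 / 2 * γ ‖x‖ * Lf σ v (x, t) * Sf p ζ v (x, t)) = 0 := by
  have hα : ∀ q ∈ off d, ContDiffAt ℝ 1 (alf γ p ζ σ v) q := fun q hq =>
    alf_contDiffAt hγ.toWt σ hv hq hA
  have hβ : ∀ q ∈ off d, ContDiffAt ℝ 1 (bet γ σ v) q := fun q hq =>
    bet_contDiffAt hγ.toWt σ hv hq
  have hG : ∀ q ∈ off d, ContDiffAt ℝ 1 (gr v) q := fun q hq => hv.gr_contDiffAt hq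
  rw [← integral_div_radial_add_eq_zero (b := b) hγ.pos (slice_contDiffAt hα t)
    (slice_contDiffAt hβ t)
    (slice_contDiffAt hG t) (fun x hx => by simp [alf, hγ.low _ hx])
    (fun x hx => by simp [alf, hγ.high _ hx]) (fun x hx => by simp [bet, hγ.low _ hx])
    (fun x hx => by simp [bet, hγ.high _ hx])]
  refine integral_congr_ae ?_
  have : Nonempty (Fin d) := ⟨0⟩
  have h0 : ∀ᵐ x : Sp d, x ≠ 0 := by
    exact Measure.ae_ne volume 0
  filter_upwards [h0] with x hx
  have hq : (x, t) ∈ off d := mem_off.2 hx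
  have h := pointwise_identity hγ.toWt σ hv hq hA hσ
  simp only [fderiv_slice (hα _ hq), fderiv_slice (hβ _ hq), fderiv_slice (hG _ hq)]
  simp only at h
  rw [h]

theorem hasDerivAt_time {f : Sp d × ℝ → ℝ} {x : Sp d} {t : ℝ} (hf : ContDiffAt ℝ 1 f (x, t)) :
    HasDerivAt (fun s => f (x, s)) (fderiv ℝ f (x, t) (0, 1)) t := by
  have h : HasDerivAt (fun s : ℝ => (x, s)) ((0 : Sp d), (1 : ℝ)) t :=
    (hasDerivAt_const _ _).prodMk (hasDerivAt_id _)
  exact (hf.differentiableAt (by norm_num)).hasFDerivAt.comp_hasDerivAt t h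

theorem integral_slab_time_deriv [NeZero d] (hγ : WtC γ γ' a b) {f : Sp d × ℝ → ℝ}
    (hf : ∀ q ∈ off d, ContDiffAt ℝ 1 f q) {t1 t2 : ℝ} (h12 : t1 ≤ t2) :
    ∫ q, γ ‖q.1‖ * fderiv ℝ f q (0, 1) ∂(slab d t1 t2)
      = (∫ x, γ ‖x‖ * f (x, t2)) - ∫ x, γ ‖x‖ * f (x, t1) := by
  have hγc := hγ.contDiffOn.continuousOn
  have hf' : ContinuousOn (fun q => fderiv ℝ f q (0, 1)) (off d) :=
    (continuousOn_fderiv_of_contDiffAt hf).clm_apply continuousOn_const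
  have hfc := continuousOn_of_contDiffAt hf
  have hi := integrable_slab_weight hγc hγ.pos hγ.low hγ.high hf' t1 t2
  rw [← integral_sub (integrable_slice_weight hγc hγ.pos hγ.low hγ.high hfc t2)
    (integrable_slice_weight hγc hγ.pos hγ.low hγ.high hfc t1)]
  rw [slab] at hi ⊢
  rw [integral_prod _ hi]
  refine integral_congr_ae ?_
  have : Nonempty (Fin d) := ⟨0⟩
  filter_upwards [Measure.ae_ne volume 0] with x hx
  rw [integral_const_mul, ← mul_sub, ← intervalIntegral.integral_of_le h12]
  congr 1
  refine intervalIntegral.integral_eq_sub_of_hasDerivAt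
    (fun s _ => hasDerivAt_time (hf (x, s) (mem_off.2 hx))) ?_
  refine ContinuousOn.intervalIntegrable ?_
  exact hf'.comp (by fun_prop : Continuous fun s : ℝ => (x, s)).continuousOn
    fun s _ => mem_off.2 hx

/-- The multiplier identity with weights supported away from the origin. -/
theorem basic_identity [NeZero d] (hγ : WtC γ γ' a b) {p ζ σ : ℝ} (hA : Adm p ζ) (hσ : σ ^ 2 = 1)
    {v : Sp d → ℝ → ℝ} (hv : Reg v) {t1 t2 : ℝ} (h12 : t1 ≤ t2) :
    σ * ((∫ x, γ ‖x‖ * eS p ζ σ v (x, t2)) - ∫ x, γ ‖x‖ * eS p ζ σ v (x, t1))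
      = ∫ q, (-(γ' ‖q.1‖ * (1 / 4 * Lf σ v q ^ 2 - 1 / 2 * ef p ζ v q))
        - γ ‖q.1‖ * Mf p ζ v q + γ ‖q.1‖ * (1 / 2 * Lf σ v q * Sf p ζ v q)) ∂(slab d t1 t2) := by
  have hγc := hγ.contDiffOn.continuousOn
  have he : ∀ q ∈ off d, ContDiffAt ℝ 1 (eS p ζ σ v) q := fun q hq => eS_contDiffAt hv hq hA σ
  have hL := continuousOn_Lf hv σ
  have i1 := (integrable_slab_weight hγc hγ.pos hγ.low hγ.high
    ((continuousOn_fderiv_of_contDiffAt he).clm_apply (continuousOn_const (c := (0, 1))))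
    t1 t2).const_mul σ
  have i2 := integrable_slab_weight hγ.cont hγ.pos hγ.low' hγ.high'
    (((continuousOn_const (c := (1 / 4 : ℝ))).mul (hL.pow 2)).sub
      ((continuousOn_const (c := (1 / 2 : ℝ))).mul (continuousOn_ef hv hA))) t1 t2
  have i3 := integrable_slab_weight hγc hγ.pos hγ.low hγ.high (continuousOn_Mf hv hA) t1 t2
  have i4 := integrable_slab_weight hγc hγ.pos hγ.low hγ.high
    (((continuousOn_const (c := (1 / 2 : ℝ))).mul hL).mul (continuousOn_Sf hv hA)) t1 t2
  have i5 : Integrable (fun q => -(γ' ‖q.1‖ * (1 / 4 * Lf σ v q ^ 2 - 1 / 2 * ef p ζ v q))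
      - γ ‖q.1‖ * Mf p ζ v q + γ ‖q.1‖ * (1 / 2 * Lf σ v q * Sf p ζ v q)) (slab d t1 t2) :=
    (i2.neg.sub i3).add i4
  rw [← integral_slab_time_deriv hγ he h12, ← integral_const_mul, ← sub_eq_zero,
    ← integral_sub i1 i5]
  have iall : Integrable (fun q => σ * (γ ‖q.1‖ * fderiv ℝ (eS p ζ σ v) q (0, 1)) -
      (-(γ' ‖q.1‖ * (1 / 4 * Lf σ v q ^ 2 - 1 / 2 * ef p ζ v q))
        - γ ‖q.1‖ * Mf p ζ v q + γ ‖q.1‖ * (1 / 2 * Lf σ v q * Sf p ζ v q))) (slab d t1 t2) :=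
    i1.sub i5
  rw [slab] at iall ⊢
  rw [integral_prod_symm _ iall]
  refine integral_eq_zero_of_ae (Eventually.of_forall fun t => ?_)
  rw [Pi.zero_apply, ← slice_identity hγ hA hσ hv t]
  refine integral_congr_ae (Eventually.of_forall fun x => ?_)
  ring

end
end
end Coulomb
namespace Coulomb
section
open Set Topology
variable {d : ℕ}

/-- The derivative of the standard smooth transition function. -/
noncomputable def sT' (x : ℝ) : ℝ := deriv Real.smoothTransition x

theorem hasDerivAt_smoothTransition (x : ℝ) : HasDerivAt Real.smoothTransition (sT' x) x :=
  ((Real.smoothTransition.contDiff (n := 1)).differentiable (by norm_num) x).hasDerivAt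

theorem continuous_sT' : Continuous sT' :=
  (Real.smoothTransition.contDiff (n := 1)).continuous_deriv (by norm_num)

theorem sT'_of_nonpos {x : ℝ} (hx : x ≤ 0) : sT' x = 0 :=
  IsLocalMin.deriv_eq_zero (Eventually.of_forall fun y => by
    rw [Real.smoothTransition.zero_of_nonpos hx]; exact Real.smoothTransition.nonneg y)

theorem sT'_of_one_le {x : ℝ} (hx : 1 ≤ x) : sT' x = 0 :=
  IsLocalMax.deriv_eq_zero (Eventually.of_forall fun y => by
    rw [Real.smoothTransition.one_of_one_le hx]; exact Real.smoothTransition.le_one y)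

theorem exists_bound_sT' : ∃ C, 0 ≤ C ∧ ∀ x, |sT' x| ≤ C := by
  obtain ⟨C, hC⟩ := (isCompact_Icc (a := (0 : ℝ)) (b := 1)).exists_bound_of_continuousOn
    continuous_sT'.continuousOn
  have h0 : 0 ≤ C := (norm_nonneg _).trans (hC 0 (by simp))
  refine ⟨C, h0, fun x => ?_⟩
  rcases le_total x 0 with h | h
  · simpa [sT'_of_nonpos h] using h0
  rcases le_total 1 x with h' | h'
  · simpa [sT'_of_one_le h'] using h0
  · exact hC x ⟨h, h'⟩

theorem wt_comp_affine (k c : ℝ) :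
    Wt (fun r => Real.smoothTransition (k * r + c)) (fun r => sT' (k * r + c) * k) where
  hasDeriv r _ := (hasDerivAt_smoothTransition _).comp r
    (by simpa using ((hasDerivAt_id r).const_mul k).add_const c)
  cont := ((continuous_sT'.comp (by fun_prop)).mul continuous_const).continuousOn

theorem exists_cutoff : ∃ (χ χ' : ℕ → ℝ → ℝ) (C : ℝ), 0 ≤ C ∧
    (∀ n, ∃ a b, WtC (χ n) (χ' n) a b) ∧ (∀ n r, 0 ≤ χ n r ∧ χ n r ≤ 1) ∧
    (∀ n r, 0 < r → r * |χ' n r| ≤ C) ∧ (∀ r, 0 < r → ∀ᶠ n in atTop, χ n r = 1 ∧ χ' n r = 0) := by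
  obtain ⟨C, hC0, hC⟩ := exists_bound_sT'
  let s := Real.smoothTransition
  have hn : ∀ n : ℕ, (0 : ℝ) < n + 1 := fun n => by positivity
  refine ⟨fun n r => s ((n + 1) * r + -1) * s (-(1 / (n + 1)) * r + 2),
    fun n r => sT' ((n + 1) * r + -1) * (n + 1) * s (-(1 / (n + 1)) * r + 2)
      + s ((n + 1) * r + -1) * (sT' (-(1 / (n + 1)) * r + 2) * -(1 / (n + 1))), 4 * C,
    by positivity, fun n => ⟨1 / (n + 1), 2 * (n + 1), ?_⟩, fun n r => ⟨?_, ?_⟩, fun n r hr => ?_,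
    fun r hr => ?_⟩
  · have low : ∀ r : ℝ, r < 1 / (n + 1) → (n + 1) * r + -1 ≤ 0 := by
      intro r hr
      rw [lt_div_iff₀ (hn n)] at hr
      linarith
    have high : ∀ r : ℝ, 2 * (n + 1) < r → -(1 / ((n : ℝ) + 1)) * r + 2 ≤ 0 := by
      intro r hr
      have : 2 < r / (n + 1) := by rwa [lt_div_iff₀ (hn n)]
      have e : -(1 / ((n : ℝ) + 1)) * r = -(r / (n + 1)) := by ring
      rw [e]; linarith
    refine ⟨(wt_comp_affine _ _).mul (wt_comp_affine _ _), by positivity, fun r hr => ?_,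
      fun r hr => ?_, fun r hr => ?_, fun r hr => ?_⟩
    · simp [s, Real.smoothTransition.zero_of_nonpos (low r hr)]
    · simp only [s, Real.smoothTransition.zero_of_nonpos (high r hr), mul_zero]
    · simp only [s, Real.smoothTransition.zero_of_nonpos (low r hr), sT'_of_nonpos (low r hr),
        zero_mul, add_zero]
    · simp only [s, Real.smoothTransition.zero_of_nonpos (high r hr), sT'_of_nonpos (high r hr),
        zero_mul, mul_zero, add_zero]
  · exact mul_nonneg (Real.smoothTransition.nonneg _) (Real.smoothTransition.nonneg _)
  · exact mul_le_one₀ (Real.smoothTransition.le_one _) (Real.smoothTransition.nonneg _)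
      (Real.smoothTransition.le_one _)
  · have ab : ∀ x, |s x| ≤ 1 := fun x => by
      rw [abs_of_nonneg (Real.smoothTransition.nonneg _)]; exact Real.smoothTransition.le_one _
    have b1 : |sT' ((n + 1) * r + -1)| * ((n + 1) * r) ≤ 2 * C := by
      rcases le_total ((n + 1) * r) 2 with h | h
      · nlinarith [hC ((n + 1) * r + -1), abs_nonneg (sT' ((n + 1) * r + -1)),
          mul_pos (hn n) hr]
      · rw [sT'_of_one_le (by linarith)]; simpa using hC0
    have b2 : |sT' (-(1 / (n + 1)) * r + 2)| * (1 / (n + 1) * r) ≤ 2 * C := by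
      have hp : 0 < 1 / ((n : ℝ) + 1) * r := by have := hn n; positivity
      rcases le_total (1 / (n + 1) * r) 2 with h | h
      · nlinarith [hC (-(1 / (n + 1)) * r + 2), abs_nonneg (sT' (-(1 / (n + 1)) * r + 2))]
      · rw [sT'_of_nonpos (by linarith)]; simpa using hC0
    have t1 : r * |sT' ((n + 1) * r + -1) * (n + 1) * s (-(1 / (n + 1)) * r + 2)| ≤ 2 * C := by
      rw [abs_mul, abs_mul, abs_of_pos (hn n)]
      calc _ = |sT' ((n + 1) * r + -1)| * ((n + 1) * r) * |s (-(1 / (n + 1)) * r + 2)| := by ring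
        _ ≤ 2 * C * 1 := mul_le_mul b1 (ab _) (abs_nonneg _) (by positivity)
        _ = 2 * C := by ring
    have t2 : r * |s ((n + 1) * r + -1) * (sT' (-(1 / (n + 1)) * r + 2) * -(1 / (n + 1)))|
        ≤ 2 * C := by
      rw [abs_mul, abs_mul, abs_neg, abs_of_pos (by have := hn n; positivity : 0 < 1 / ((n : ℝ) + 1))]
      calc _ = |sT' (-(1 / (n + 1)) * r + 2)| * (1 / (n + 1) * r) * |s ((n + 1) * r + -1)| := by
            ring
        _ ≤ 2 * C * 1 := mul_le_mul b2 (ab _) (abs_nonneg _) (by positivity)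
        _ = 2 * C := by ring
    refine (mul_le_mul_of_nonneg_left (abs_add_le _ _) hr.le).trans ?_
    rw [mul_add]
    linarith
  · filter_upwards [eventually_ge_atTop ⌈2 / r⌉₊, eventually_ge_atTop ⌈r⌉₊] with n h1 h2
    have h1' : 2 / r ≤ n := (Nat.le_ceil _).trans (by exact_mod_cast h1)
    have h2' : r ≤ n := (Nat.le_ceil _).trans (by exact_mod_cast h2)
    rw [div_le_iff₀ hr] at h1'
    have e1 : 1 ≤ ((n : ℝ) + 1) * r + -1 := by nlinarith
    have e2 : 1 ≤ -(1 / ((n : ℝ) + 1)) * r + 2 := by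
      have : r / (n + 1) ≤ 1 := by rw [div_le_one (hn n)]; linarith
      have e : -(1 / ((n : ℝ) + 1)) * r = -(r / (n + 1)) := by ring
      rw [e]; linarith
    simp only [s, Real.smoothTransition.one_of_one_le e1, Real.smoothTransition.one_of_one_le e2,
      sT'_of_one_le e1, sT'_of_one_le e2]
    simp

section meas
variable [NeZero d]

theorem ae_ne_zero : ∀ᵐ x : Sp d, x ≠ 0 := by
  have : Nonempty (Fin d) := ⟨0⟩
  exact Measure.ae_ne volume 0

theorem ae_mem_off (t1 t2 : ℝ) : ∀ᵐ q ∂(slab d t1 t2), q ∈ off d := by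
  have h : ∀ᵐ q ∂(slab d t1 t2), q.1 ≠ 0 :=
    Measure.quasiMeasurePreserving_fst.ae (ae_ne_zero (d := d))
  filter_upwards [h] with q hq using mem_off.2 hq

theorem aesm_slab {F : Sp d × ℝ → ℝ} (hF : ContinuousOn F (off d)) (t1 t2 : ℝ) :
    AEStronglyMeasurable F (slab d t1 t2) := by
  have h := hF.aestronglyMeasurable (μ := slab d t1 t2) isOpen_off.measurableSet
  rwa [Measure.restrict_eq_self_of_ae_mem (ae_mem_off t1 t2)] at h

theorem aesm_slice {F : Sp d × ℝ → ℝ} (hF : ContinuousOn F (off d)) (t : ℝ) :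
    AEStronglyMeasurable (fun x : Sp d => F (x, t)) := by
  have hc : ContinuousOn (fun x : Sp d => F (x, t)) {0}ᶜ :=
    hF.comp (by fun_prop : Continuous fun x : Sp d => (x, t)).continuousOn fun x hx => mem_off.2 hx
  have h := hc.aestronglyMeasurable (μ := volume) isOpen_compl_singleton.measurableSet
  rwa [Measure.restrict_eq_self_of_ae_mem] at h
  exact ae_ne_zero

end meas
end
end Coulomb
namespace Coulomb
section
open Set Topology
variable {d : ℕ}

/-- Energy density as a function on space-time. -/
noncomputable def eF (p ζ : ℝ) (v : Sp d → ℝ → ℝ) (q : Sp d × ℝ) : ℝ :=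
  1 / 2 * ‖gr v q‖ ^ 2 + 1 / 2 * vt v q ^ 2 + v q.1 q.2 ^ 2 / (2 * ‖q.1‖)
    + ζ * |v q.1 q.2| ^ (p + 1) / (p + 1)

/-- The energy density enlarged by the Hardy term. -/
noncomputable def Df (p ζ : ℝ) (v : Sp d → ℝ → ℝ) (q : Sp d × ℝ) : ℝ :=
  eF p ζ v q + v q.1 q.2 ^ 2 / ‖q.1‖ ^ 2

/-- Regular functions with uniformly bounded energy. -/
structure FE (p ζ : ℝ) (v : Sp d → ℝ → ℝ) : Prop where
  reg : Reg v
  adm : Adm p ζ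
  int : ∀ t, Integrable fun x => eF p ζ v (x, t)
  bdd : ∃ K, ∀ t, ∫ x, eF p ζ v (x, t) ≤ K

theorem potential_nonneg {p ζ : ℝ} (h : Adm p ζ) (y : ℝ) : 0 ≤ ζ * |y| ^ (p + 1) / (p + 1) := by
  rcases h.2 with h' | h'
  · simp [h']
  · have := h.1
    have : 0 < p + 1 := by linarith
    positivity

theorem eF_nonneg {p ζ : ℝ} (h : Adm p ζ) (v : Sp d → ℝ → ℝ) (q : Sp d × ℝ) : 0 ≤ eF p ζ v q := by
  have := potential_nonneg h (v q.1 q.2)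
  unfold eF; positivity

theorem Df_nonneg {p ζ : ℝ} (h : Adm p ζ) (v : Sp d → ℝ → ℝ) (q : Sp d × ℝ) : 0 ≤ Df p ζ v q := by
  have := eF_nonneg h v q
  unfold Df; positivity

theorem Qf_sq_le (v : Sp d → ℝ → ℝ) (q : Sp d × ℝ) : (Qf v q / ‖q.1‖) ^ 2 ≤ ‖gr v q‖ ^ 2 := by
  rcases eq_or_ne q.1 0 with h | h
  · simp [h]
  · have h0 : 0 < ‖q.1‖ := by simpa using h
    rw [sq_le_sq, abs_div, abs_norm, abs_norm, div_le_iff₀ h0, mul_comm]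
    exact abs_real_inner_le_norm _ _

/-- Elementary pieces are controlled by `Df`. -/
theorem le_Df {p ζ : ℝ} (h : Adm p ζ) (v : Sp d → ℝ → ℝ) (q : Sp d × ℝ) :
    ‖gr v q‖ ^ 2 ≤ 2 * Df p ζ v q ∧ vt v q ^ 2 ≤ 2 * Df p ζ v q ∧
    v q.1 q.2 ^ 2 / ‖q.1‖ ≤ 2 * Df p ζ v q ∧ v q.1 q.2 ^ 2 / ‖q.1‖ ^ 2 ≤ Df p ζ v q ∧
    ζ * |v q.1 q.2| ^ (p + 1) / (p + 1) ≤ Df p ζ v q ∧ eF p ζ v q ≤ Df p ζ v q := by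
  have h1 := potential_nonneg h (v q.1 q.2)
  have h2 : 0 ≤ v q.1 q.2 ^ 2 / ‖q.1‖ := by positivity
  have h3 : 0 ≤ v q.1 q.2 ^ 2 / ‖q.1‖ ^ 2 := by positivity
  have h4 := sq_nonneg ‖gr v q‖
  have h5 := sq_nonneg (vt v q)
  have e : v q.1 q.2 ^ 2 / (2 * ‖q.1‖) = 1 / 2 * (v q.1 q.2 ^ 2 / ‖q.1‖) := by
    rw [mul_comm, ← div_div]; ring
  unfold Df eF
  rw [e]
  refine ⟨by linarith, by linarith, by linarith, by linarith, by linarith, by linarith⟩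

set_option maxHeartbeats 800000 in
theorem exists_bound_Df {p ζ : ℝ} (h : Adm p ζ) : ∃ C, 0 ≤ C ∧ ∀ (v : Sp d → ℝ → ℝ) (q : Sp d × ℝ),
    (∀ σ : ℝ, σ ^ 2 = 1 → Lf σ v q ^ 2 ≤ C * Df p ζ v q) ∧ |ef p ζ v q| ≤ C * Df p ζ v q ∧
    ‖q.1‖ * |Mf p ζ v q| ≤ C * Df p ζ v q := by
  refine ⟨20 * ((d : ℝ) + 1) ^ 2 * (|p| + 1), by positivity, fun v q => ?_⟩
  obtain ⟨h1, h2, h3, h4, h5, h6⟩ := le_Df h v q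
  have hD := Df_nonneg h v q
  have hQ := Qf_sq_le v q
  have hW := potential_nonneg h (v q.1 q.2)
  have h3' : 0 ≤ v q.1 q.2 ^ 2 / ‖q.1‖ := by positivity
  have h4' : 0 ≤ v q.1 q.2 ^ 2 / ‖q.1‖ ^ 2 := by positivity
  have hd0 : (0 : ℝ) ≤ d := by positivity
  have hp0 := abs_nonneg p
  set A := Qf v q / ‖q.1‖
  have hC1 : 20 * ((d : ℝ) + 1) ^ 2 * Df p ζ v q ≤ 20 * ((d : ℝ) + 1) ^ 2 * (|p| + 1) * Df p ζ v q := by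
    have : 0 ≤ 20 * ((d : ℝ) + 1) ^ 2 * Df p ζ v q := by positivity
    nlinarith
  have hl : |lam d| ≤ ((d : ℝ) + 1) ^ 2 := by
    rw [lam, abs_le]; constructor <;> nlinarith
  have hd1 : 1 ≤ ((d : ℝ) + 1) ^ 2 := by nlinarith
  have hl' : |lam d / 2 * (v q.1 q.2) ^ 2 / ‖q.1‖ ^ 2| ≤ ((d : ℝ) + 1) ^ 2 * Df p ζ v q := by
    have e : lam d / 2 * (v q.1 q.2) ^ 2 / ‖q.1‖ ^ 2 = lam d / 2 * ((v q.1 q.2) ^ 2 / ‖q.1‖ ^ 2) := by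
      ring
    rw [e, abs_mul, abs_of_nonneg h4', abs_div, abs_two]
    have : |lam d| / 2 ≤ ((d : ℝ) + 1) ^ 2 := by
      have := abs_nonneg (lam d); linarith
    exact mul_le_mul this h4 h4' (by positivity)
  have eh : v q.1 q.2 ^ 2 / (2 * ‖q.1‖) = 1 / 2 * (v q.1 q.2 ^ 2 / ‖q.1‖) := by
    rw [mul_comm, ← div_div]; ring
  have hDD : Df p ζ v q ≤ ((d : ℝ) + 1) ^ 2 * Df p ζ v q := by nlinarith
  refine ⟨fun σ hσ => ?_, ?_, ?_⟩
  · refine le_trans ?_ hC1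
    set B := v q.1 q.2 / ‖q.1‖
    have e1 : v q.1 q.2 ^ 2 / ‖q.1‖ ^ 2 = B ^ 2 := by rw [div_pow]
    rw [e1] at h4 h4'
    have e2 : Lf σ v q = A + ((d : ℝ) - 1) / 2 * B + σ * vt v q := by
      simp only [Lf, A, B]; ring
    rw [e2]
    have e3 : (σ * vt v q) ^ 2 = vt v q ^ 2 := by rw [mul_pow, hσ, one_mul]
    have e4 : (((d : ℝ) - 1) / 2 * B) ^ 2 ≤ ((d : ℝ) + 1) ^ 2 / 4 * Df p ζ v q := by
      rw [mul_pow]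
      have : (((d : ℝ) - 1) / 2) ^ 2 ≤ ((d : ℝ) + 1) ^ 2 / 4 := by nlinarith
      exact mul_le_mul this h4 h4' (by positivity)
    have : (A + ((d : ℝ) - 1) / 2 * B + σ * vt v q) ^ 2
      ≤ 3 * (A ^ 2 + (((d : ℝ) - 1) / 2 * B) ^ 2 + (σ * vt v q) ^ 2) := by
      nlinarith [sq_nonneg (A - ((d : ℝ) - 1) / 2 * B), sq_nonneg (A - σ * vt v q),
        sq_nonneg (((d : ℝ) - 1) / 2 * B - σ * vt v q)]
    rw [e3] at this
    have hDD0 : 0 ≤ ((d : ℝ) + 1) ^ 2 * Df p ζ v q := by positivity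
    linarith
  · refine le_trans ?_ hC1
    have := abs_le.1 hl'
    have hA0 := sq_nonneg A
    have e0 : ef p ζ v q = 1 / 2 * (‖gr v q‖ ^ 2 - A ^ 2) + lam d / 2 * (v q.1 q.2) ^ 2 / ‖q.1‖ ^ 2
      + 1 / 2 * (v q.1 q.2 ^ 2 / ‖q.1‖) + ζ * |v q.1 q.2| ^ (p + 1) / (p + 1) := by
      rw [← eh]; rfl
    rw [e0, abs_le]
    constructor <;> linarith
  · have hl2 : ‖q.1‖ * Mf p ζ v q = ‖q.1‖ * (1 / 2 * (‖gr v q‖ ^ 2 - A ^ 2) / ‖q.1‖)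
      + ‖q.1‖ * (lam d / 2 * (v q.1 q.2) ^ 2 / ‖q.1‖ ^ 3)
      + ‖q.1‖ * (ζ * ((d : ℝ) - 1) * (p - 1) * |v q.1 q.2| ^ (p + 1) / (4 * (p + 1) * ‖q.1‖))
      + ‖q.1‖ * (v q.1 q.2 ^ 2 / (4 * ‖q.1‖ ^ 2)) := by simp only [Mf, A]; ring
    have hl3 : ‖q.1‖ * |Mf p ζ v q| = |‖q.1‖ * Mf p ζ v q| := by rw [abs_mul, abs_norm]
    have hA0 := sq_nonneg A
    rw [hl3, hl2]
    rcases eq_or_ne ‖q.1‖ 0 with h0 | h0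
    · simp only [h0, zero_mul, add_zero, abs_zero]; positivity
    have f1 : ‖q.1‖ * (1 / 2 * (‖gr v q‖ ^ 2 - A ^ 2) / ‖q.1‖) = 1 / 2 * (‖gr v q‖ ^ 2 - A ^ 2) := by
      field_simp
    have f2 : ‖q.1‖ * (lam d / 2 * (v q.1 q.2) ^ 2 / ‖q.1‖ ^ 3)
        = lam d / 2 * (v q.1 q.2) ^ 2 / ‖q.1‖ ^ 2 := by field_simp
    have f3 : ‖q.1‖ * (ζ * ((d : ℝ) - 1) * (p - 1) * |v q.1 q.2| ^ (p + 1) / (4 * (p + 1) * ‖q.1‖))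
        = ((d : ℝ) - 1) * (p - 1) / 4 * (ζ * |v q.1 q.2| ^ (p + 1) / (p + 1)) := by
      rcases h.2 with h' | h'
      · simp [h']
      · have : p + 1 ≠ 0 := by linarith
        field_simp
    have f4 : ‖q.1‖ * (v q.1 q.2 ^ 2 / (4 * ‖q.1‖ ^ 2)) = 1 / 4 * (v q.1 q.2 ^ 2 / ‖q.1‖) := by
      field_simp
    rw [f1, f2, f3, f4]
    have g3 : |((d : ℝ) - 1) * (p - 1) / 4 * (ζ * |v q.1 q.2| ^ (p + 1) / (p + 1))|
        ≤ ((d : ℝ) + 1) ^ 2 * (|p| + 1) * Df p ζ v q := by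
      rw [abs_mul, abs_of_nonneg hW]
      refine mul_le_mul ?_ h5 hW (by positivity)
      rw [abs_div, abs_mul]
      have k1 : |(d : ℝ) - 1| ≤ d + 1 := by rw [abs_le]; constructor <;> linarith
      have k2 : |p - 1| ≤ |p| + 1 := by
        have := abs_sub p 1; simpa using this
      have k3 : |(d : ℝ) - 1| * |p - 1| ≤ (d + 1) * (|p| + 1) :=
        mul_le_mul k1 k2 (abs_nonneg _) (by positivity)
      have k4 : |(4 : ℝ)| = 4 := by norm_num
      rw [k4]
      have k5 : 0 ≤ ((d : ℝ) + 1) * (|p| + 1) := by positivity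
      nlinarith
    have g2 := abs_le.1 hl'
    have g3' := abs_le.1 g3
    have hC2 : 5 * (((d : ℝ) + 1) ^ 2 * Df p ζ v q) ≤ 5 * (((d : ℝ) + 1) ^ 2 * (|p| + 1) * Df p ζ v q) := by
      have : 0 ≤ ((d : ℝ) + 1) ^ 2 * |p| * Df p ζ v q := by positivity
      linarith
    rw [abs_le]
    constructor <;> linarith

end
end Coulomb
namespace Coulomb
section
open Set Topology
variable {d : ℕ}

instance [h : Fact (4 ≤ d)] : NeZero d := ⟨by have := h.out; omega⟩

theorem continuousOn_eF {v : Sp d → ℝ → ℝ} (hv : Reg v) {p ζ : ℝ} (hA : Adm p ζ) :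
    ContinuousOn (eF p ζ v) (off d) := by
  have hu : Continuous fun q : Sp d × ℝ => v q.1 q.2 := hv.cont
  have hW : Continuous fun q : Sp d × ℝ => ζ * |v q.1 q.2| ^ (p + 1) / (p + 1) :=
    (contDiff_potential hA).continuous.comp hu
  have h1 := continuousOn_gr hv
  have h2 := continuousOn_vt hv
  have h3 : ContinuousOn (fun q : Sp d × ℝ => v q.1 q.2 ^ 2 / (2 * ‖q.1‖)) (off d) :=
    ContinuousOn.div (by fun_prop) (by fun_prop) fun q hq => by
      have := norm_ne_of_mem_off hq; positivity
  unfold eF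
  exact ((((h1.norm.pow 2).const_mul _).add ((h2.pow 2).const_mul _)).add h3).add hW.continuousOn

theorem continuousOn_sq_div {v : Sp d → ℝ → ℝ} (hv : Reg v) :
    ContinuousOn (fun q : Sp d × ℝ => v q.1 q.2 ^ 2 / ‖q.1‖ ^ 2) (off d) := by
  have hu : Continuous fun q : Sp d × ℝ => v q.1 q.2 := hv.cont
  exact ContinuousOn.div (by fun_prop) (by fun_prop) fun q hq => by
      have := norm_ne_of_mem_off hq; positivity

theorem continuousOn_Df {v : Sp d → ℝ → ℝ} (hv : Reg v) {p ζ : ℝ} (hA : Adm p ζ) :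
    ContinuousOn (Df p ζ v) (off d) :=
  (continuousOn_eF hv hA).add (continuousOn_sq_div hv)

/-- The truncated inverse square. -/
noncomputable def invSq (x : Sp d) : ℝ := if ‖x‖ ≤ 1 then (‖x‖ ^ 2)⁻¹ else 0

theorem invSq_nonneg (x : Sp d) : 0 ≤ invSq x := by unfold invSq; split_ifs <;> positivity

variable [hd : Fact (4 ≤ d)]

theorem integrable_invSq : Integrable (invSq (d := d)) := by
  have hd := hd.out
  have : Nontrivial (Sp d) := by
    have : Nonempty (Fin d) := ⟨0⟩
    infer_instance
  have hm : Measurable fun y : ℝ => if y ≤ 1 then (y ^ 2)⁻¹ else 0 :=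
    Measurable.ite (measurableSet_le (by fun_prop) (by fun_prop)) (by fun_prop) (by fun_prop)
  refine (integrable_fun_norm_addHaar (μ := (volume : Measure (Sp d)))
    (f := fun y => if y ≤ 1 then (y ^ 2)⁻¹ else 0)).2 ?_
  have h1 : IntegrableOn (fun y : ℝ => indicator (Ioc 0 1) (fun _ => (1 : ℝ)) y) (Ioi 0) := by
    refine Integrable.integrableOn ?_
    rw [integrable_indicator_iff measurableSet_Ioc]
    simp
  refine h1.mono' (by fun_prop) ?_
  refine (ae_restrict_iff' measurableSet_Ioi).2 (Eventually.of_forall fun y hy => ?_)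
  have hy0 : 0 < y := hy
  simp only [finrank_euclideanSpace, Fintype.card_fin, smul_eq_mul]
  by_cases h : y ≤ 1
  · rw [if_pos h, indicator_of_mem (show y ∈ Ioc (0 : ℝ) 1 from ⟨hy0, h⟩), Real.norm_of_nonneg (by positivity)]
    obtain ⟨k, rfl⟩ := Nat.exists_eq_add_of_le hd
    have e : y ^ (4 + k - 1) * (y ^ 2)⁻¹ = y ^ (k + 1) := by
      have : 4 + k - 1 = k + 1 + 2 := by omega
      rw [this, pow_add]; field_simp
    rw [e]
    exact pow_le_one₀ hy0.le h
  · rw [if_neg h]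
    simp [indicator_nonneg]

theorem integrable_invSq_slab (t1 t2 : ℝ) :
    Integrable (fun q : Sp d × ℝ => invSq q.1) (slab d t1 t2) := by
  have : Integrable (fun q : Sp d × ℝ => invSq q.1 * 1) (slab d t1 t2) :=
    Integrable.mul_prod integrable_invSq (integrable_const (1 : ℝ))
  simpa using this

omit hd in
/-- Local bound, uniformly on compact time intervals. -/
theorem exists_bound_ball {w : Sp d × ℝ → ℝ} (hw : Continuous w) (R t1 t2 : ℝ) :
    ∃ C, 0 ≤ C ∧ ∀ x : Sp d, ‖x‖ ≤ R → ∀ t ∈ Icc t1 t2, |w (x, t)| ≤ C := by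
  obtain ⟨C, hC⟩ := ((isCompact_closedBall (0 : Sp d) R).prod
    (isCompact_Icc (a := t1) (b := t2))).exists_bound_of_continuousOn hw.continuousOn
  refine ⟨max C 0, le_max_right _ _, fun x hx t ht => ?_⟩
  exact (hC (x, t) ⟨by simpa using hx, ht⟩).trans (le_max_left _ _)

omit hd in
theorem sq_div_le_of_bound {a r C I : ℝ} (hr : 0 ≤ r) (hI : 0 ≤ I) (hI' : r ≤ 1 → I = (r ^ 2)⁻¹)
    (h : r ≤ 1 → |a| ≤ C) : a ^ 2 / r ^ 2 ≤ C ^ 2 * I + a ^ 2 / r := by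
  by_cases h1 : r ≤ 1
  · rw [hI' h1]
    have : a ^ 2 ≤ C ^ 2 := by
      rw [← sq_abs a]; exact pow_le_pow_left₀ (abs_nonneg _) (h h1) 2
    have : 0 ≤ a ^ 2 / r := by positivity
    rw [div_eq_mul_inv]
    have : a ^ 2 * (r ^ 2)⁻¹ ≤ C ^ 2 * (r ^ 2)⁻¹ := by gcongr
    linarith
  · have h2 : 1 < r := not_le.1 h1
    have : a ^ 2 / r ^ 2 ≤ a ^ 2 / r := by
      apply div_le_div_of_nonneg_left (sq_nonneg a) (by linarith); nlinarith
    have : 0 ≤ C ^ 2 * I := by positivity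
    linarith

omit hd in
theorem invSq_of_le {x : Sp d} (h : ‖x‖ ≤ 1) : invSq x = (‖x‖ ^ 2)⁻¹ := if_pos h

section FE
variable {p ζ : ℝ} {v : Sp d → ℝ → ℝ} (hv : FE p ζ v)
include hv

omit hd in
theorem exists_Df_le (t1 t2 : ℝ) : ∃ C, 0 ≤ C ∧ ∀ x : Sp d, ∀ t ∈ Icc t1 t2,
    Df p ζ v (x, t) ≤ C * invSq x + 3 * eF p ζ v (x, t) := by
  obtain ⟨C, -, h⟩ := exists_bound_ball hv.reg.cont 1 t1 t2
  refine ⟨C ^ 2, by positivity, fun x t ht => ?_⟩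
  have h1 := sq_div_le_of_bound (a := v x t) (r := ‖x‖) (norm_nonneg x) (invSq_nonneg x) invSq_of_le
    fun hx => h x hx t ht
  have h2 : v x t ^ 2 / ‖x‖ ≤ 2 * eF p ζ v (x, t) := by
    have e : v x t ^ 2 / (2 * ‖x‖) = 1 / 2 * (v x t ^ 2 / ‖x‖) := by
      rw [mul_comm, ← div_div]; ring
    have := potential_nonneg hv.adm (v x t)
    simp only [eF, e]
    nlinarith [sq_nonneg ‖gr v (x, t)‖, sq_nonneg (vt v (x, t))]
  simp only [Df]
  linarith

theorem integrable_slice_Df (t : ℝ) : Integrable fun x => Df p ζ v (x, t) := by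
  obtain ⟨C, -, h⟩ := exists_Df_le hv t t
  refine Integrable.mono' ((integrable_invSq.const_mul C).add ((hv.int t).const_mul 3))
    (aesm_slice (continuousOn_Df hv.reg hv.adm) t) (Eventually.of_forall fun x => ?_)
  rw [Real.norm_of_nonneg (Df_nonneg hv.adm v _)]
  exact h x t ⟨le_rfl, le_rfl⟩

theorem integrable_slab_eF (t1 t2 : ℝ) : Integrable (eF p ζ v) (slab d t1 t2) := by
  have hm := aesm_slab (continuousOn_eF hv.reg hv.adm) t1 t2
  obtain ⟨K, hK⟩ := hv.bdd
  refine (integrable_prod_iff' hm).2 ⟨Eventually.of_forall hv.int, ?_⟩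
  have hm2 : AEStronglyMeasurable (fun y => ∫ x, ‖eF p ζ v (x, y)‖) (volume.restrict (Ioc t1 t2)) :=
    hm.norm.prod_swap.integral_prod_right'
  refine Integrable.mono' (integrable_const K) hm2 (Eventually.of_forall fun t => ?_)
  have e : ∀ x, ‖eF p ζ v (x, t)‖ = eF p ζ v (x, t) := fun x =>
    Real.norm_of_nonneg (eF_nonneg hv.adm v _)
  simp only [e]
  rw [Real.norm_of_nonneg (integral_nonneg fun x => eF_nonneg hv.adm v _)]
  exact hK t

omit hv in
theorem ae_slab_of_Icc {P : Sp d × ℝ → Prop} {t1 t2 : ℝ}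
    (h : ∀ q ∈ off d, q.2 ∈ Icc t1 t2 → P q) : ∀ᵐ q ∂(slab d t1 t2), P q := by
  have h2 : ∀ᵐ q ∂(slab d t1 t2), q.2 ∈ Ioc t1 t2 :=
    Measure.quasiMeasurePreserving_snd.ae (ae_restrict_mem measurableSet_Ioc)
  filter_upwards [ae_mem_off t1 t2, h2] with q h3 h4 using h q h3 (Ioc_subset_Icc_self h4)

theorem integrable_slab_Df (t1 t2 : ℝ) : Integrable (Df p ζ v) (slab d t1 t2) := by
  obtain ⟨C, -, h⟩ := exists_Df_le hv t1 t2
  refine Integrable.mono' (((integrable_invSq_slab t1 t2).const_mul C).add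
    ((integrable_slab_eF hv t1 t2).const_mul 3))
    (aesm_slab (continuousOn_Df hv.reg hv.adm) t1 t2) (ae_slab_of_Icc fun q _ hq => ?_)
  rw [Real.norm_of_nonneg (Df_nonneg hv.adm v _)]
  exact h q.1 q.2 hq

/-- Continuous functions dominated by the enlarged energy density are integrable on slabs. -/
theorem FE.integrable_slab {F : Sp d × ℝ → ℝ} (hF : ContinuousOn F (off d)) {C : ℝ}
    (h : ∀ q ∈ off d, |F q| ≤ C * Df p ζ v q) (t1 t2 : ℝ) : Integrable F (slab d t1 t2) :=
  Integrable.mono' ((integrable_slab_Df hv t1 t2).const_mul C) (aesm_slab hF t1 t2)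
    (ae_slab_of_Icc fun q hq _ => h q hq)

theorem FE.integrable_slice {F : Sp d × ℝ → ℝ} (hF : ContinuousOn F (off d)) {C : ℝ}
    (h : ∀ q ∈ off d, |F q| ≤ C * Df p ζ v q) (t : ℝ) : Integrable fun x => F (x, t) := by
  refine Integrable.mono' ((integrable_slice_Df hv t).const_mul C) (aesm_slice hF t) ?_
  filter_upwards [ae_ne_zero (d := d)] with x hx using h (x, t) (mem_off.2 hx)

end FE
end
end Coulomb
namespace Coulomb
section
open Set Topology
variable {d : ℕ}

/-- A bounded weight, vanishing at the origin at least linearly, with bounded derivative. -/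
structure WtB (φ φ' : ℝ → ℝ) (C : ℝ) : Prop extends Wt φ φ' where
  nonneg : 0 ≤ C
  bd : ∀ r, 0 < r → |φ r| ≤ C
  lin : ∀ r, 0 < r → |φ r| ≤ C * r
  bd' : ∀ r, 0 < r → |φ' r| ≤ C

theorem continuousOn_weight {φ : ℝ → ℝ} (h : ContinuousOn φ (Ioi 0)) :
    ContinuousOn (fun q : Sp d × ℝ => φ ‖q.1‖) (off d) :=
  h.comp (by fun_prop) fun _ hq => norm_pos_of_mem_off hq

theorem abs_eS_le {p ζ σ B D : ℝ} {v : Sp d → ℝ → ℝ} {q : Sp d × ℝ}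
    (h1 : Lf σ v q ^ 2 ≤ B * D) (h2 : |ef p ζ v q| ≤ B * D) : |eS p ζ σ v q| ≤ B * D := by
  have := abs_le.1 h2
  have := sq_nonneg (Lf σ v q)
  rw [eS, abs_le]; constructor <;> linarith

variable [hd : Fact (4 ≤ d)]

section
variable {p ζ : ℝ} {v : Sp d → ℝ → ℝ} (hv : FE p ζ v)
include hv

theorem tendsto_integral_cutoff_slice {χ : ℕ → ℝ → ℝ} (h1 : ∀ n, ContinuousOn (χ n) (Ioi 0))
    (h2 : ∀ n r, 0 ≤ χ n r ∧ χ n r ≤ 1) (h3 : ∀ r, 0 < r → ∀ᶠ n in atTop, χ n r = 1)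
    {F : Sp d × ℝ → ℝ} (hF : ContinuousOn F (off d)) {C : ℝ}
    (h : ∀ q ∈ off d, |F q| ≤ C * Df p ζ v q) (t : ℝ) :
    Tendsto (fun n => ∫ x, χ n ‖x‖ * F (x, t)) atTop (𝓝 (∫ x, F (x, t))) := by
  refine tendsto_integral_of_dominated_convergence (fun x => C * Df p ζ v (x, t))
    (fun n => ?_) ((integrable_slice_Df hv t).const_mul C) (fun n => ?_) ?_
  · exact aesm_slice (F := fun q => χ n ‖q.1‖ * F q) ((continuousOn_weight (h1 n)).mul hF) t
  · filter_upwards [ae_ne_zero (d := d)] with x hx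
    rw [Real.norm_eq_abs, abs_mul, abs_of_nonneg (h2 n _).1]
    have := h (x, t) (mem_off.2 hx)
    have h0 := abs_nonneg (F (x, t))
    nlinarith [(h2 n ‖x‖).2, (h2 n ‖x‖).1]
  · filter_upwards [ae_ne_zero (d := d)] with x hx
    refine tendsto_const_nhds.congr' ?_
    filter_upwards [h3 ‖x‖ (norm_pos_iff.2 hx)] with n hn
    rw [hn, one_mul]

/-- The basic identity for weights that are not compactly supported. -/
theorem weighted_identity {φ φ' : ℝ → ℝ} {C σ : ℝ} (hφ : WtB φ φ' C) (hσ : σ ^ 2 = 1) {t1 t2 : ℝ}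
    (h12 : t1 ≤ t2)
    (hS : Integrable (fun q => φ ‖q.1‖ * (1 / 2 * Lf σ v q * Sf p ζ v q)) (slab d t1 t2)) :
    σ * ((∫ x, φ ‖x‖ * eS p ζ σ v (x, t2)) - ∫ x, φ ‖x‖ * eS p ζ σ v (x, t1))
      = ∫ q, (-(φ' ‖q.1‖ * (1 / 4 * Lf σ v q ^ 2 - 1 / 2 * ef p ζ v q))
        - φ ‖q.1‖ * Mf p ζ v q + φ ‖q.1‖ * (1 / 2 * Lf σ v q * Sf p ζ v q)) ∂(slab d t1 t2) := by
  obtain ⟨χ, χ', C', hC', hχ, h01, hχ', hlim⟩ := exists_cutoff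
  obtain ⟨B, hB, hD⟩ := exists_bound_Df (d := d) hv.adm
  have hr := hv.reg
  have hA := hv.adm
  have hχc : ∀ n, ContinuousOn (χ n) (Ioi 0) := fun n => by
    obtain ⟨a, b, h⟩ := hχ n
    exact h.contDiffOn.continuousOn
  have hφc := hφ.contDiffOn.continuousOn
  have cφ := continuousOn_weight (d := d) hφc
  have hL := continuousOn_Lf hr σ
  have cE := continuousOn_eS hr hA σ
  have cM := continuousOn_Mf hr hA
  have ce := continuousOn_ef hr hA
  have cS := continuousOn_Sf hr hA
  have hT : ∀ t, Tendsto (fun n => ∫ x, (χ n ‖x‖ * φ ‖x‖) * eS p ζ σ v (x, t)) atTop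
      (𝓝 (∫ x, φ ‖x‖ * eS p ζ σ v (x, t))) := fun t => by
    have := tendsto_integral_cutoff_slice hv hχc h01 (fun r hr => (hlim r hr).mono fun n h => h.1)
      (F := fun q => φ ‖q.1‖ * eS p ζ σ v q) (cφ.mul cE) (C := C * B) (fun q hq => by
        rw [abs_mul, mul_assoc]
        exact mul_le_mul (hφ.bd _ (norm_pos_of_mem_off hq))
          (abs_eS_le ((hD v q).1 σ hσ) (hD v q).2.1) (abs_nonneg _) hφ.nonneg) t
    simpa only [mul_assoc] using this
  choose a b hab using hχ
  have hid := fun n => basic_identity ((hab n).mul hφ.toWt) hA hσ hr h12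
  refine tendsto_nhds_unique (((hT t2).sub (hT t1)).const_mul σ) ?_
  simp only [hid]
  refine tendsto_integral_of_dominated_convergence (fun q =>
    (C' * C + C) * (B * Df p ζ v q) + C * (B * Df p ζ v q)
      + |φ ‖q.1‖ * (1 / 2 * Lf σ v q * Sf p ζ v q)|) (fun n => ?_) ?_ (fun n => ?_) ?_
  · have h := hab n
    refine aesm_slab ?_ t1 t2
    have c1 := continuousOn_weight (d := d) (h.mul hφ.toWt).cont
    have c2 := continuousOn_weight (d := d) (h.mul hφ.toWt).contDiffOn.continuousOn
    exact ((c1.mul (((hL.pow 2).const_mul _).sub (ce.const_mul _))).neg.sub (c2.mul cM)).add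
      (c2.mul ((hL.const_mul _).mul cS))
  · have := integrable_slab_Df hv t1 t2
    exact (((this.const_mul _).const_mul _).add ((this.const_mul _).const_mul _)).add hS.abs
  · refine ae_slab_of_Icc fun q hq _ => ?_
    have hp := norm_pos_of_mem_off hq
    obtain ⟨k1, k2, k3⟩ := hD v q
    have k1 := k1 σ hσ
    have l1 := (h01 n ‖q.1‖).1
    have l2 := (h01 n ‖q.1‖).2
    have m1 : |χ' n ‖q.1‖ * φ ‖q.1‖ + χ n ‖q.1‖ * φ' ‖q.1‖| ≤ C' * C + C := by
      refine (abs_add_le _ _).trans (add_le_add ?_ ?_)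
      · rw [abs_mul]
        have : |χ' n ‖q.1‖| * |φ ‖q.1‖| ≤ |χ' n ‖q.1‖| * (C * ‖q.1‖) :=
          mul_le_mul_of_nonneg_left (hφ.lin _ hp) (abs_nonneg _)
        have h3 := mul_le_mul_of_nonneg_right (hχ' n _ hp) hφ.nonneg
        calc _ ≤ _ := this
          _ = ‖q.1‖ * |χ' n ‖q.1‖| * C := by ring
          _ ≤ _ := h3
      · rw [abs_mul, abs_of_nonneg l1]
        have := hφ.bd' _ hp
        have := abs_nonneg (φ' ‖q.1‖)
        nlinarith
    have m2 : |1 / 4 * Lf σ v q ^ 2 - 1 / 2 * ef p ζ v q| ≤ B * Df p ζ v q := by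
      have := abs_le.1 k2
      have := sq_nonneg (Lf σ v q)
      rw [abs_le]; constructor <;> linarith
    have m3 : |χ n ‖q.1‖ * φ ‖q.1‖ * Mf p ζ v q| ≤ C * (B * Df p ζ v q) := by
      rw [abs_mul, abs_mul, abs_of_nonneg l1]
      have e1 : χ n ‖q.1‖ * |φ ‖q.1‖| ≤ C * ‖q.1‖ := by
        have := hφ.lin _ hp
        have := abs_nonneg (φ ‖q.1‖)
        nlinarith
      have e2 := mul_le_mul_of_nonneg_right e1 (abs_nonneg (Mf p ζ v q))
      have e3 := mul_le_mul_of_nonneg_left k3 hφ.nonneg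
      calc _ ≤ _ := e2
        _ = C * (‖q.1‖ * |Mf p ζ v q|) := by ring
        _ ≤ _ := e3
    have m4 : |χ n ‖q.1‖ * φ ‖q.1‖ * (1 / 2 * Lf σ v q * Sf p ζ v q)|
        ≤ |φ ‖q.1‖ * (1 / 2 * Lf σ v q * Sf p ζ v q)| := by
      rw [mul_assoc, abs_mul, abs_of_nonneg l1]
      exact mul_le_of_le_one_left (abs_nonneg _) l2
    have m5 := mul_le_mul m1 m2 (abs_nonneg _) (add_nonneg (mul_nonneg hC' hφ.nonneg) hφ.nonneg)
    rw [← abs_mul] at m5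
    rw [Real.norm_eq_abs]
    refine (abs_add_le _ _).trans (add_le_add ((abs_sub _ _).trans (add_le_add ?_ m3)) m4)
    rw [abs_neg]
    exact m5
  · refine ae_slab_of_Icc fun q hq _ => ?_
    refine tendsto_const_nhds.congr' ?_
    filter_upwards [hlim ‖q.1‖ (norm_pos_of_mem_off hq)] with n hn
    rw [hn.1, hn.2]
    simp only [one_mul, zero_mul, zero_add]

end
end
end Coulomb
namespace Coulomb
section
open Set Topology
variable {d : ℕ} [hd : Fact (4 ≤ d)]

theorem wt_inv_sq : Wt (fun r => (r ^ 2)⁻¹) (fun r => -(2 * r) / (r ^ 2) ^ 2) where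
  hasDeriv r hr := by
    have h0 : (0 : ℝ) < r := hr
    exact ((hasDerivAt_pow 2 r).inv (by positivity)).congr_deriv (by simp)
  cont := by
    refine ContinuousOn.div (by fun_prop) (by fun_prop) fun r hr => ?_
    have : (0 : ℝ) < r := hr
    positivity

theorem integral_hardy_weight {γ γ' : ℝ → ℝ} {a b : ℝ} (hγ : WtC γ γ' a b) {v : Sp d → ℝ → ℝ}
    (hv : Reg v) (t : ℝ) :
    ∫ x, (γ' ‖x‖ * ‖x‖ * v x t ^ 2 + γ ‖x‖ * (2 * v x t * Qf v (x, t) + d * v x t ^ 2)) = 0 := by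
  have hα : ∀ q ∈ off d, ContDiffAt ℝ 1 (fun q : Sp d × ℝ => γ ‖q.1‖ * v q.1 q.2 ^ 2) q :=
    fun q hq => (hγ.contDiffAt hq).mul ((hv.contDiffAt_one hq).pow 2)
  have h := integral_div_radial_add_eq_zero (d := d) (b := b) hγ.pos (slice_contDiffAt hα t)
    (β := fun _ => 0) (G := fun _ => 0) (fun x _ => contDiffAt_const) (fun x _ => contDiffAt_const)
    (fun x hx => by simp [hγ.low _ hx])
    (fun x hx => by simp [hγ.high _ hx]) (fun x hx => rfl) (fun x hx => rfl)
  rw [← h]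
  refine integral_congr_ae ?_
  filter_upwards [ae_ne_zero (d := d)] with x hx
  have hq : (x, t) ∈ off d := mem_off.2 hx
  have hx0 : 0 < ‖x‖ := norm_pos_iff.2 hx
  rw [fderiv_slice (hα _ hq)]
  have h1 := norm_line hq (x, 0)
  have h2 := val_line hv hq (x, 0)
  have h3 : HasDerivAt (fun s : ℝ => γ ‖((x, t) + s • ((x, 0) : Sp d × ℝ)).1‖) _ 0 :=
    HasDerivAt.comp 0 (by simpa using hγ.hasDeriv ‖x‖ hx0) h1
  rw [fderiv_eq_of_line (hα _ hq) (h3.mul (h2.pow 2))]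
  have e : inner ℝ x x = ‖x‖ ^ 2 := real_inner_self_eq_norm_sq x
  simp only [Pi.pow_apply, zero_smul, add_zero, e, zero_mul, fderiv_fun_const, Pi.zero_apply,
    zero_apply, Qf, real_inner_comm]
  field_simp
  ring

section
variable {p ζ : ℝ} {v : Sp d → ℝ → ℝ} (hv : FE p ζ v)
include hv

theorem integral_hardy (t : ℝ) :
    ∫ x, (2 * v x t * Qf v (x, t) + (d - 2) * v x t ^ 2) / ‖x‖ ^ 2 = 0 := by
  obtain ⟨χ, χ', C', hC', hχ, h01, hχ', hlim⟩ := exists_cutoff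
  choose a b hab using hχ
  have hr := hv.reg
  have hu : Continuous fun q : Sp d × ℝ => v q.1 q.2 := hr.cont
  have cH : ContinuousOn (fun q : Sp d × ℝ =>
      (2 * v q.1 q.2 * Qf v q + (d - 2) * v q.1 q.2 ^ 2) / ‖q.1‖ ^ 2) (off d) := by
    have cQ := continuousOn_Qf hr
    refine ContinuousOn.div ?_ (by fun_prop) fun q hq => by
      have := norm_ne_of_mem_off hq; positivity
    exact ((by fun_prop : Continuous fun q : Sp d × ℝ => 2 * v q.1 q.2).continuousOn.mul cQ).add
      (by fun_prop)
  have bH : ∀ q ∈ off d, |(2 * v q.1 q.2 * Qf v q + (d - 2) * v q.1 q.2 ^ 2) / ‖q.1‖ ^ 2|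
      ≤ (3 + d) * Df p ζ v q := fun q hq => by
    obtain ⟨h1, -, -, h4, -, -⟩ := le_Df hv.adm v q
    have hQ := Qf_sq_le v q
    have h0 := norm_ne_of_mem_off hq
    have hD := Df_nonneg hv.adm v q
    have e : (2 * v q.1 q.2 * Qf v q + (d - 2) * v q.1 q.2 ^ 2) / ‖q.1‖ ^ 2
        = 2 * (v q.1 q.2 / ‖q.1‖) * (Qf v q / ‖q.1‖) + (d - 2) * (v q.1 q.2 / ‖q.1‖) ^ 2 := by
      field_simp
    rw [← div_pow] at h4
    rw [e]
    generalize v q.1 q.2 / ‖q.1‖ = A at *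
    generalize Qf v q / ‖q.1‖ = B at *
    have hd' : (4 : ℝ) ≤ d := by exact_mod_cast hd.out
    have h5 : ((d : ℝ) - 2) * A ^ 2 ≤ (d - 2) * Df p ζ v q :=
      mul_le_mul_of_nonneg_left h4 (by linarith)
    have h6 : 0 ≤ ((d : ℝ) - 2) * A ^ 2 := mul_nonneg (by linarith) (sq_nonneg _)
    have h7 : 0 ≤ (d : ℝ) * Df p ζ v q := by positivity
    rw [abs_le]
    constructor <;> nlinarith [sq_nonneg (A + B), sq_nonneg (A - B)]
  have hχc : ∀ n, ContinuousOn (χ n) (Ioi 0) := fun n => (hab n).contDiffOn.continuousOn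
  have hT1 := tendsto_integral_cutoff_slice hv hχc h01
    (fun r hr => (hlim r hr).mono fun n h => h.1) cH bH t
  have cV := continuousOn_sq_div hr
  have cχ' : ∀ n, ContinuousOn (fun q : Sp d × ℝ => χ' n ‖q.1‖ * ‖q.1‖ * (v q.1 q.2 ^ 2 / ‖q.1‖ ^ 2))
      (off d) := fun n =>
    ((continuousOn_weight (hab n).cont).mul (by fun_prop)).mul cV
  have hb : ∀ n, ∀ q ∈ off d, |χ' n ‖q.1‖ * ‖q.1‖ * (v q.1 q.2 ^ 2 / ‖q.1‖ ^ 2)| ≤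
      C' * Df p ζ v q := fun n q hq => by
    obtain ⟨-, -, -, h4, -, -⟩ := le_Df hv.adm v q
    rw [abs_mul, abs_mul, abs_norm, mul_comm |χ' n ‖q.1‖|,
      abs_of_nonneg (by positivity : 0 ≤ v q.1 q.2 ^ 2 / ‖q.1‖ ^ 2)]
    exact mul_le_mul (hχ' n _ (norm_pos_of_mem_off hq)) h4 (by positivity) hC'
  have hT2 : Tendsto (fun n => ∫ x, χ' n ‖x‖ * ‖x‖ * (v x t ^ 2 / ‖x‖ ^ 2)) atTop
      (𝓝 (∫ x : Sp d, 0)) := by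
    refine tendsto_integral_of_dominated_convergence (fun x => C' * Df p ζ v (x, t))
      (fun n => aesm_slice (cχ' n) t) ((integrable_slice_Df hv t).const_mul C') (fun n => ?_) ?_
    · filter_upwards [ae_ne_zero (d := d)] with x hx using hb n (x, t) (mem_off.2 hx)
    · filter_upwards [ae_ne_zero (d := d)] with x hx
      refine tendsto_const_nhds.congr' ?_
      filter_upwards [hlim ‖x‖ (norm_pos_iff.2 hx)] with n hn
      simp [hn.2]
  have hs := hT2.add hT1
  rw [integral_zero, zero_add] at hs
  refine tendsto_nhds_unique hs (tendsto_const_nhds.congr fun n => ?_)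
  rw [← integral_hardy_weight ((hab n).mul wt_inv_sq) hr t, ← integral_add]
  · refine integral_congr_ae ?_
    filter_upwards [ae_ne_zero (d := d)] with x hx
    have hx0 : 0 < ‖x‖ := norm_pos_iff.2 hx
    field_simp
    ring
  · exact FE.integrable_slice hv (cχ' n) (hb n) t
  · refine FE.integrable_slice hv ((continuousOn_weight (hχc n)).mul cH) (C := 3 + d) (fun q hq => ?_) t
    rw [Pi.mul_apply, abs_mul, abs_of_nonneg (h01 n _).1]
    exact (mul_le_of_le_one_left (abs_nonneg _) (h01 n _).2).trans (bH q hq)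

theorem integrable_eS (σ : ℝ) (hσ : σ ^ 2 = 1) (t : ℝ) : Integrable fun x => eS p ζ σ v (x, t) := by
  obtain ⟨B, hB, hD⟩ := exists_bound_Df (d := d) hv.adm
  exact FE.integrable_slice hv (continuousOn_eS hv.reg hv.adm σ) (C := B)
    (fun q _ => abs_eS_le ((hD v q).1 σ hσ) (hD v q).2.1) t

/-- The inward and outward energies add up to the energy. -/
theorem integral_eS_add (t : ℝ) :
    (∫ x, eS p ζ 1 v (x, t)) + ∫ x, eS p ζ (-1) v (x, t) = ∫ x, eF p ζ v (x, t) := by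
  rw [← integral_add (integrable_eS hv 1 (by norm_num) t) (integrable_eS hv (-1) (by norm_num) t)]
  rw [← sub_eq_zero, ← integral_sub]
  · rw [← mul_zero (((d : ℝ) - 1) / 4), ← integral_hardy hv t, ← integral_const_mul]
    refine integral_congr_ae ?_
    filter_upwards [ae_ne_zero (d := d)] with x hx
    have hx0 : 0 < ‖x‖ := norm_pos_iff.2 hx
    simp only [eS, Lf, ef, eF, lam]
    field_simp
    ring
  · exact (integrable_eS hv 1 (by norm_num) t).add (integrable_eS hv (-1) (by norm_num) t)
  · exact hv.int t

end
end
end Coulomb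
namespace Coulomb
section
open Set Topology

/-- The Morawetz weight at scale `ρ`. -/
noncomputable def ph (ρ r : ℝ) : ℝ := r / (r + ρ)

/-- Derivative of the Morawetz weight at scale `ρ`. -/
noncomputable def ph' (ρ r : ℝ) : ℝ := ρ / (r + ρ) ^ 2

section
variable {ρ r : ℝ} (hρ : 0 < ρ) (hr : 0 < r)
include hρ hr

theorem ph_nonneg : 0 ≤ ph ρ r := by unfold ph; positivity

theorem ph_le_one : ph ρ r ≤ 1 := by
  unfold ph; rw [div_le_one (by positivity)]; linarith

theorem ph_le_lin : ph ρ r ≤ r / ρ := by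
  unfold ph
  exact div_le_div_of_nonneg_left hr.le hρ (by linarith)

theorem ph'_nonneg : 0 ≤ ph' ρ r := by unfold ph'; positivity

theorem ph'_le_inv : ph' ρ r ≤ 1 / ρ := by
  unfold ph'
  rw [div_le_div_iff₀ (by positivity) hρ]
  nlinarith

theorem ph'_le : ph' ρ r ≤ 1 / r := by
  unfold ph'
  rw [div_le_div_iff₀ (by positivity) hr]
  nlinarith [mul_pos hρ hr, sq_nonneg r]

theorem ph_sub : ph ρ r - r * ph' ρ r = ph ρ r ^ 2 := by
  unfold ph ph'
  field_simp
  ring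

end

theorem wtB_ph {ρ : ℝ} (hρ : 0 < ρ) : WtB (ph ρ) (ph' ρ) (1 + 1 / ρ) where
  hasDeriv r hr := by
    have h1 : HasDerivAt (fun r : ℝ => r + ρ) 1 r := (hasDerivAt_id r).add_const ρ
    refine ((hasDerivAt_id r).div h1 (by positivity)).congr_deriv ?_
    simp [ph']
  cont := ContinuousOn.div (by fun_prop) (by fun_prop) fun r hr => by
    have : (0 : ℝ) < r := hr
    positivity
  nonneg := by positivity
  bd r hr := by
    rw [abs_of_nonneg (ph_nonneg hρ hr)]
    have := ph_le_one hρ hr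
    have : 0 < 1 / ρ := by positivity
    linarith
  lin r hr := by
    rw [abs_of_nonneg (ph_nonneg hρ hr)]
    have := ph_le_lin hρ hr
    have e : (1 + 1 / ρ) * r = r + r / ρ := by ring
    linarith
  bd' r hr := by
    rw [abs_of_nonneg (ph'_nonneg hρ hr)]
    have := ph'_le_inv hρ hr
    linarith

theorem tendsto_inv_succ : Tendsto (fun n : ℕ => 1 / ((n : ℝ) + 1)) atTop (𝓝 0) :=
  tendsto_one_div_add_atTop_nhds_zero_nat

theorem inv_succ_pos (n : ℕ) : 0 < 1 / ((n : ℝ) + 1) := by positivity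

theorem tendsto_ph {r : ℝ} (hr : 0 < r) :
    Tendsto (fun n : ℕ => ph (1 / ((n : ℝ) + 1)) r) atTop (𝓝 1) := by
  have h : Tendsto (fun ρ : ℝ => ph ρ r) (𝓝 0) (𝓝 (ph 0 r)) := by
    have : ContinuousAt (fun ρ : ℝ => r / (r + ρ)) 0 :=
      continuousAt_const.div (by fun_prop) (by simpa using hr.ne')
    exact this.tendsto
  have e : ph 0 r = 1 := by simp [ph, hr.ne']
  rw [e] at h
  exact h.comp tendsto_inv_succ

theorem tendsto_ph' {r : ℝ} (hr : 0 < r) :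
    Tendsto (fun n : ℕ => ph' (1 / ((n : ℝ) + 1)) r) atTop (𝓝 0) := by
  have h : Tendsto (fun ρ : ℝ => ph' ρ r) (𝓝 0) (𝓝 (ph' 0 r)) := by
    have : ContinuousAt (fun ρ : ℝ => ρ / (r + ρ) ^ 2) 0 :=
      continuousAt_id.div (by fun_prop) (by simpa using hr.ne')
    exact this.tendsto
  have e : ph' 0 r = 0 := by simp [ph']
  rw [e] at h
  exact h.comp tendsto_inv_succ

theorem tendsto_ph_large {r : ℝ} (hr : 0 < r) :
    Tendsto (fun n : ℕ => ph ((n : ℝ) + 1) r) atTop (𝓝 0) := by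
  have h := tendsto_inv_succ.const_mul r
  rw [mul_zero] at h
  refine squeeze_zero (fun n => ph_nonneg (by positivity) hr) (fun n => ?_) h
  have := ph_le_lin (ρ := (n : ℝ) + 1) (by positivity) hr
  rwa [mul_one_div]

/-- Fatou's lemma for nonnegative functions with bounded integrals. -/
theorem integrable_of_tendsto_of_le {α : Type*} [MeasurableSpace α] {μ : Measure α}
    {f : ℕ → α → ℝ} {g : α → ℝ} {K : ℝ} (hf : ∀ n, Integrable (f n) μ) (h0 : ∀ n, 0 ≤ᵐ[μ] f n)
    (hK : ∀ n, ∫ x, f n x ∂μ ≤ K) (hlim : ∀ᵐ x ∂μ, Tendsto (fun n => f n x) atTop (𝓝 (g x)))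
    (hg : 0 ≤ᵐ[μ] g) (hm : AEStronglyMeasurable g μ) : Integrable g μ ∧ ∫ x, g x ∂μ ≤ K := by
  have hK0 : 0 ≤ K := (integral_nonneg_of_ae (h0 0)).trans (hK 0)
  have h1 : ∫⁻ x, ENNReal.ofReal (g x) ∂μ ≤ ENNReal.ofReal K := by
    have e : ∫⁻ x, ENNReal.ofReal (g x) ∂μ
        = ∫⁻ x, liminf (fun n => ENNReal.ofReal (f n x)) atTop ∂μ := by
      refine lintegral_congr_ae ?_
      filter_upwards [hlim] with x hx
      exact ((ENNReal.continuous_ofReal.tendsto _).comp hx).liminf_eq.symm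
    rw [e]
    refine (lintegral_liminf_le' fun n => (hf n).1.aemeasurable.ennreal_ofReal).trans ?_
    refine liminf_le_of_le (by isBoundedDefault) fun b hb => ?_
    obtain ⟨n, hn⟩ := hb.exists
    refine hn.trans ?_
    rw [← ofReal_integral_eq_lintegral_ofReal (hf n) (h0 n)]
    exact ENNReal.ofReal_le_ofReal (hK n)
  have hi : Integrable g μ := by
    refine ⟨hm, ?_⟩
    rw [hasFiniteIntegral_iff_ofReal hg]
    exact h1.trans_lt ENNReal.ofReal_lt_top
  refine ⟨hi, ?_⟩
  rw [← ofReal_integral_eq_lintegral_ofReal hi hg] at h1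
  exact (ENNReal.ofReal_le_ofReal_iff hK0).1 h1

end
end Coulomb
namespace Coulomb
section
open Set Topology
variable {d : ℕ}

/-- Solutions of constant energy, with a nonlinearity that is strong enough for the Morawetz
estimate. -/
structure Sol (p ζ E : ℝ) (v : Sp d → ℝ → ℝ) : Prop extends FE p ζ v where
  eqn : ∀ q ∈ off d, Sf p ζ v q = 0
  cond : ζ = 0 ∨ 4 ≤ ((d : ℝ) - 1) * (p - 1)
  energy : ∀ t, ∫ x, eF p ζ v (x, t) = E

variable [hd : Fact (4 ≤ d)]

omit hd in
theorem lam_pos [hd : Fact (4 ≤ d)] : 0 < lam d := by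
  have hd' : (4 : ℝ) ≤ d := by exact_mod_cast hd.out
  have h1 : 0 < (d : ℝ) - 1 := by linarith
  have h3 : 0 < (d : ℝ) - 3 := by linarith
  unfold lam; positivity

section
variable {p ζ : ℝ} (hA : Adm p ζ)
include hA

theorem ef_nonneg (v : Sp d → ℝ → ℝ) (q : Sp d × ℝ) : 0 ≤ ef p ζ v q := by
  have h1 := Qf_sq_le v q
  have h2 := potential_nonneg hA (v q.1 q.2)
  have h3 := lam_pos (d := d)
  have h4 : 0 ≤ 1 / 2 * (‖gr v q‖ ^ 2 - (Qf v q / ‖q.1‖) ^ 2) := by linarith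
  unfold ef; positivity

theorem eS_nonneg (σ : ℝ) (v : Sp d → ℝ → ℝ) (q : Sp d × ℝ) : 0 ≤ eS p ζ σ v q := by
  have := ef_nonneg hA v q
  unfold eS; positivity

theorem norm_mul_Mf {v : Sp d → ℝ → ℝ} {q : Sp d × ℝ} (hq : q ∈ off d) :
    ‖q.1‖ * Mf p ζ v q = 1 / 2 * (‖gr v q‖ ^ 2 - (Qf v q / ‖q.1‖) ^ 2)
      + lam d / 2 * (v q.1 q.2 ^ 2 / ‖q.1‖ ^ 2)
      + ((d : ℝ) - 1) * (p - 1) / 4 * (ζ * |v q.1 q.2| ^ (p + 1) / (p + 1))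
      + v q.1 q.2 ^ 2 / (4 * ‖q.1‖) := by
  have h0 := norm_ne_of_mem_off hq
  rcases hA.2 with h | h
  · simp only [Mf, h]
    field_simp
  · have : p + 1 ≠ 0 := by linarith
    simp only [Mf]
    field_simp

theorem half_ef_le (hc : ζ = 0 ∨ 4 ≤ ((d : ℝ) - 1) * (p - 1)) {v : Sp d → ℝ → ℝ} {q : Sp d × ℝ}
    (hq : q ∈ off d) : 1 / 2 * ef p ζ v q ≤ ‖q.1‖ * Mf p ζ v q := by
  have h1 := Qf_sq_le v q
  have h2 := potential_nonneg hA (v q.1 q.2)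
  have h3 := lam_pos (d := d)
  have h4 : 0 ≤ lam d / 2 * (v q.1 q.2 ^ 2 / ‖q.1‖ ^ 2) := by positivity
  have e1 : v q.1 q.2 ^ 2 / (4 * ‖q.1‖) = 1 / 2 * (v q.1 q.2 ^ 2 / (2 * ‖q.1‖)) := by ring
  have e2 : ef p ζ v q = 1 / 2 * (‖gr v q‖ ^ 2 - (Qf v q / ‖q.1‖) ^ 2)
      + lam d / 2 * (v q.1 q.2 ^ 2 / ‖q.1‖ ^ 2) + v q.1 q.2 ^ 2 / (2 * ‖q.1‖)
      + ζ * |v q.1 q.2| ^ (p + 1) / (p + 1) := by rw [← mul_div_assoc]; rfl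
  have h5 : ζ * |v q.1 q.2| ^ (p + 1) / (p + 1)
      ≤ ((d : ℝ) - 1) * (p - 1) / 4 * (ζ * |v q.1 q.2| ^ (p + 1) / (p + 1)) := by
    rcases hc with h | h
    · simp [h]
    · have : 1 ≤ ((d : ℝ) - 1) * (p - 1) / 4 := by linarith
      nlinarith
  rw [norm_mul_Mf hA hq, e1, e2]
  linarith

theorem Mf_nonneg (hc : ζ = 0 ∨ 4 ≤ ((d : ℝ) - 1) * (p - 1)) {v : Sp d → ℝ → ℝ} {q : Sp d × ℝ}
    (hq : q ∈ off d) : 0 ≤ Mf p ζ v q := by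
  have h1 := half_ef_le hA hc (v := v) hq
  have h2 := ef_nonneg hA v q
  have h3 := norm_pos_of_mem_off hq
  by_contra h
  have := mul_neg_of_pos_of_neg h3 (not_le.1 h)
  linarith

end

/-- Inward energy seen by the weight at scale `ρ`. -/
noncomputable def inw (p ζ ρ : ℝ) (v : Sp d → ℝ → ℝ) (t : ℝ) : ℝ :=
  ∫ x, ph ρ ‖x‖ * eS p ζ 1 v (x, t)

section
variable {p ζ E : ℝ} {v : Sp d → ℝ → ℝ} (hv : Sol p ζ E v)
include hv

theorem abs_le_of_eS (ρ : ℝ) (hρ : 0 < ρ) : ∃ B, ∀ q ∈ off d,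
    |ph ρ ‖q.1‖ * eS p ζ 1 v q| ≤ B * Df p ζ v q ∧
    |ph' ρ ‖q.1‖ * (1 / 4 * Lf 1 v q ^ 2)| ≤ B * Df p ζ v q ∧
    |ph' ρ ‖q.1‖ * (1 / 2 * ef p ζ v q)| ≤ B * Df p ζ v q ∧
    |ph ρ ‖q.1‖ * Mf p ζ v q| ≤ B * Df p ζ v q ∧
    |ph ρ ‖q.1‖ ^ 2 * Mf p ζ v q| ≤ B * Df p ζ v q := by
  obtain ⟨B, hB, hD⟩ := exists_bound_Df (d := d) hv.adm
  refine ⟨(1 + 1 / ρ) * B, fun q hq => ?_⟩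
  have hw := wtB_ph hρ
  have hp := norm_pos_of_mem_off hq
  obtain ⟨k1, k2, k3⟩ := hD v q
  have k1 := k1 1 (by norm_num)
  have h0 := hw.nonneg
  have m : |ph ρ ‖q.1‖ * Mf p ζ v q| ≤ (1 + 1 / ρ) * (B * Df p ζ v q) := by
    rw [abs_mul]
    have e2 := mul_le_mul_of_nonneg_right (hw.lin _ hp) (abs_nonneg (Mf p ζ v q))
    have e3 := mul_le_mul_of_nonneg_left k3 h0
    linarith
  simp only [mul_assoc] at *
  refine ⟨?_, ?_, ?_, m, ?_⟩
  · rw [abs_mul]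
    exact mul_le_mul (hw.bd _ hp) (abs_eS_le k1 k2) (abs_nonneg _) h0
  · rw [abs_mul]
    refine mul_le_mul (hw.bd' _ hp) ?_ (abs_nonneg _) h0
    have := sq_nonneg (Lf 1 v q)
    rw [abs_of_nonneg (by positivity)]; linarith
  · rw [abs_mul]
    refine mul_le_mul (hw.bd' _ hp) ?_ (abs_nonneg _) h0
    have h2 := ef_nonneg hv.adm v q
    rw [abs_of_nonneg (by positivity)]
    have := le_abs_self (ef p ζ v q)
    linarith
  · refine le_trans ?_ m
    rw [pow_two, mul_assoc, abs_mul, abs_of_nonneg (ph_nonneg hρ hp)]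
    exact mul_le_of_le_one_left (abs_nonneg _) (ph_le_one hρ hp)

omit hv in
theorem continuousOn_ph {ρ : ℝ} (hρ : 0 < ρ) :
    ContinuousOn (fun q : Sp d × ℝ => ph ρ ‖q.1‖) (off d) :=
  continuousOn_weight (wtB_ph hρ).contDiffOn.continuousOn

omit hv in
theorem continuousOn_ph' {ρ : ℝ} (hρ : 0 < ρ) :
    ContinuousOn (fun q : Sp d × ℝ => ph' ρ ‖q.1‖) (off d) :=
  continuousOn_weight (wtB_ph hρ).cont

theorem integrable_ph_eS {ρ : ℝ} (hρ : 0 < ρ) (t : ℝ) :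
    Integrable fun x => ph ρ ‖x‖ * eS p ζ 1 v (x, t) := by
  obtain ⟨B, hB⟩ := abs_le_of_eS hv ρ hρ
  exact FE.integrable_slice hv.toFE (F := fun q => ph ρ ‖q.1‖ * eS p ζ 1 v q)
    ((continuousOn_ph hρ).mul (continuousOn_eS hv.reg hv.adm 1)) (fun q hq => (hB q hq).1) t

theorem integrable_slab_ph_eS {ρ : ℝ} (hρ : 0 < ρ) (t1 t2 : ℝ) :
    Integrable (fun q => ph ρ ‖q.1‖ * eS p ζ 1 v q) (slab d t1 t2) := by
  obtain ⟨B, hB⟩ := abs_le_of_eS hv ρ hρ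
  exact FE.integrable_slab hv.toFE
    ((continuousOn_ph hρ).mul (continuousOn_eS hv.reg hv.adm 1)) (fun q hq => (hB q hq).1) t1 t2

theorem integrable_slab_ph'_Lf {ρ : ℝ} (hρ : 0 < ρ) (t1 t2 : ℝ) :
    Integrable (fun q => ph' ρ ‖q.1‖ * (1 / 4 * Lf 1 v q ^ 2)) (slab d t1 t2) := by
  obtain ⟨B, hB⟩ := abs_le_of_eS hv ρ hρ
  exact FE.integrable_slab hv.toFE ((continuousOn_ph' hρ).mul
    (((continuousOn_Lf hv.reg 1).pow 2).const_mul _)) (fun q hq => (hB q hq).2.1) t1 t2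

theorem integrable_slab_ph'_ef {ρ : ℝ} (hρ : 0 < ρ) (t1 t2 : ℝ) :
    Integrable (fun q => ph' ρ ‖q.1‖ * (1 / 2 * ef p ζ v q)) (slab d t1 t2) := by
  obtain ⟨B, hB⟩ := abs_le_of_eS hv ρ hρ
  exact FE.integrable_slab hv.toFE ((continuousOn_ph' hρ).mul
    ((continuousOn_ef hv.reg hv.adm).const_mul _)) (fun q hq => (hB q hq).2.2.1) t1 t2

theorem integrable_slab_ph_Mf {ρ : ℝ} (hρ : 0 < ρ) (t1 t2 : ℝ) :
    Integrable (fun q => ph ρ ‖q.1‖ * Mf p ζ v q) (slab d t1 t2) := by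
  obtain ⟨B, hB⟩ := abs_le_of_eS hv ρ hρ
  exact FE.integrable_slab hv.toFE ((continuousOn_ph hρ).mul
    (continuousOn_Mf hv.reg hv.adm)) (fun q hq => (hB q hq).2.2.2.1) t1 t2

theorem integrable_slab_ph_sq_Mf {ρ : ℝ} (hρ : 0 < ρ) (t1 t2 : ℝ) :
    Integrable (fun q => ph ρ ‖q.1‖ ^ 2 * Mf p ζ v q) (slab d t1 t2) := by
  obtain ⟨B, hB⟩ := abs_le_of_eS hv ρ hρ
  exact FE.integrable_slab hv.toFE (((continuousOn_ph hρ).pow 2).mul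
    (continuousOn_Mf hv.reg hv.adm)) (fun q hq => (hB q hq).2.2.2.2) t1 t2

/-- The Morawetz flux identity at scale `ρ`. -/
theorem inw_sub {ρ : ℝ} (hρ : 0 < ρ) {t1 t2 : ℝ} (h : t1 ≤ t2) :
    inw p ζ ρ v t1 - inw p ζ ρ v t2 = (∫ q, ph' ρ ‖q.1‖ * (1 / 4 * Lf 1 v q ^ 2) ∂(slab d t1 t2))
      - (∫ q, ph' ρ ‖q.1‖ * (1 / 2 * ef p ζ v q) ∂(slab d t1 t2))
      + ∫ q, ph ρ ‖q.1‖ * Mf p ζ v q ∂(slab d t1 t2) := by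
  have h0 : (fun q => ph ρ ‖q.1‖ * (1 / 2 * Lf 1 v q * Sf p ζ v q)) =ᵐ[slab d t1 t2] fun _ => 0 :=
    ae_slab_of_Icc fun q hq _ => by simp [hv.eqn q hq]
  have hid := weighted_identity hv.toFE (wtB_ph hρ) (σ := 1) (by norm_num) h
    ((integrable_zero _ _ _).congr h0.symm)
  rw [one_mul] at hid
  have i1 := integrable_slab_ph'_Lf hv hρ t1 t2
  have i2 := integrable_slab_ph'_ef hv hρ t1 t2
  have i3 := integrable_slab_ph_Mf hv hρ t1 t2
  rw [← integral_sub i1 i2]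
  have i12 : Integrable (fun q => ph' ρ ‖q.1‖ * (1 / 4 * Lf 1 v q ^ 2)
    - ph' ρ ‖q.1‖ * (1 / 2 * ef p ζ v q)) (slab d t1 t2) := i1.sub i2
  rw [← integral_add i12 i3]
  unfold inw
  rw [← neg_sub, hid, ← integral_neg]
  refine integral_congr_ae ?_
  filter_upwards [h0] with q hq
  rw [hq]; ring

theorem inw_ge {ρ : ℝ} (hρ : 0 < ρ) {t1 t2 : ℝ} (h : t1 ≤ t2) :
    (∫ q, ph' ρ ‖q.1‖ * (1 / 4 * Lf 1 v q ^ 2) ∂(slab d t1 t2))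
      + (∫ q, ph ρ ‖q.1‖ ^ 2 * Mf p ζ v q ∂(slab d t1 t2))
      ≤ inw p ζ ρ v t1 - inw p ζ ρ v t2 := by
  have i2 := integrable_slab_ph'_ef hv hρ t1 t2
  have i3 := integrable_slab_ph_Mf hv hρ t1 t2
  have i4 := integrable_slab_ph_sq_Mf hv hρ t1 t2
  rw [inw_sub hv hρ h, sub_add, sub_eq_add_neg, neg_sub]
  gcongr
  rw [← integral_sub i3 i2]
  refine integral_mono_ae i4 (i3.sub i2) (ae_slab_of_Icc fun q hq _ => ?_)
  have hp := norm_pos_of_mem_off hq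
  have h1 := half_ef_le hv.adm hv.cond (v := v) hq
  have h2 := ph'_nonneg hρ hp
  simp only [Pi.sub_apply, ← ph_sub hρ hp]
  nlinarith

theorem integral_ph'_Lf_nonneg {ρ : ℝ} (hρ : 0 < ρ) (t1 t2 : ℝ) :
    0 ≤ ∫ q, ph' ρ ‖q.1‖ * (1 / 4 * Lf 1 v q ^ 2) ∂(slab d t1 t2) :=
  integral_nonneg_of_ae (ae_slab_of_Icc fun q hq _ => by
    have := ph'_nonneg hρ (norm_pos_of_mem_off hq)
    positivity)

theorem integral_ph_sq_Mf_nonneg {ρ : ℝ} (t1 t2 : ℝ) :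
    0 ≤ ∫ q, ph ρ ‖q.1‖ ^ 2 * Mf p ζ v q ∂(slab d t1 t2) :=
  integral_nonneg_of_ae (ae_slab_of_Icc fun q hq _ => by
    have := Mf_nonneg hv.adm hv.cond (v := v) hq
    positivity)

theorem inw_antitone {ρ : ℝ} (hρ : 0 < ρ) : Antitone (inw p ζ ρ v) := fun t1 t2 h => by
  have h1 := inw_ge hv hρ h
  have h2 := integral_ph'_Lf_nonneg hv hρ t1 t2
  have h3 := integral_ph_sq_Mf_nonneg hv (ρ := ρ) t1 t2
  linarith

theorem inw_nonneg {ρ : ℝ} (hρ : 0 < ρ) (t : ℝ) : 0 ≤ inw p ζ ρ v t := by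
  refine integral_nonneg_of_ae ?_
  filter_upwards [ae_ne_zero (d := d)] with x hx
  have := ph_nonneg hρ (norm_pos_iff.2 hx)
  have := eS_nonneg hv.adm 1 v (x, t)
  positivity

theorem inw_le {ρ : ℝ} (hρ : 0 < ρ) (t : ℝ) : inw p ζ ρ v t ≤ ∫ x, eS p ζ 1 v (x, t) := by
  refine integral_mono_ae (integrable_ph_eS hv hρ t)
    (integrable_eS hv.toFE 1 (by norm_num) t) ?_
  filter_upwards [ae_ne_zero (d := d)] with x hx
  exact mul_le_of_le_one_left (eS_nonneg hv.adm 1 v (x, t)) (ph_le_one hρ (norm_pos_iff.2 hx))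

theorem tendsto_inw_of {ρ : ℕ → ℝ} (hρ : ∀ n, 0 < ρ n) {c : ℝ}
    (hl : ∀ r, 0 < r → Tendsto (fun n => ph (ρ n) r) atTop (𝓝 c)) (t : ℝ) :
    Tendsto (fun n => inw p ζ (ρ n) v t) atTop (𝓝 (c * ∫ x, eS p ζ 1 v (x, t))) := by
  rw [← integral_const_mul]
  refine tendsto_integral_of_dominated_convergence (fun x => eS p ζ 1 v (x, t))
    (fun n => (integrable_ph_eS hv (hρ n) t).1) (integrable_eS hv.toFE 1 (by norm_num) t)
    (fun n => ?_) ?_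
  · filter_upwards [ae_ne_zero (d := d)] with x hx
    have h1 := ph_nonneg (hρ n) (norm_pos_iff.2 hx)
    have h2 := eS_nonneg hv.adm 1 v (x, t)
    rw [Real.norm_of_nonneg (by positivity)]
    exact mul_le_of_le_one_left h2 (ph_le_one (hρ n) (norm_pos_iff.2 hx))
  · filter_upwards [ae_ne_zero (d := d)] with x hx
    exact (hl _ (norm_pos_iff.2 hx)).mul_const _

theorem tendsto_inw_small (t : ℝ) : Tendsto (fun n : ℕ => inw p ζ (1 / ((n : ℝ) + 1)) v t) atTop
    (𝓝 (∫ x, eS p ζ 1 v (x, t))) := by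
  simpa using tendsto_inw_of hv inv_succ_pos (fun r hr => tendsto_ph hr) t

theorem tendsto_inw_large (t : ℝ) : Tendsto (fun n : ℕ => inw p ζ ((n : ℝ) + 1) v t) atTop
    (𝓝 0) := by
  simpa using tendsto_inw_of hv (fun n => by positivity) (fun r hr => tendsto_ph_large hr) t

theorem inward_antitone : Antitone fun t => ∫ x, eS p ζ 1 v (x, t) := fun t1 t2 h =>
  le_of_tendsto_of_tendsto' (tendsto_inw_small hv t2) (tendsto_inw_small hv t1) fun n =>
    inw_antitone hv (inv_succ_pos n) h

/-- The Morawetz density is integrable on slabs. -/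
theorem Mf_integrable_slab {t1 t2 : ℝ} (h : t1 ≤ t2) : Integrable (Mf p ζ v) (slab d t1 t2) ∧
    ∫ q, Mf p ζ v q ∂(slab d t1 t2) ≤ ∫ x, eS p ζ 1 v (x, t1) := by
  refine integrable_of_tendsto_of_le
    (fun n : ℕ => integrable_slab_ph_sq_Mf hv (inv_succ_pos n) t1 t2) (fun n => ?_) (fun n => ?_) ?_
    ?_ (aesm_slab (continuousOn_Mf hv.reg hv.adm) t1 t2)
  · refine ae_slab_of_Icc fun q hq _ => ?_
    have := Mf_nonneg hv.adm hv.cond (v := v) hq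
    simp only [Pi.zero_apply]; positivity
  · have h1 := inw_ge hv (inv_succ_pos n) h
    have h2 := integral_ph'_Lf_nonneg hv (inv_succ_pos n) t1 t2
    have h3 := inw_nonneg hv (inv_succ_pos n) t2
    have h4 := inw_le hv (inv_succ_pos n) t1
    linarith
  · refine ae_slab_of_Icc fun q hq _ => ?_
    have := ((tendsto_ph (norm_pos_of_mem_off hq)).pow 2).mul_const (Mf p ζ v q)
    simpa using this
  · exact ae_slab_of_Icc fun q hq _ => Mf_nonneg hv.adm hv.cond (v := v) hq

theorem integral_ph'_Lf_le {ρ : ℝ} (hρ : 0 < ρ) {t1 t2 : ℝ} (h : t1 ≤ t2) :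
    ∫ q, ph' ρ ‖q.1‖ * (1 / 4 * Lf 1 v q ^ 2) ∂(slab d t1 t2) ≤ inw p ζ ρ v t1 := by
  have h1 := inw_ge hv hρ h
  have h3 := integral_ph_sq_Mf_nonneg hv (ρ := ρ) t1 t2
  have h4 := inw_nonneg hv hρ t2
  linarith

end
end
end Coulomb
namespace Coulomb
section
open Set Topology
variable {d : ℕ} [hd : Fact (4 ≤ d)]

theorem le_integral_slab {F : Sp d × ℝ → ℝ} {t1 t2 c : ℝ} (h : t1 ≤ t2)
    (hF : Integrable F (slab d t1 t2)) (hc : ∀ t ∈ Icc t1 t2, c ≤ ∫ x, F (x, t)) :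
    (t2 - t1) * c ≤ ∫ q, F q ∂(slab d t1 t2) := by
  rw [slab] at hF ⊢
  rw [integral_prod_symm _ hF]
  have e : (t2 - t1) * c = ∫ t in Ioc t1 t2, c := by
    simp [h]
  rw [e]
  refine integral_mono_ae (integrable_const c) hF.integral_prod_right ?_
  filter_upwards [ae_restrict_mem measurableSet_Ioc] with t ht using hc t (Ioc_subset_Icc_self ht)

theorem integral_slab_le {F : Sp d × ℝ → ℝ} {t1 t2 c : ℝ} (h : t1 ≤ t2)
    (hF : Integrable F (slab d t1 t2)) (hc : ∀ t ∈ Icc t1 t2, ∫ x, F (x, t) ≤ c) :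
    ∫ q, F q ∂(slab d t1 t2) ≤ (t2 - t1) * c := by
  have := le_integral_slab h hF.neg (c := -c) fun t ht => by
    simp only [Pi.neg_apply, integral_neg]
    exact neg_le_neg (hc t ht)
  simp only [Pi.neg_apply, integral_neg] at this
  linarith

section
variable {p ζ E : ℝ} {v : Sp d → ℝ → ℝ} (hv : Sol p ζ E v)
include hv

theorem integrable_slab_eS (t1 t2 : ℝ) : Integrable (eS p ζ 1 v) (slab d t1 t2) := by
  obtain ⟨B, hB, hD⟩ := exists_bound_Df (d := d) hv.adm
  exact FE.integrable_slab hv.toFE (continuousOn_eS hv.reg hv.adm 1) (C := B)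
    (fun q _ => abs_eS_le ((hD v q).1 1 (by norm_num)) (hD v q).2.1) t1 t2

theorem mul_inward_le {T R : ℝ} (hT : 0 ≤ T) (hR : 0 < R) :
    T * (∫ x, eS p ζ 1 v (x, T)) ≤ T * (2 * inw p ζ R v 0) + 5 * R * ∫ x, eS p ζ 1 v (x, 0) := by
  have i0 := integrable_slab_eS hv 0 T
  have i1 := integrable_slab_ph_eS hv hR 0 T
  have i2 := integrable_slab_ph'_Lf hv hR 0 T
  obtain ⟨i3, h3⟩ := Mf_integrable_slab hv hT
  have h1 : T * (∫ x, eS p ζ 1 v (x, T)) ≤ ∫ q, eS p ζ 1 v q ∂(slab d 0 T) := by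
    have := le_integral_slab hT i0 fun t ht => inward_antitone hv ht.2
    simpa using this
  have h2 : ∫ q, ph R ‖q.1‖ * eS p ζ 1 v q ∂(slab d 0 T) ≤ T * inw p ζ R v 0 := by
    have := integral_slab_le hT i1 fun t ht => inw_antitone hv hR ht.1
    simpa using this
  have h4 := integral_ph'_Lf_le hv hR hT
  have h5 := inw_le hv hR 0
  have h6 : ∫ q, eS p ζ 1 v q ∂(slab d 0 T) ≤ 2 * (∫ q, ph R ‖q.1‖ * eS p ζ 1 v q ∂(slab d 0 T))
      + 4 * R * (∫ q, ph' R ‖q.1‖ * (1 / 4 * Lf 1 v q ^ 2) ∂(slab d 0 T))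
      + R * ∫ q, Mf p ζ v q ∂(slab d 0 T) := by
    rw [← integral_const_mul, ← integral_const_mul, ← integral_const_mul,
      ← integral_add (i1.const_mul _) (i2.const_mul _)]
    have i12 : Integrable (fun q => 2 * (ph R ‖q.1‖ * eS p ζ 1 v q)
      + 4 * R * (ph' R ‖q.1‖ * (1 / 4 * Lf 1 v q ^ 2))) (slab d 0 T) :=
      (i1.const_mul _).add (i2.const_mul _)
    rw [← integral_add i12 (i3.const_mul _)]
    refine integral_mono_ae i0 (i12.add (i3.const_mul _)) (ae_slab_of_Icc fun q hq _ => ?_)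
    have hp := norm_pos_of_mem_off hq
    have k1 := half_ef_le hv.adm hv.cond (v := v) hq
    have k2 := Mf_nonneg hv.adm hv.cond (v := v) hq
    have k3 := eS_nonneg hv.adm 1 v q
    have k4 := ph_nonneg hR hp
    have k5 := ph'_nonneg hR hp
    simp only [Pi.add_apply]
    rcases le_total R ‖q.1‖ with hRr | hRr
    · have : 1 / 2 ≤ ph R ‖q.1‖ := by
        unfold ph; rw [div_le_div_iff₀ (by norm_num) (by positivity)]; linarith
      have a1 : 0 ≤ 4 * R * (ph' R ‖q.1‖ * (1 / 4 * Lf 1 v q ^ 2)) := by positivity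
      have a2 : 0 ≤ R * Mf p ζ v q := by positivity
      nlinarith
    · have a0 : 1 ≤ 4 * R * ph' R ‖q.1‖ := by
        unfold ph'; rw [← mul_div_assoc, le_div_iff₀ (by positivity)]; nlinarith
      have a1 : 0 ≤ ph R ‖q.1‖ * eS p ζ 1 v q := by positivity
      have a2 : ‖q.1‖ * Mf p ζ v q ≤ R * Mf p ζ v q := mul_le_mul_of_nonneg_right hRr k2
      have a3 : 1 / 4 * Lf 1 v q ^ 2 ≤ 4 * R * ph' R ‖q.1‖ * (1 / 4 * Lf 1 v q ^ 2) :=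
        le_mul_of_one_le_left (by positivity) a0
      have e : eS p ζ 1 v q = 1 / 4 * Lf 1 v q ^ 2 + 1 / 2 * ef p ζ v q := rfl
      linarith
  nlinarith

theorem inward_nonneg (t : ℝ) : 0 ≤ ∫ x, eS p ζ 1 v (x, t) :=
  integral_nonneg fun _ => eS_nonneg hv.adm 1 v _

theorem tendsto_inward_atTop : Tendsto (fun t => ∫ x, eS p ζ 1 v (x, t)) atTop (𝓝 0) := by
  have h0 := inward_nonneg hv
  rw [Metric.tendsto_atTop]
  intro ε hε
  obtain ⟨n, hn⟩ := ((tendsto_inw_large hv 0).eventually (gt_mem_nhds (show 0 < ε / 4 by positivity))).exists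
  set R : ℝ := (n : ℝ) + 1 with hR
  have hR0 : 0 < R := by positivity
  set K := 5 * R * ∫ x, eS p ζ 1 v (x, 0)
  have hK : 0 ≤ K := mul_nonneg (by positivity) (h0 0)
  refine ⟨2 * K / ε + 1, fun T hT => ?_⟩
  have hT0 : 0 < T := lt_of_lt_of_le (by positivity) hT
  have h := mul_inward_le hv hT0.le hR0
  rw [Real.dist_eq, sub_zero, abs_of_nonneg (h0 T)]
  have h2 : 2 * K < ε * T := by
    have : 2 * K / ε < T := by linarith
    rw [div_lt_iff₀ hε] at this; linarith
  by_contra hc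
  have := mul_le_mul_of_nonneg_left (not_lt.1 hc) hT0.le
  have := mul_lt_mul_of_pos_left hn hT0
  nlinarith

end
end
end Coulomb
namespace Coulomb
section
open Set Topology
variable {d : ℕ}

section
variable {γ γ' : ℝ → ℝ} {v : Sp d → ℝ → ℝ}

theorem weight_line (hγ : Wt γ γ') {q : Sp d × ℝ} (hq : q ∈ off d) (w : Sp d × ℝ) :
    HasDerivAt (fun s : ℝ => γ ‖(q + s • w).1‖) (γ' ‖q.1‖ * (inner ℝ q.1 w.1 / ‖q.1‖)) 0 := by
  have h := hγ.hasDeriv ‖q.1‖ (norm_pos_of_mem_off hq)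
  have h' : HasDerivAt γ (γ' ‖q.1‖) ‖(q + (0 : ℝ) • w).1‖ := by simpa using h
  exact h'.comp (0 : ℝ) (norm_line hq w)

theorem fderiv_weight_mul (hγ : Wt γ γ') (hv : Reg v) {q : Sp d × ℝ} (hq : q ∈ off d)
    (w : Sp d × ℝ) : fderiv ℝ (fun q : Sp d × ℝ => γ ‖q.1‖ * v q.1 q.2) q w
      = γ' ‖q.1‖ * (inner ℝ q.1 w.1 / ‖q.1‖) * v q.1 q.2
        + γ ‖q.1‖ * (inner ℝ (gr v q) w.1 + w.2 * vt v q) := by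
  refine fderiv_eq_of_line ((hγ.contDiffAt hq).mul (hv.contDiffAt_one hq)) ?_
  refine ((weight_line hγ hq w).mul (val_line hv hq w)).congr_deriv ?_
  simp only [zero_smul, add_zero]

theorem fderiv_mul_vt (hv : Reg v) {q : Sp d × ℝ} (hq : q ∈ off d) :
    fderiv ℝ (fun q : Sp d × ℝ => v q.1 q.2 * vt v q) q (0, 1)
      = vt v q ^ 2 + v q.1 q.2 * fderiv ℝ (vt v) q (0, 1) := by
  refine fderiv_eq_of_line ((hv.contDiffAt_one hq).mul (hv.vt_contDiffAt hq)) ?_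
  refine ((val_line hv hq (0, 1)).mul (hasDerivAt_line (0, 1) (hv.vt_contDiffAt hq))).congr_deriv ?_
  simp only [zero_smul, add_zero, inner_zero_right, zero_add, one_mul]
  ring

/-- The virial identity with weights supported away from the origin. -/
theorem virial_identity [NeZero d] {a b : ℝ} (hγ : WtC γ γ' a b) {p ζ : ℝ} (hA : Adm p ζ)
    (hv : Reg v) (hS : ∀ q ∈ off d, Sf p ζ v q = 0) {t1 t2 : ℝ} (h12 : t1 ≤ t2) :
    ∫ q, (γ ‖q.1‖ * (‖gr v q‖ ^ 2 + v q.1 q.2 ^ 2 / ‖q.1‖ + ζ * |v q.1 q.2| ^ (p + 1) - vt v q ^ 2)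
        + γ' ‖q.1‖ * (Qf v q / ‖q.1‖ * v q.1 q.2)) ∂(slab d t1 t2)
      = (∫ x, γ ‖x‖ * (v x t1 * vt v (x, t1))) - ∫ x, γ ‖x‖ * (v x t2 * vt v (x, t2)) := by
  have hγc := hγ.contDiffOn.continuousOn
  have hf : ∀ q ∈ off d, ContDiffAt ℝ 1 (fun q : Sp d × ℝ => v q.1 q.2 * vt v q) q := fun q hq =>
    (hv.contDiffAt_one hq).mul (hv.vt_contDiffAt hq)
  have hβ : ∀ q ∈ off d, ContDiffAt ℝ 1 (fun q : Sp d × ℝ => γ ‖q.1‖ * v q.1 q.2) q := fun q hq =>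
    (hγ.toWt.contDiffAt hq).mul (hv.contDiffAt_one hq)
  have hG : ∀ q ∈ off d, ContDiffAt ℝ 1 (gr v) q := fun q hq => hv.gr_contDiffAt hq
  have cv : ContinuousOn (fun q : Sp d × ℝ => v q.1 q.2) (off d) :=
    continuousOn_of_contDiffAt fun q hq => hv.contDiffAt_one hq
  have cn : ContinuousOn (fun q : Sp d × ℝ => ‖q.1‖) (off d) := by fun_prop
  have cW : ContinuousOn (fun q : Sp d × ℝ => ζ * |v q.1 q.2| ^ (p + 1)) (off d) := by
    simp only [← potential_mul hA]
    exact ((continuous_abs_rpow_mul hA).comp_continuousOn cv).mul cv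
  have i1 := integrable_slab_weight hγc hγ.pos hγ.low hγ.high
    (((((continuousOn_gr hv).norm.pow 2).add ((cv.pow 2).div cn fun q => norm_ne_of_mem_off)).add
      cW).sub ((continuousOn_vt hv).pow 2)) t1 t2
  have i2 := integrable_slab_weight hγ.cont hγ.pos hγ.low' hγ.high'
    (((continuousOn_Qf hv).div cn fun q => norm_ne_of_mem_off).mul cv) t1 t2
  have i3 := integrable_slab_weight hγc hγ.pos hγ.low hγ.high
    ((continuousOn_fderiv_of_contDiffAt hf).clm_apply (continuousOn_const (c := (0, 1)))) t1 t2
  have i4 : Integrable (fun q => γ ‖q.1‖ * (‖gr v q‖ ^ 2 + v q.1 q.2 ^ 2 / ‖q.1‖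
      + ζ * |v q.1 q.2| ^ (p + 1) - vt v q ^ 2) + γ' ‖q.1‖ * (Qf v q / ‖q.1‖ * v q.1 q.2))
      (slab d t1 t2) := i1.add i2
  rw [← neg_sub, ← integral_slab_time_deriv hγ hf h12, eq_neg_iff_add_eq_zero,
    ← integral_add i4 i3]
  have iall : Integrable (fun q => γ ‖q.1‖ * (‖gr v q‖ ^ 2 + v q.1 q.2 ^ 2 / ‖q.1‖
      + ζ * |v q.1 q.2| ^ (p + 1) - vt v q ^ 2) + γ' ‖q.1‖ * (Qf v q / ‖q.1‖ * v q.1 q.2)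
      + γ ‖q.1‖ * fderiv ℝ (fun q : Sp d × ℝ => v q.1 q.2 * vt v q) q (0, 1))
      (slab d t1 t2) := i4.add i3
  rw [slab] at iall ⊢
  rw [integral_prod_symm _ iall]
  refine integral_eq_zero_of_ae (Eventually.of_forall fun t => ?_)
  rw [Pi.zero_apply, ← integral_div_radial_add_eq_zero (b := b) hγ.pos
    (α := fun _ : Sp d => 0) (fun _ _ => contDiffAt_const)
    (slice_contDiffAt hβ t) (slice_contDiffAt hG t) (fun _ _ => rfl) (fun _ _ => rfl)
    (fun x hx => by simp [hγ.low _ hx]) (fun x hx => by simp [hγ.high _ hx])]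
  refine integral_congr_ae ?_
  filter_upwards [ae_ne_zero (d := d)] with x hx
  have hq : (x, t) ∈ off d := mem_off.2 hx
  have h := hS _ hq
  rw [Sf_eq hv p ζ hq] at h
  simp only [fderiv_slice (hβ _ hq), fderiv_slice (hG _ hq), fderiv_weight_mul hγ.toWt hv hq,
    fderiv_mul_vt hv hq, real_inner_self_eq_norm_sq]
  simp only at h ⊢
  have e := potential_mul hA (v x t)
  have e2 : Qf v (x, t) = inner ℝ x (gr v (x, t)) := rfl
  rw [← e2, ← e]
  simp only [fderiv_fun_const, Pi.zero_apply, zero_apply]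
  linear_combination (γ ‖x‖ * v x t) * h

end

theorem potential_nonneg' {p ζ : ℝ} (hA : Adm p ζ) (y : ℝ) :
    0 ≤ ζ * |y| ^ (p + 1) ∧ ζ * |y| ^ (p + 1) ≤ |p + 1| * (ζ * |y| ^ (p + 1) / (p + 1)) := by
  refine ⟨mul_nonneg hA.1 (Real.rpow_nonneg (abs_nonneg _) _), ?_⟩
  rcases hA.2 with h | h
  · simp [h]
  · have hp : 0 < p + 1 := by linarith
    rw [abs_of_pos hp, mul_div_cancel₀ _ hp.ne']

theorem abs_mul_div_le_Df {p ζ : ℝ} (hA : Adm p ζ) (v : Sp d → ℝ → ℝ) {q : Sp d × ℝ}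
    (hq : q ∈ off d) {y : ℝ} (hy : y ^ 2 ≤ 2 * Df p ζ v q) :
    |y * (v q.1 q.2 / ‖q.1‖)| ≤ 2 * Df p ζ v q := by
  have h := (le_Df hA v q).2.2.2.1
  rw [← div_pow] at h
  rw [abs_le]
  constructor <;> nlinarith [sq_nonneg (y - v q.1 q.2 / ‖q.1‖), sq_nonneg (y + v q.1 q.2 / ‖q.1‖),
    Df_nonneg hA v q]

section
variable [hd : Fact (4 ≤ d)] {p ζ : ℝ} {v : Sp d → ℝ → ℝ} (hv : FE p ζ v)
include hv

/-- The virial identity for weights that are not compactly supported. -/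
theorem weighted_virial_identity {φ φ' : ℝ → ℝ} {C : ℝ} (hφ : Wt φ φ') (hC : 0 ≤ C)
    (h0 : ∀ r, 0 < r → |φ r| ≤ C) (h1 : ∀ r, 0 < r → r * |φ r| ≤ C)
    (h2 : ∀ r, 0 < r → r * |φ' r| ≤ C)
    (hS : ∀ q ∈ off d, Sf p ζ v q = 0) {t1 t2 : ℝ} (h12 : t1 ≤ t2) :
    ∫ q, (φ ‖q.1‖ * (‖gr v q‖ ^ 2 + v q.1 q.2 ^ 2 / ‖q.1‖ + ζ * |v q.1 q.2| ^ (p + 1) - vt v q ^ 2)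
        + φ' ‖q.1‖ * (Qf v q / ‖q.1‖ * v q.1 q.2)) ∂(slab d t1 t2)
      = (∫ x, φ ‖x‖ * (v x t1 * vt v (x, t1))) - ∫ x, φ ‖x‖ * (v x t2 * vt v (x, t2)) := by
  obtain ⟨χ, χ', C', hC', hχ, h01, hχ', hlim⟩ := exists_cutoff
  have hr := hv.reg
  have hA := hv.adm
  have hχc : ∀ n, ContinuousOn (χ n) (Ioi 0) := fun n => by
    obtain ⟨a, b, h⟩ := hχ n
    exact h.contDiffOn.continuousOn
  have cφ := continuousOn_weight (d := d) hφ.contDiffOn.continuousOn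
  have cv : ContinuousOn (fun q : Sp d × ℝ => v q.1 q.2) (off d) :=
    continuousOn_of_contDiffAt fun q hq => hr.contDiffAt_one hq
  have cn : ContinuousOn (fun q : Sp d × ℝ => ‖q.1‖) (off d) := by fun_prop
  have cW : ContinuousOn (fun q : Sp d × ℝ => ζ * |v q.1 q.2| ^ (p + 1)) (off d) := by
    simp only [← potential_mul hA]
    exact ((continuous_abs_rpow_mul hA).comp_continuousOn cv).mul cv
  have cvt := continuousOn_vt hr
  have hT : ∀ t, Tendsto (fun n => ∫ x, (χ n ‖x‖ * φ ‖x‖) * (v x t * vt v (x, t))) atTop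
      (𝓝 (∫ x, φ ‖x‖ * (v x t * vt v (x, t)))) := fun t => by
    have := tendsto_integral_cutoff_slice hv hχc h01 (fun r hr => (hlim r hr).mono fun n h => h.1)
      (F := fun q => φ ‖q.1‖ * (v q.1 q.2 * vt v q)) (cφ.mul (cv.mul cvt)) (C := C * 2)
      (fun q hq => by
        have hp := norm_pos_of_mem_off hq
        have k := abs_mul_div_le_Df hA v hq (le_Df hA v q).2.1
        have e : φ ‖q.1‖ * (v q.1 q.2 * vt v q)
            = ‖q.1‖ * φ ‖q.1‖ * (vt v q * (v q.1 q.2 / ‖q.1‖)) := by field_simp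
        rw [e, abs_mul, abs_mul, abs_of_pos hp, mul_assoc C]
        exact mul_le_mul (h1 _ hp) k (abs_nonneg _) hC) t
    simpa only [mul_assoc] using this
  choose a b hab using hχ
  have hid := fun n => virial_identity ((hab n).mul hφ) hA hr hS h12
  refine tendsto_nhds_unique ?_ ((hT t1).sub (hT t2))
  simp only [← hid]
  refine tendsto_integral_of_dominated_convergence (fun q => C * ((6 + |p + 1|) * Df p ζ v q)
      + (C' * C + C) * (2 * Df p ζ v q)) (fun n => ?_) ?_ (fun n => ?_) ?_
  · have h := hab n
    refine aesm_slab ?_ t1 t2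
    have c1 := continuousOn_weight (d := d) (h.mul hφ).cont
    have c2 := continuousOn_weight (d := d) (h.mul hφ).contDiffOn.continuousOn
    exact (c2.mul (((((continuousOn_gr hr).norm.pow 2).add ((cv.pow 2).div cn
      fun q => norm_ne_of_mem_off)).add cW).sub (cvt.pow 2))).add
      (c1.mul (((continuousOn_Qf hr).div cn fun q => norm_ne_of_mem_off).mul cv))
  · have := integrable_slab_Df hv t1 t2
    exact ((this.const_mul _).const_mul _).add ((this.const_mul _).const_mul _)
  · refine ae_slab_of_Icc fun q hq _ => ?_
    have hp := norm_pos_of_mem_off hq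
    obtain ⟨k1, k2, k3, k4, k5, k6⟩ := le_Df hA v q
    have k7 := Qf_sq_le v q
    have l1 := (h01 n ‖q.1‖).1
    have l2 := (h01 n ‖q.1‖).2
    have D0 := Df_nonneg hA v q
    have m1 : ‖q.1‖ * |χ' n ‖q.1‖ * φ ‖q.1‖ + χ n ‖q.1‖ * φ' ‖q.1‖| ≤ C' * C + C := by
      refine (mul_le_mul_of_nonneg_left (abs_add_le _ _) hp.le).trans ?_
      rw [mul_add]
      refine add_le_add ?_ ?_
      · rw [abs_mul, ← mul_assoc]
        exact mul_le_mul (hχ' n _ hp) (h0 _ hp) (abs_nonneg _) hC'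
      · rw [abs_mul, abs_of_nonneg l1]
        have := h2 _ hp
        have : 0 ≤ ‖q.1‖ * |φ' ‖q.1‖| := by positivity
        nlinarith
    have m2 : |χ n ‖q.1‖ * φ ‖q.1‖| ≤ C := by
      rw [abs_mul, abs_of_nonneg l1]
      have := h0 _ hp
      have := abs_nonneg (φ ‖q.1‖)
      nlinarith
    have m3 := abs_mul_div_le_Df hA v hq (k7.trans k1)
    rw [Real.norm_eq_abs]
    refine (abs_add_le _ _).trans (add_le_add ?_ ?_)
    · rw [abs_mul]
      refine mul_le_mul m2 ?_ (abs_nonneg _) hC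
      have a1 := sq_nonneg ‖gr v q‖
      have a2 := sq_nonneg (vt v q)
      have a3 : 0 ≤ v q.1 q.2 ^ 2 / ‖q.1‖ := by positivity
      have a4 := potential_nonneg' hA (v q.1 q.2)
      have a5 := (a4.2).trans (mul_le_mul_of_nonneg_left k5 (abs_nonneg _))
      rw [abs_le, add_mul]
      constructor <;> linarith [a4.1]
    · have e : (χ' n ‖q.1‖ * φ ‖q.1‖ + χ n ‖q.1‖ * φ' ‖q.1‖) * (Qf v q / ‖q.1‖ * v q.1 q.2)
          = ‖q.1‖ * (χ' n ‖q.1‖ * φ ‖q.1‖ + χ n ‖q.1‖ * φ' ‖q.1‖)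
            * (Qf v q / ‖q.1‖ * (v q.1 q.2 / ‖q.1‖)) := by field_simp
      rw [e, abs_mul, abs_mul, abs_of_pos hp]
      exact mul_le_mul m1 m3 (abs_nonneg _) (add_nonneg (mul_nonneg hC' hC) hC)
  · refine ae_slab_of_Icc fun q hq _ => ?_
    refine tendsto_const_nhds.congr' ?_
    filter_upwards [hlim ‖q.1‖ (norm_pos_of_mem_off hq)] with n hn
    rw [hn.1, hn.2]
    simp only [one_mul, zero_mul, zero_add]

end
end
end Coulomb
namespace Coulomb
section
open Set Topology
variable {d : ℕ}

theorem tendsto_integral_ph' {α : Type*} [MeasurableSpace α] {μ : Measure α} {F G r : α → ℝ}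
    (hF : ∀ ρ, 0 < ρ → AEStronglyMeasurable (fun q => ph' ρ (r q) * F q) μ) (hG : Integrable G μ)
    (h : ∀ᵐ q ∂μ, 0 < r q ∧ |F q| ≤ r q * G q) :
    Tendsto (fun n : ℕ => ∫ q, ph' (1 / ((n : ℝ) + 1)) (r q) * F q ∂μ) atTop (𝓝 0) := by
  rw [← integral_zero α ℝ (μ := μ)]
  refine tendsto_integral_of_dominated_convergence G (fun n => hF _ (inv_succ_pos n)) hG
    (fun n => ?_) ?_
  · filter_upwards [h] with q hq
    rw [Real.norm_eq_abs, abs_mul, abs_of_nonneg (ph'_nonneg (inv_succ_pos n) hq.1)]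
    have h1 := ph'_le (inv_succ_pos n) hq.1
    calc _ ≤ 1 / r q * (r q * G q) := mul_le_mul h1 hq.2 (abs_nonneg _) (by have := hq.1; positivity)
      _ = G q := by have := hq.1; field_simp
  · filter_upwards [h] with q hq
    simpa using (tendsto_ph' hq.1).mul_const (F q)

theorem hasDerivAt_ph' {ρ r : ℝ} (hρ : 0 < ρ) (hr : 0 < r) :
    HasDerivAt (ph' ρ) (-(2 * ρ / (r + ρ) ^ 3)) r := by
  have h1 : HasDerivAt (fun r : ℝ => (r + ρ) ^ 2) (2 * (r + ρ)) r := by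
    simpa [Pi.pow_def] using ((hasDerivAt_id r).add_const ρ).pow 2
  refine ((hasDerivAt_const r ρ).div h1 (by positivity)).congr_deriv ?_
  field_simp
  ring

theorem wt_ph' {ρ : ℝ} (hρ : 0 < ρ) : Wt (ph' ρ) fun r => -(2 * ρ / (r + ρ) ^ 3) where
  hasDeriv r hr := hasDerivAt_ph' hρ hr
  cont := (ContinuousOn.div (by fun_prop) (by fun_prop) fun r hr => by
    have : (0 : ℝ) < r := hr
    positivity).neg

theorem mul_abs_ph''_le {ρ r : ℝ} (hρ : 0 < ρ) (hr : 0 < r) :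
    r * |-(2 * ρ / (r + ρ) ^ 3)| ≤ 2 * ph' ρ r := by
  have e : 2 * ρ / (r + ρ) ^ 3 = 2 * ph' ρ r / (r + ρ) := by unfold ph'; field_simp
  have h := ph'_nonneg hρ hr
  rw [abs_neg, abs_of_nonneg (by positivity), e, ← mul_div_assoc, div_le_iff₀ (by positivity)]
  nlinarith [mul_nonneg h hρ.le]

section
variable [hd : Fact (4 ≤ d)] {p ζ : ℝ} {v : Sp d → ℝ → ℝ} (hv : FE p ζ v)
include hv

theorem integrable_slab_ph'_mul {ρ : ℝ} (hρ : 0 < ρ) {F : Sp d × ℝ → ℝ}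
    (hF : ContinuousOn F (off d)) {C : ℝ} (h : ∀ q ∈ off d, |F q| ≤ C * Df p ζ v q) (t1 t2 : ℝ) :
    Integrable (fun q => ph' ρ ‖q.1‖ * F q) (slab d t1 t2) := by
  refine hv.integrable_slab (F := fun q => ph' ρ ‖q.1‖ * F q) (C := 1 / ρ * C) ((continuousOn_ph' hρ).mul hF) (fun q hq => ?_) t1 t2
  have hp := norm_pos_of_mem_off hq
  rw [abs_mul, abs_of_nonneg (ph'_nonneg hρ hp), mul_assoc]
  exact mul_le_mul (ph'_le_inv hρ hp) (h q hq) (abs_nonneg _) (by positivity)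

theorem continuousOn_mul_vt : ContinuousOn (fun q : Sp d × ℝ => v q.1 q.2 * vt v q) (off d) :=
  (continuousOn_of_contDiffAt fun _ hq => hv.reg.contDiffAt_one hq).mul (continuousOn_vt hv.reg)

theorem abs_mul_vt_le {q : Sp d × ℝ} (hq : q ∈ off d) :
    |v q.1 q.2 * vt v q| ≤ ‖q.1‖ * (2 * Df p ζ v q) := by
  have k := abs_mul_div_le_Df hv.adm v hq (le_Df hv.adm v q).2.1
  have hp := norm_pos_of_mem_off hq
  have e : v q.1 q.2 * vt v q = ‖q.1‖ * (vt v q * (v q.1 q.2 / ‖q.1‖)) := by field_simp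
  rw [e, abs_mul, abs_of_pos hp]
  exact mul_le_mul_of_nonneg_left k hp.le

theorem integrable_ph'_mul_vt {ρ : ℝ} (hρ : 0 < ρ) (t : ℝ) :
    Integrable fun x => ph' ρ ‖x‖ * (v x t * vt v (x, t)) := by
  refine hv.integrable_slice (F := fun q => ph' ρ ‖q.1‖ * (v q.1 q.2 * vt v q)) (C := 2)
    ((continuousOn_ph' hρ).mul (continuousOn_mul_vt hv)) (fun q hq => ?_) t
  have hp := norm_pos_of_mem_off hq
  have k := abs_mul_vt_le hv hq
  rw [abs_mul, abs_of_nonneg (ph'_nonneg hρ hp)]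
  calc _ ≤ 1 / ‖q.1‖ * (‖q.1‖ * (2 * Df p ζ v q)) :=
        mul_le_mul (ph'_le hρ hp) k (abs_nonneg _) (by positivity)
    _ = _ := by field_simp

theorem tendsto_ph'_mul_vt (t : ℝ) :
    Tendsto (fun n : ℕ => ∫ x, ph' (1 / ((n : ℝ) + 1)) ‖x‖ * (v x t * vt v (x, t))) atTop (𝓝 0) := by
  refine tendsto_integral_ph' (F := fun x => v x t * vt v (x, t)) (r := fun x : Sp d => ‖x‖)
    (fun ρ hρ => (integrable_ph'_mul_vt hv hρ t).1) ((integrable_slice_Df hv t).const_mul 2) ?_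
  filter_upwards [ae_ne_zero (d := d)] with x hx
  exact ⟨norm_pos_iff.2 hx, abs_mul_vt_le hv (q := (x, t)) (mem_off.2 hx)⟩

theorem continuousOn_sq_gr : ContinuousOn (fun q => ‖gr v q‖ ^ 2) (off d) :=
  (continuousOn_gr hv.reg).norm.pow 2

theorem integrable_slab_ph'_gr {ρ : ℝ} (hρ : 0 < ρ) (t1 t2 : ℝ) :
    Integrable (fun q => ph' ρ ‖q.1‖ * ‖gr v q‖ ^ 2) (slab d t1 t2) :=
  integrable_slab_ph'_mul hv hρ (continuousOn_sq_gr hv) (C := 2) (fun q _ => by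
    rw [abs_of_nonneg (by positivity)]; exact (le_Df hv.adm v q).1) t1 t2

theorem integrable_slab_ph'_vt {ρ : ℝ} (hρ : 0 < ρ) (t1 t2 : ℝ) :
    Integrable (fun q => ph' ρ ‖q.1‖ * vt v q ^ 2) (slab d t1 t2) :=
  integrable_slab_ph'_mul hv hρ (F := fun q => vt v q ^ 2) ((continuousOn_vt hv.reg).pow 2) (C := 2) (fun q _ => by
    rw [abs_of_nonneg (by positivity)]; exact (le_Df hv.adm v q).2.1) t1 t2

theorem integrable_slab_ph'_sq_div {ρ : ℝ} (hρ : 0 < ρ) (t1 t2 : ℝ) :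
    Integrable (fun q => ph' ρ ‖q.1‖ * (v q.1 q.2 ^ 2 / ‖q.1‖ ^ 2)) (slab d t1 t2) :=
  integrable_slab_ph'_mul hv hρ (continuousOn_sq_div hv.reg) (C := 1) (fun q _ => by
    rw [abs_of_nonneg (by positivity), one_mul]; exact (le_Df hv.adm v q).2.2.2.1) t1 t2

/-- A weighted Caccioppoli inequality. -/
theorem caccioppoli (hS : ∀ q ∈ off d, Sf p ζ v q = 0) {ρ : ℝ} (hρ : 0 < ρ) {t1 t2 : ℝ}
    (h12 : t1 ≤ t2) :
    ∫ q, ph' ρ ‖q.1‖ * ‖gr v q‖ ^ 2 ∂(slab d t1 t2)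
      ≤ 2 * (∫ q, ph' ρ ‖q.1‖ * vt v q ^ 2 ∂(slab d t1 t2))
        + 4 * (∫ q, ph' ρ ‖q.1‖ * (v q.1 q.2 ^ 2 / ‖q.1‖ ^ 2) ∂(slab d t1 t2))
        + 2 * ((∫ x, ph' ρ ‖x‖ * (v x t1 * vt v (x, t1)))
          - ∫ x, ph' ρ ‖x‖ * (v x t2 * vt v (x, t2))) := by
  have hA := hv.adm
  have hr := hv.reg
  have cv : ContinuousOn (fun q : Sp d × ℝ => v q.1 q.2) (off d) :=
    continuousOn_of_contDiffAt fun q hq => hr.contDiffAt_one hq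
  have cn : ContinuousOn (fun q : Sp d × ℝ => ‖q.1‖) (off d) := by fun_prop
  have cW : ContinuousOn (fun q : Sp d × ℝ => ζ * |v q.1 q.2| ^ (p + 1)) (off d) := by
    simp only [← potential_mul hA]
    exact ((continuous_abs_rpow_mul hA).comp_continuousOn cv).mul cv
  have bnd : ∀ r, 0 < r → |ph' ρ r| ≤ 1 / ρ := fun r hr => by
    rw [abs_of_nonneg (ph'_nonneg hρ hr)]; exact ph'_le_inv hρ hr
  have hid := weighted_virial_identity hv (wt_ph' hρ) (C := 1 + 2 / ρ) (by positivity)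
    (fun r hr => (bnd r hr).trans (by rw [div_le_iff₀ hρ, add_mul, div_mul_cancel₀ _ hρ.ne']; linarith))
    (fun r hr => by
      have h := ph'_le hρ hr
      have h0 := ph'_nonneg hρ hr
      rw [abs_of_nonneg h0]
      rw [le_div_iff₀ hr] at h
      have : 0 ≤ 2 / ρ := by positivity
      linarith)
    (fun r hr => by
      have h := mul_abs_ph''_le hρ hr
      have h1 := ph'_le_inv hρ hr
      have : 2 / ρ = 2 * (1 / ρ) := by ring
      linarith) hS h12
  have i1 := integrable_slab_ph'_gr hv hρ t1 t2
  have i2 := integrable_slab_ph'_vt hv hρ t1 t2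
  have i3 := integrable_slab_ph'_sq_div hv hρ t1 t2
  have i12 : Integrable (fun q => 1 / 2 * (ph' ρ ‖q.1‖ * ‖gr v q‖ ^ 2) - ph' ρ ‖q.1‖ * vt v q ^ 2)
    (slab d t1 t2) := (i1.const_mul _).sub i2
  have i123 : Integrable (fun q => 1 / 2 * (ph' ρ ‖q.1‖ * ‖gr v q‖ ^ 2) - ph' ρ ‖q.1‖ * vt v q ^ 2
    - 2 * (ph' ρ ‖q.1‖ * (v q.1 q.2 ^ 2 / ‖q.1‖ ^ 2))) (slab d t1 t2) := i12.sub (i3.const_mul _)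
  have key : ∫ q, (1 / 2 * (ph' ρ ‖q.1‖ * ‖gr v q‖ ^ 2) - ph' ρ ‖q.1‖ * vt v q ^ 2
      - 2 * (ph' ρ ‖q.1‖ * (v q.1 q.2 ^ 2 / ‖q.1‖ ^ 2))) ∂(slab d t1 t2)
      ≤ ∫ q, (ph' ρ ‖q.1‖ * (‖gr v q‖ ^ 2 + v q.1 q.2 ^ 2 / ‖q.1‖ + ζ * |v q.1 q.2| ^ (p + 1)
        - vt v q ^ 2) + -(2 * ρ / (‖q.1‖ + ρ) ^ 3) * (Qf v q / ‖q.1‖ * v q.1 q.2))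
        ∂(slab d t1 t2) := by
    have c3 : ContinuousOn (fun q : Sp d × ℝ => -(2 * ρ / (‖q.1‖ + ρ) ^ 3)) (off d) :=
      continuousOn_weight (wt_ph' hρ).cont
    have pt : ∀ q ∈ off d, |-(2 * ρ / (‖q.1‖ + ρ) ^ 3) * (Qf v q / ‖q.1‖ * v q.1 q.2)|
        ≤ ph' ρ ‖q.1‖ * (1 / 2 * ‖gr v q‖ ^ 2 + 2 * (v q.1 q.2 ^ 2 / ‖q.1‖ ^ 2)) := fun q hq => by
      have hp := norm_pos_of_mem_off hq
      have e : -(2 * ρ / (‖q.1‖ + ρ) ^ 3) * (Qf v q / ‖q.1‖ * v q.1 q.2)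
          = ‖q.1‖ * -(2 * ρ / (‖q.1‖ + ρ) ^ 3) * (Qf v q / ‖q.1‖ * (v q.1 q.2 / ‖q.1‖)) := by
        field_simp
      have m := mul_abs_ph''_le hρ hp
      have k7 := Qf_sq_le v q
      rw [e, abs_mul, abs_mul, abs_of_pos hp]
      have h2 : |Qf v q / ‖q.1‖ * (v q.1 q.2 / ‖q.1‖)|
          ≤ 1 / 4 * ‖gr v q‖ ^ 2 + v q.1 q.2 ^ 2 / ‖q.1‖ ^ 2 := by
        rw [← div_pow, abs_le]
        constructor <;> nlinarith [sq_nonneg (1 / 2 * (Qf v q / ‖q.1‖) - v q.1 q.2 / ‖q.1‖),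
          sq_nonneg (1 / 2 * (Qf v q / ‖q.1‖) + v q.1 q.2 / ‖q.1‖)]
      have h0 := ph'_nonneg hρ hp
      refine (mul_le_mul m h2 (abs_nonneg _) (by positivity)).trans (le_of_eq (by ring))
    have j1 : Integrable (fun q => ph' ρ ‖q.1‖ * (‖gr v q‖ ^ 2 + v q.1 q.2 ^ 2 / ‖q.1‖
        + ζ * |v q.1 q.2| ^ (p + 1) - vt v q ^ 2)) (slab d t1 t2) := by
      refine integrable_slab_ph'_mul hv hρ (F := fun q => ‖gr v q‖ ^ 2 + v q.1 q.2 ^ 2 / ‖q.1‖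
        + ζ * |v q.1 q.2| ^ (p + 1) - vt v q ^ 2) ((((continuousOn_sq_gr hv).add ((cv.pow 2).div cn
        fun q => norm_ne_of_mem_off)).add cW).sub ((continuousOn_vt hr).pow 2))
        (C := 6 + |p + 1|) (fun q hq => ?_) t1 t2
      obtain ⟨k1, k2, k3, k4, k5, k6⟩ := le_Df hA v q
      have a1 := sq_nonneg ‖gr v q‖
      have a2 := sq_nonneg (vt v q)
      have a3 : 0 ≤ v q.1 q.2 ^ 2 / ‖q.1‖ := by positivity
      have a4 := potential_nonneg' hA (v q.1 q.2)
      have a5 := (a4.2).trans (mul_le_mul_of_nonneg_left k5 (abs_nonneg _))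
      have D0 := Df_nonneg hA v q
      rw [abs_le, add_mul]
      constructor <;> linarith [a4.1]
    have j2 : Integrable (fun q => -(2 * ρ / (‖q.1‖ + ρ) ^ 3) * (Qf v q / ‖q.1‖ * v q.1 q.2))
        (slab d t1 t2) := by
      have ib : Integrable (fun q => ph' ρ ‖q.1‖ * (1 / 2 * ‖gr v q‖ ^ 2
          + 2 * (v q.1 q.2 ^ 2 / ‖q.1‖ ^ 2))) (slab d t1 t2) := by
        refine ((i1.const_mul (1 / 2)).add (i3.const_mul 2)).congr (Eventually.of_forall fun q => ?_)
        simp only [Pi.add_apply]; ring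
      exact ib.mono' (aesm_slab (c3.mul (((continuousOn_Qf hr).div cn
        fun q => norm_ne_of_mem_off).mul cv)) t1 t2) (ae_slab_of_Icc fun q hq _ => pt q hq)
    refine integral_mono_ae i123 (j1.add j2) (ae_slab_of_Icc fun q hq _ => ?_)
    have hp := norm_pos_of_mem_off hq
    have h0 := ph'_nonneg hρ hp
    have a3 : 0 ≤ ph' ρ ‖q.1‖ * (v q.1 q.2 ^ 2 / ‖q.1‖) := by positivity
    have a4 := mul_nonneg h0 (potential_nonneg' hA (v q.1 q.2)).1
    have a5 := (abs_le.1 (pt q hq)).1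
    simp only [Pi.add_apply]
    linarith
  rw [hid, integral_sub i12 (i3.const_mul _), integral_sub (i1.const_mul _) i2, integral_const_mul,
    integral_const_mul] at key
  linarith

end
end
end Coulomb
namespace Coulomb
section
open Set Topology
variable {d : ℕ}

/-- A smooth cutoff, equal to one on the unit ball and vanishing off the ball of radius two. -/
noncomputable def eta (r : ℝ) : ℝ := Real.smoothTransition (-1 * r + 2)

/-- Derivative of the cutoff. -/
noncomputable def eta' (r : ℝ) : ℝ := sT' (-1 * r + 2) * (-1)

theorem wt_eta : Wt eta eta' := wt_comp_affine (-1) 2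

theorem eta_nonneg (r : ℝ) : 0 ≤ eta r := Real.smoothTransition.nonneg _

theorem eta_le_one (r : ℝ) : eta r ≤ 1 := Real.smoothTransition.le_one _

theorem eta_of_le {r : ℝ} (h : r ≤ 1) : eta r = 1 :=
  Real.smoothTransition.one_of_one_le (by linarith)

theorem eta_of_ge {r : ℝ} (h : 2 ≤ r) : eta r = 0 :=
  Real.smoothTransition.zero_of_nonpos (by linarith)

theorem continuous_eta : Continuous eta := by
  unfold eta; exact Real.smoothTransition.continuous.comp (by fun_prop)

theorem exists_bound_eta' : ∃ C, 0 ≤ C ∧ ∀ r, |eta' r| ≤ C := by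
  obtain ⟨C, h0, h⟩ := exists_bound_sT'
  exact ⟨C, h0, fun r => by simpa [eta'] using h _⟩

theorem WtB.mul_bounded {φ φ' δ δ' : ℝ → ℝ} {C K : ℝ} (h : WtB φ φ' C) (k : Wt δ δ') (hK : 0 ≤ K)
    (h1 : ∀ r, |δ r| ≤ 1) (h2 : ∀ r, |δ' r| ≤ K) :
    WtB (fun r => φ r * δ r) (fun r => φ' r * δ r + φ r * δ' r) (C + C * K) where
  toWt := h.toWt.mul k
  nonneg := add_nonneg h.nonneg (mul_nonneg h.nonneg hK)
  bd r hr := by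
    rw [abs_mul]
    have := mul_le_mul (h.bd r hr) (h1 r) (abs_nonneg _) h.nonneg
    have := mul_nonneg h.nonneg hK
    linarith
  lin r hr := by
    rw [abs_mul]
    have := mul_le_mul (h.lin r hr) (h1 r) (abs_nonneg _) (mul_nonneg h.nonneg hr.le)
    have := mul_nonneg (mul_nonneg h.nonneg hK) hr.le
    nlinarith
  bd' r hr := by
    refine (abs_add_le _ _).trans (add_le_add ?_ ?_)
    · rw [abs_mul]
      have := mul_le_mul (h.bd' r hr) (h1 r) (abs_nonneg _) h.nonneg
      linarith
    · rw [abs_mul]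
      exact mul_le_mul (h.bd r hr) (h2 r) (abs_nonneg _) h.nonneg

section
variable [hd : Fact (4 ≤ d)]

theorem integrable_slab_eta (t1 t2 : ℝ) :
    Integrable (fun q : Sp d × ℝ => eta ‖q.1‖) (slab d t1 t2) :=
  integrable_slab_of_continuous (continuous_eta.comp (by fun_prop)) (b := 2)
    (fun _ hq => eta_of_ge hq.le) t1 t2

theorem adm_zero (p : ℝ) : Adm p 0 := ⟨le_rfl, Or.inl rfl⟩

theorem exists_flux_bound (d : ℕ) [hd : Fact (4 ≤ d)] (p : ℝ) : ∃ C, 0 ≤ C ∧ ∀ (v : Sp d → ℝ → ℝ), FE p 0 v →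
    ∀ σ : ℝ, σ ^ 2 = 1 → ∀ t1 t2 K : ℝ, t1 ≤ t2 →
    (∀ q ∈ off d, ‖q.1‖ ≤ 2 → q.2 ∈ Icc t1 t2 → |Sf p 0 v q| ≤ K) → ∀ ρ, 0 < ρ →
    Integrable (fun q => ph' ρ ‖q.1‖ * eta ‖q.1‖ * (1 / 4 * Lf σ v q ^ 2)) (slab d t1 t2) ∧
    ∫ q, ph' ρ ‖q.1‖ * eta ‖q.1‖ * (1 / 4 * Lf σ v q ^ 2) ∂(slab d t1 t2)
      ≤ C * ((∫ q, Df p 0 v q ∂(slab d t1 t2)) + (∫ x, Df p 0 v (x, t1)) + ∫ x, Df p 0 v (x, t2))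
        + K ^ 2 * ∫ q, eta ‖q.1‖ ∂(slab d t1 t2) := by
  obtain ⟨B, hB, hD⟩ := exists_bound_Df (d := d) (adm_zero p)
  obtain ⟨N, hN, hη'⟩ := exists_bound_eta'
  refine ⟨N * B + 2 * B, by positivity, fun v hv σ hσ t1 t2 K h12 hK ρ hρ => ?_⟩
  have hr := hv.reg
  have hA := hv.adm
  have hη1 : ∀ r, |eta r| ≤ 1 := fun r => by rw [abs_of_nonneg (eta_nonneg r)]; exact eta_le_one r
  have hw := (wtB_ph hρ).mul_bounded wt_eta hN hη1 hη'
  have cη : ContinuousOn (fun q : Sp d × ℝ => eta ‖q.1‖) (off d) :=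
    (continuous_eta.comp (by fun_prop)).continuousOn
  have cL := continuousOn_Lf hr σ
  have iD := integrable_slab_Df hv t1 t2
  have iη := integrable_slab_eta (d := d) t1 t2
  have SB : ∀ q ∈ off d, q.2 ∈ Icc t1 t2 →
      |ph ρ ‖q.1‖ * eta ‖q.1‖ * (1 / 2 * Lf σ v q * Sf p 0 v q)|
        ≤ B * Df p 0 v q + K ^ 2 * eta ‖q.1‖ := fun q hq ht => by
    have hp := norm_pos_of_mem_off hq
    have D0 := Df_nonneg hA v q
    have e0 := eta_nonneg ‖q.1‖
    have e1 := eta_le_one ‖q.1‖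
    rcases le_or_gt 2 ‖q.1‖ with h2 | h2
    · rw [eta_of_ge h2]; simp only [mul_zero, zero_mul, abs_zero, add_zero]; positivity
    · have hs : Sf p 0 v q ^ 2 ≤ K ^ 2 := sq_le_sq' (abs_le.1 (hK q hq h2.le ht)).1
        (abs_le.1 (hK q hq h2.le ht)).2
      have k1 := (hD v q).1 σ hσ
      have p0 := ph_nonneg hρ hp
      have p1 := ph_le_one hρ hp
      rw [abs_mul, abs_of_nonneg (mul_nonneg p0 e0)]
      have a1 : |1 / 2 * Lf σ v q * Sf p 0 v q| ≤ Lf σ v q ^ 2 + Sf p 0 v q ^ 2 := by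
        rw [abs_le]
        constructor <;> nlinarith [sq_nonneg (Lf σ v q - Sf p 0 v q),
          sq_nonneg (Lf σ v q + Sf p 0 v q), sq_nonneg (Lf σ v q), sq_nonneg (Sf p 0 v q)]
      have a2 : ph ρ ‖q.1‖ * eta ‖q.1‖ ≤ eta ‖q.1‖ := mul_le_of_le_one_left e0 p1
      calc _ ≤ eta ‖q.1‖ * (B * Df p 0 v q + K ^ 2) :=
            mul_le_mul a2 (a1.trans (add_le_add k1 hs)) (abs_nonneg _) e0
        _ ≤ _ := by nlinarith [mul_nonneg hB D0]
  have cS : ContinuousOn (fun q => ph ρ ‖q.1‖ * eta ‖q.1‖ * (1 / 2 * Lf σ v q * Sf p 0 v q)) (off d) :=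
    ((continuousOn_ph hρ).mul cη).mul ((cL.const_mul _).mul (continuousOn_Sf hr hA))
  have iB : Integrable (fun q => B * Df p 0 v q + K ^ 2 * eta ‖q.1‖) (slab d t1 t2) :=
    (iD.const_mul _).add (iη.const_mul _)
  have hS : Integrable (fun q => ph ρ ‖q.1‖ * eta ‖q.1‖ * (1 / 2 * Lf σ v q * Sf p 0 v q))
      (slab d t1 t2) := iB.mono' (aesm_slab cS t1 t2) (ae_slab_of_Icc SB)
  have hm2 : ∀ q, |1 / 4 * Lf σ v q ^ 2 - 1 / 2 * ef p 0 v q| ≤ B * Df p 0 v q := fun q => by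
    have k1 := (hD v q).1 σ hσ
    have := abs_le.1 (hD v q).2.1
    have := sq_nonneg (Lf σ v q)
    rw [abs_le]; constructor <;> linarith
  have hid := weighted_identity hv hw hσ h12 hS
  have hI : ∀ t, |∫ x, ph ρ ‖x‖ * eta ‖x‖ * eS p 0 σ v (x, t)| ≤ B * ∫ x, Df p 0 v (x, t) := by
    intro t
    rw [← integral_const_mul]
    rw [← Real.norm_eq_abs]
    refine norm_integral_le_of_norm_le ((integrable_slice_Df hv t).const_mul B) ?_
    filter_upwards [ae_ne_zero (d := d)] with x hx
    have hp : 0 < ‖x‖ := norm_pos_iff.2 hx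
    have k := hD v (x, t)
    rw [Real.norm_eq_abs, abs_mul]
    refine (mul_le_of_le_one_left (abs_nonneg _) ?_).trans (abs_eS_le (k.1 σ hσ) k.2.1)
    rw [abs_of_nonneg (mul_nonneg (ph_nonneg hρ hp) (eta_nonneg _))]
    exact mul_le_one₀ (ph_le_one hρ hp) (eta_nonneg _) (eta_le_one _)
  have i1 : Integrable (fun q => ph' ρ ‖q.1‖ * eta ‖q.1‖ * (1 / 4 * Lf σ v q ^ 2)) (slab d t1 t2) := by
    simp only [mul_assoc]
    refine integrable_slab_ph'_mul hv hρ (F := fun q => eta ‖q.1‖ * (1 / 4 * Lf σ v q ^ 2))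
      (cη.mul ((cL.pow 2).const_mul _)) (C := B) (fun q hq => ?_) t1 t2
    have k1 := (hD v q).1 σ hσ
    have e0 := eta_nonneg ‖q.1‖
    rw [abs_of_nonneg (by positivity)]
    have := mul_le_of_le_one_left (show 0 ≤ 1 / 4 * Lf σ v q ^ 2 by positivity) (eta_le_one ‖q.1‖)
    have := sq_nonneg (Lf σ v q)
    linarith
  refine ⟨i1, ?_⟩
  have key : (∫ q, (-((ph' ρ ‖q.1‖ * eta ‖q.1‖ + ph ρ ‖q.1‖ * eta' ‖q.1‖)
        * (1 / 4 * Lf σ v q ^ 2 - 1 / 2 * ef p 0 v q))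
        - ph ρ ‖q.1‖ * eta ‖q.1‖ * Mf p 0 v q
        + ph ρ ‖q.1‖ * eta ‖q.1‖ * (1 / 2 * Lf σ v q * Sf p 0 v q)) ∂(slab d t1 t2))
      ≤ ∫ q, (-(ph' ρ ‖q.1‖ * eta ‖q.1‖ * (1 / 4 * Lf σ v q ^ 2))
        + (N * B * Df p 0 v q + (B * Df p 0 v q + K ^ 2 * eta ‖q.1‖))) ∂(slab d t1 t2) := by
    have j2 : Integrable (fun q => N * B * Df p 0 v q + (B * Df p 0 v q + K ^ 2 * eta ‖q.1‖))
      (slab d t1 t2) := (iD.const_mul _).add iB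
    refine integral_mono_ae ?_ (i1.neg.add j2) (ae_slab_of_Icc fun q hq ht => ?_)
    · have hc1 := continuousOn_weight (d := d) hw.cont
      have hc2 := continuousOn_weight (d := d) hw.contDiffOn.continuousOn
      have ce := continuousOn_ef hr hA
      have a1 : Integrable (fun q => (ph' ρ ‖q.1‖ * eta ‖q.1‖ + ph ρ ‖q.1‖ * eta' ‖q.1‖)
          * (1 / 4 * Lf σ v q ^ 2 - 1 / 2 * ef p 0 v q)) (slab d t1 t2) := by
        refine hv.integrable_slab (F := fun q => (ph' ρ ‖q.1‖ * eta ‖q.1‖ + ph ρ ‖q.1‖ * eta' ‖q.1‖)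
          * (1 / 4 * Lf σ v q ^ 2 - 1 / 2 * ef p 0 v q))
          (hc1.mul (((cL.pow 2).const_mul _).sub (ce.const_mul _)))
          (C := (1 + 1 / ρ + (1 + 1 / ρ) * N) * B) (fun q hq => ?_) t1 t2
        rw [abs_mul, mul_assoc]
        exact mul_le_mul (hw.bd' _ (norm_pos_of_mem_off hq)) (hm2 q) (abs_nonneg _) hw.nonneg
      have a2 : Integrable (fun q => ph ρ ‖q.1‖ * eta ‖q.1‖ * Mf p 0 v q) (slab d t1 t2) := by
        refine hv.integrable_slab (F := fun q => ph ρ ‖q.1‖ * eta ‖q.1‖ * Mf p 0 v q)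
          (hc2.mul (continuousOn_Mf hr hA))
          (C := (1 + 1 / ρ + (1 + 1 / ρ) * N) * B) (fun q hq => ?_) t1 t2
        have e2 := mul_le_mul_of_nonneg_right (hw.lin _ (norm_pos_of_mem_off hq))
          (abs_nonneg (Mf p 0 v q))
        have e3 := mul_le_mul_of_nonneg_left (hD v q).2.2 hw.nonneg
        rw [abs_mul]
        refine e2.trans ?_
        rw [mul_assoc, mul_assoc]
        exact e3
      exact (a1.neg.sub a2).add hS
    · have hp := norm_pos_of_mem_off hq
      obtain ⟨k1, k2, k3⟩ := hD v q
      have k1 := k1 σ hσ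
      have s1 := (abs_le.1 (SB q hq ht)).2
      have p0 := ph_nonneg hρ hp
      have p1 := ph_le_one hρ hp
      have p2 := ph_sub hρ hp
      have e0 := eta_nonneg ‖q.1‖
      have m2 := hm2 q
      have m3 : |ph ρ ‖q.1‖ * eta' ‖q.1‖ * (1 / 4 * Lf σ v q ^ 2 - 1 / 2 * ef p 0 v q)|
          ≤ N * (B * Df p 0 v q) := by
        rw [abs_mul, abs_mul, abs_of_nonneg p0]
        exact mul_le_mul ((mul_le_of_le_one_left (abs_nonneg _) p1).trans (hη' _)) m2
          (abs_nonneg _) hN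
      have m4 : ph' ρ ‖q.1‖ * (1 / 2 * ef p 0 v q) ≤ ph ρ ‖q.1‖ * Mf p 0 v q := by
        have a1 := half_ef_le hA (Or.inl rfl) (v := v) hq
        have a2 := Mf_nonneg hA (Or.inl rfl) (v := v) hq
        have a3 := mul_le_mul_of_nonneg_left a1 (ph'_nonneg hρ hp)
        have a4 := mul_nonneg (sq_nonneg (ph ρ ‖q.1‖)) a2
        rw [← p2] at a4
        nlinarith
      have m5 := mul_le_mul_of_nonneg_left m4 e0
      have m3 := (abs_le.1 m3).1
      simp only [Pi.add_apply, Pi.neg_apply]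
      nlinarith
  rw [← hid] at key
  have j2 : Integrable (fun q => N * B * Df p 0 v q + (B * Df p 0 v q + K ^ 2 * eta ‖q.1‖))
      (slab d t1 t2) := (iD.const_mul _).add iB
  have i1n : Integrable (fun q => -(ph' ρ ‖q.1‖ * eta ‖q.1‖ * (1 / 4 * Lf σ v q ^ 2)))
    (slab d t1 t2) := i1.neg
  rw [integral_add i1n j2, integral_add (iD.const_mul _) iB, integral_add (iD.const_mul _)
    (iη.const_mul _), integral_const_mul, integral_const_mul, integral_const_mul] at key
  rw [integral_neg] at key
  have I1 := abs_le.1 (hI t1)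
  have I2 := abs_le.1 (hI t2)
  have d0 : 0 ≤ ∫ q, Df p 0 v q ∂(slab d t1 t2) := integral_nonneg fun q => Df_nonneg hA v q
  have d1 : 0 ≤ ∫ x, Df p 0 v (x, t1) := integral_nonneg fun x => Df_nonneg hA v _
  have d2 : 0 ≤ ∫ x, Df p 0 v (x, t2) := integral_nonneg fun x => Df_nonneg hA v _
  have hs : -((∫ x, ph ρ ‖x‖ * eta ‖x‖ * eS p 0 σ v (x, t2))
      - ∫ x, ph ρ ‖x‖ * eta ‖x‖ * eS p 0 σ v (x, t1)) * σ
      ≤ B * (∫ x, Df p 0 v (x, t1)) + B * ∫ x, Df p 0 v (x, t2) := by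
    rcases mul_eq_zero.1 (show (σ - 1) * (σ + 1) = 0 by linear_combination hσ) with h | h
    · obtain rfl : σ = 1 := by linarith
      linarith
    · obtain rfl : σ = -1 := by linarith
      linarith
  have n1 := mul_nonneg (mul_nonneg hN hB) d1
  have n2 := mul_nonneg (mul_nonneg hN hB) d2
  have n3 := mul_nonneg hB d0
  have n4 := mul_nonneg hB d1
  have n5 := mul_nonneg hB d2
  nlinarith

end
end
end Coulomb
namespace Coulomb
section
open Set Topology
variable {d : ℕ}

/-- The affine change of time `t ↦ a * t + s`. -/
def tmap (a s : ℝ) (v : Sp d → ℝ → ℝ) : Sp d → ℝ → ℝ := fun x t => v x (a * t + s)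

theorem gr_tmap (a s : ℝ) (v : Sp d → ℝ → ℝ) (q : Sp d × ℝ) :
    gr (tmap a s v) q = gr v (q.1, a * q.2 + s) := rfl

theorem deriv_comp_affine (a s : ℝ) (f : ℝ → ℝ) (t : ℝ) :
    deriv (fun t => f (a * t + s)) t = a * deriv f (a * t + s) := by
  have h := deriv_comp_mul_left a (fun t => f (t + s)) t
  rw [deriv_comp_add_const] at h
  simpa using h

theorem vt_tmap (a s : ℝ) (v : Sp d → ℝ → ℝ) (q : Sp d × ℝ) :
    vt (tmap a s v) q = a * vt v (q.1, a * q.2 + s) := deriv_comp_affine a s _ _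

theorem Sf_tmap (p ζ : ℝ) {a : ℝ} (ha : a ^ 2 = 1) (s : ℝ) (v : Sp d → ℝ → ℝ) (q : Sp d × ℝ) :
    Sf p ζ (tmap a s v) q = Sf p ζ v (q.1, a * q.2 + s) := by
  have h : deriv (tmap a s v q.1) = fun t => a * deriv (v q.1) (a * t + s) :=
    funext fun t => deriv_comp_affine a s _ t
  have h2 : deriv (deriv (tmap a s v q.1)) q.2 = deriv (deriv (v q.1)) (a * q.2 + s) := by
    rw [h, deriv_const_mul_field, deriv_comp_affine, ← mul_assoc, ← sq, ha, one_mul]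
  unfold Sf
  rw [h2]
  rfl

theorem Lf_tmap {a : ℝ} (s σ : ℝ) (v : Sp d → ℝ → ℝ) (q : Sp d × ℝ) :
    Lf σ (tmap a s v) q = Lf (a * σ) v (q.1, a * q.2 + s) := by
  unfold Lf Qf
  rw [gr_tmap, vt_tmap]
  simp only [tmap]
  ring

theorem eS_tmap (p ζ : ℝ) {a : ℝ} (s σ : ℝ) (v : Sp d → ℝ → ℝ) (q : Sp d × ℝ) :
    eS p ζ σ (tmap a s v) q = eS p ζ (a * σ) v (q.1, a * q.2 + s) := by
  unfold eS
  rw [Lf_tmap]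
  rfl

theorem eF_tmap (p ζ : ℝ) {a : ℝ} (ha : a ^ 2 = 1) (s : ℝ) (v : Sp d → ℝ → ℝ) (q : Sp d × ℝ) :
    eF p ζ (tmap a s v) q = eF p ζ v (q.1, a * q.2 + s) := by
  unfold eF
  rw [vt_tmap, gr_tmap, mul_pow, ha, one_mul]
  rfl

theorem Reg.tmap {v : Sp d → ℝ → ℝ} (hv : Reg v) (a s : ℝ) : Reg (tmap a s v) where
  cont := hv.cont.comp (f := fun q : Sp d × ℝ => (q.1, a * q.2 + s)) (by fun_prop)
  smooth := hv.smooth.comp (f := fun q : Sp d × ℝ => (q.1, a * q.2 + s)) (by fun_prop)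
    fun q hq => ⟨hq.1, mem_univ _⟩

theorem FE.tmap {p ζ : ℝ} {v : Sp d → ℝ → ℝ} (hv : FE p ζ v) {a : ℝ} (ha : a ^ 2 = 1) (s : ℝ) :
    FE p ζ (tmap a s v) where
  reg := hv.reg.tmap a s
  adm := hv.adm
  int t := by simpa only [eF_tmap p ζ ha] using hv.int (a * t + s)
  bdd := by
    obtain ⟨K, hK⟩ := hv.bdd
    exact ⟨K, fun t => by simpa only [eF_tmap p ζ ha] using hK (a * t + s)⟩

theorem Sol.tmap {p ζ E : ℝ} {v : Sp d → ℝ → ℝ} (hv : Sol p ζ E v) {a : ℝ} (ha : a ^ 2 = 1)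
    (s : ℝ) : Sol p ζ E (tmap a s v) where
  toFE := hv.toFE.tmap ha s
  eqn q hq := by rw [Sf_tmap p ζ ha]; exact hv.eqn _ (mem_off.2 (mem_off.1 hq))
  cond := hv.cond
  energy t := by simpa only [eF_tmap p ζ ha] using hv.energy (a * t + s)

theorem Reg.sub {v w : Sp d → ℝ → ℝ} (hv : Reg v) (hw : Reg w) : Reg (v - w) where
  cont := hv.cont.sub hw.cont
  smooth := hv.smooth.sub hw.smooth

theorem gr_sub {v w : Sp d → ℝ → ℝ} (hv : Reg v) (hw : Reg w) {q : Sp d × ℝ} (hq : q ∈ off d) :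
    gr (v - w) q = gr v q - gr w q := by
  rw [(hv.sub hw).gr_eq hq, hv.gr_eq hq, hw.gr_eq hq, ← map_sub, ← ContinuousLinearMap.sub_comp]
  congr 2
  exact fderiv_fun_sub (hv.hasFDerivAt hq).differentiableAt (hw.hasFDerivAt hq).differentiableAt

theorem vt_sub {v w : Sp d → ℝ → ℝ} (hv : Reg v) (hw : Reg w) {q : Sp d × ℝ} (hq : q ∈ off d) :
    vt (v - w) q = vt v q - vt w q :=
  deriv_fun_sub (hv.hasDerivAt_right hq).differentiableAt (hw.hasDerivAt_right hq).differentiableAt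

theorem Sf_sub {v w : Sp d → ℝ → ℝ} (hv : Reg v) (hw : Reg w) (p : ℝ) {q : Sp d × ℝ}
    (hq : q ∈ off d) : Sf p 0 (v - w) q = Sf p 0 v q - Sf p 0 w q := by
  have hn := (isOpen_off (d := d)).mem_nhds hq
  have e1 : gr (v - w) =ᶠ[𝓝 q] fun z => gr v z - gr w z := by
    filter_upwards [hn] with z hz using gr_sub hv hw hz
  have e2 : vt (v - w) =ᶠ[𝓝 q] fun z => vt v z - vt w z := by
    filter_upwards [hn] with z hz using vt_sub hv hw hz
  rw [Sf_eq (hv.sub hw) p 0 hq, Sf_eq hv p 0 hq, Sf_eq hw p 0 hq, e1.fderiv_eq, e2.fderiv_eq,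
    fderiv_fun_sub (hv.hasFDerivAt_gr hq).differentiableAt (hw.hasFDerivAt_gr hq).differentiableAt,
    fderiv_fun_sub (hv.hasFDerivAt_vt hq).differentiableAt (hw.hasFDerivAt_vt hq).differentiableAt]
  simp only [sub_apply, inner_sub_left, Finset.sum_sub_distrib, Pi.sub_apply]
  ring

theorem eF_zero_sub_le {p ζ : ℝ} {v w : Sp d → ℝ → ℝ} (hv : Reg v) (hw : Reg w) (hA : Adm p ζ)
    {q : Sp d × ℝ} (hq : q ∈ off d) :
    eF p 0 (v - w) q ≤ 2 * (eF p ζ v q + eF p ζ w q) := by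
  have h1 := potential_nonneg hA (v q.1 q.2)
  have h2 := potential_nonneg hA (w q.1 q.2)
  have hp := norm_pos_of_mem_off hq
  have h3 : ‖gr v q - gr w q‖ ^ 2 ≤ 2 * ‖gr v q‖ ^ 2 + 2 * ‖gr w q‖ ^ 2 := by
    have := parallelogram_law_with_norm ℝ (gr v q) (gr w q)
    nlinarith [mul_self_nonneg ‖gr v q + gr w q‖]
  have h4 : (v q.1 q.2 - w q.1 q.2) ^ 2 / (2 * ‖q.1‖)
      ≤ 2 * (v q.1 q.2 ^ 2 / (2 * ‖q.1‖)) + 2 * (w q.1 q.2 ^ 2 / (2 * ‖q.1‖)) := by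
    rw [← mul_div_assoc, ← mul_div_assoc, ← add_div]
    gcongr
    nlinarith [sq_nonneg (v q.1 q.2 + w q.1 q.2)]
  unfold eF
  rw [gr_sub hv hw hq, vt_sub hv hw hq]
  simp only [Pi.sub_apply, zero_mul, zero_div]
  nlinarith [sq_nonneg (vt v q + vt w q)]

theorem FE.sub [Fact (4 ≤ d)] {p ζ : ℝ} {v w : Sp d → ℝ → ℝ} (hv : FE p ζ v) (hw : FE p ζ w) :
    FE p 0 (v - w) where
  reg := hv.reg.sub hw.reg
  adm := adm_zero p
  int t := by
    refine (((hv.int t).add (hw.int t)).const_mul 2).mono'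
      (aesm_slice (continuousOn_eF (hv.reg.sub hw.reg) (adm_zero p)) t) ?_
    filter_upwards [ae_ne_zero] with x hx
    rw [Real.norm_eq_abs, abs_of_nonneg (eF_nonneg (adm_zero p) _ _)]
    exact eF_zero_sub_le hv.reg hw.reg hv.adm (mem_off.2 hx)
  bdd := by
    obtain ⟨K, hK⟩ := hv.bdd
    obtain ⟨L, hL⟩ := hw.bdd
    refine ⟨2 * (K + L), fun t => ?_⟩
    have : ∫ x, eF p 0 (v - w) (x, t) ≤ ∫ x, 2 * (eF p ζ v (x, t) + eF p ζ w (x, t)) := by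
      refine integral_mono_of_nonneg (Eventually.of_forall fun x => eF_nonneg (adm_zero p) _ _)
        (((hv.int t).add (hw.int t)).const_mul 2) ?_
      filter_upwards [ae_ne_zero] with x hx
      exact eF_zero_sub_le hv.reg hw.reg hv.adm (mem_off.2 hx)
    rw [integral_const_mul, integral_add (hv.int t) (hw.int t)] at this
    linarith [hK t, hL t]

theorem exists_vt_flux_bound (d : ℕ) [Fact (4 ≤ d)] (p : ℝ) : ∃ C, 0 ≤ C ∧ ∀ v : Sp d → ℝ → ℝ,
    FE p 0 v → ∀ t1 t2 K, t1 ≤ t2 →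
    (∀ q ∈ off d, ‖q.1‖ ≤ 2 → q.2 ∈ Icc t1 t2 → |Sf p 0 v q| ≤ K) → ∀ ρ, 0 < ρ →
    ∫ q, ph' ρ ‖q.1‖ * eta ‖q.1‖ * vt v q ^ 2 ∂slab d t1 t2
      ≤ C * ((∫ q, Df p 0 v q ∂slab d t1 t2) + (∫ x, Df p 0 v (x, t1)) + ∫ x, Df p 0 v (x, t2))
        + 4 * (K ^ 2 * ∫ q, eta ‖q.1‖ ∂slab d t1 t2) := by
  obtain ⟨C, hC, h⟩ := exists_flux_bound d p
  refine ⟨4 * C, by positivity, fun v hv t1 t2 K h12 hK ρ hρ => ?_⟩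
  obtain ⟨i1, b1⟩ := h v hv 1 (by norm_num) t1 t2 K h12 hK ρ hρ
  obtain ⟨i2, b2⟩ := h v hv (-1) (by norm_num) t1 t2 K h12 hK ρ hρ
  have key : ∫ q, ph' ρ ‖q.1‖ * eta ‖q.1‖ * vt v q ^ 2 ∂slab d t1 t2
      ≤ ∫ q, 2 * (ph' ρ ‖q.1‖ * eta ‖q.1‖ * (1 / 4 * Lf 1 v q ^ 2)
        + ph' ρ ‖q.1‖ * eta ‖q.1‖ * (1 / 4 * Lf (-1) v q ^ 2)) ∂slab d t1 t2 := by
    refine integral_mono_of_nonneg ?_ ((i1.add i2).const_mul 2) ?_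
    · filter_upwards [ae_mem_off t1 t2] with q hq
      have := ph'_nonneg hρ (norm_pos_of_mem_off hq)
      have := eta_nonneg ‖q.1‖
      simp only [Pi.zero_apply]
      positivity
    · filter_upwards [ae_mem_off t1 t2] with q hq
      have h1 := mul_nonneg (ph'_nonneg hρ (norm_pos_of_mem_off hq)) (eta_nonneg ‖q.1‖)
      have h2 : vt v q ^ 2 ≤ 2 * (1 / 4 * Lf 1 v q ^ 2 + 1 / 4 * Lf (-1) v q ^ 2) := by
        unfold Lf
        nlinarith [sq_nonneg (Qf v q / ‖q.1‖ + (d - 1) / 2 * v q.1 q.2 / ‖q.1‖)]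
      have := mul_le_mul_of_nonneg_left h2 h1
      linarith
  rw [integral_const_mul, integral_add i1 i2] at key
  linarith

end
end Coulomb
namespace Coulomb
section
open Set Topology
variable {d : ℕ}

theorem tendsto_integral_zero_of_le_add {α ι : Type*} [MeasurableSpace α] {μ : Measure α}
    {l : Filter ι} [l.IsCountablyGenerated] {f Z : ι → α → ℝ} {g G : α → ℝ} {C : ℝ} (hC : 0 ≤ C)
    (hf : ∀ i, Integrable (f i) μ) (hg : Integrable g μ) (hG : Integrable G μ)
    (hf0 : ∀ i a, 0 ≤ f i a) (hg0 : ∀ a, 0 ≤ g a) (hG0 : ∀ a, 0 ≤ G a)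
    (hZ0 : ∀ i a, 0 ≤ Z i a) (hZm : ∀ i, AEStronglyMeasurable (Z i) μ)
    (hlim : Tendsto (fun i => ∫ a, f i a ∂μ) l (𝓝 (∫ a, g a ∂μ)))
    (hfg : ∀ᵐ a ∂μ, Tendsto (fun i => f i a) l (𝓝 (g a)))
    (hZ : ∀ᵐ a ∂μ, Tendsto (fun i => Z i a) l (𝓝 0))
    (hle : ∀ᶠ i in l, ∀ᵐ a ∂μ, Z i a ≤ C * (f i a + g a) + G a) :
    Tendsto (fun i => ∫ a, Z i a ∂μ) l (𝓝 0) := by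
  have hmin (i : ι) : Integrable (fun a => min (f i a) (g a)) μ :=
    hg.mono' ((hf i).1.inf hg.1) <| Eventually.of_forall fun a => by
      rw [Real.norm_eq_abs, abs_of_nonneg (le_min (hf0 i a) (hg0 a))]; exact min_le_right _ _
  have L1 : Tendsto (fun i => ∫ a, min (f i a) (g a) ∂μ) l (𝓝 (∫ a, g a ∂μ)) := by
    refine tendsto_integral_filter_of_dominated_convergence g (Eventually.of_forall fun i => (hmin i).1)
      (Eventually.of_forall fun i => Eventually.of_forall fun a => ?_) hg ?_
    · rw [Real.norm_eq_abs, abs_of_nonneg (le_min (hf0 i a) (hg0 a))]; exact min_le_right _ _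
    · filter_upwards [hfg] with a ha
      simpa using ha.min (tendsto_const_nhds (x := g a))
  have iH : Integrable (fun a => 2 * C * g a + G a) μ := (hg.const_mul _).add hG
  have hH0 (a : α) : 0 ≤ 2 * C * g a + G a :=
    add_nonneg (mul_nonneg (by positivity) (hg0 a)) (hG0 a)
  have hcut (i : ι) (a : α) : ‖min (Z i a) (2 * C * g a + G a)‖ ≤ 2 * C * g a + G a := by
    rw [Real.norm_eq_abs, abs_of_nonneg (le_min (hZ0 i a) (hH0 a))]; exact min_le_right _ _
  have L2 : Tendsto (fun i => ∫ a, min (Z i a) (2 * C * g a + G a) ∂μ) l (𝓝 0) := by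
    rw [← integral_zero α ℝ (μ := μ)]
    refine tendsto_integral_filter_of_dominated_convergence (fun a => 2 * C * g a + G a)
      (Eventually.of_forall fun i => (hZm i).inf iH.1)
      (Eventually.of_forall fun i => Eventually.of_forall fun a => hcut i a) iH ?_
    filter_upwards [hZ] with a ha
    have := ha.min (tendsto_const_nhds (x := 2 * C * g a + G a))
    rwa [min_eq_left (hH0 a)] at this
  have L3 : Tendsto (fun i => C * (((∫ a, f i a ∂μ) + ∫ a, g a ∂μ) - 2 * ∫ a, min (f i a) (g a) ∂μ)
      + ∫ a, min (Z i a) (2 * C * g a + G a) ∂μ) l (𝓝 0) := by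
    have := ((((hlim.add_const (∫ a, g a ∂μ)).sub (L1.const_mul 2)).const_mul C).add L2)
    convert this using 2
    ring
  refine tendsto_of_tendsto_of_tendsto_of_le_of_le' tendsto_const_nhds L3
    (Eventually.of_forall fun i => integral_nonneg (hZ0 i)) ?_
  filter_upwards [hle] with i hi
  have icut : Integrable (fun a => min (Z i a) (2 * C * g a + G a)) μ :=
    iH.mono' ((hZm i).inf iH.1) (Eventually.of_forall (hcut i))
  have ifg : Integrable (fun a => f i a + g a) μ := (hf i).add hg
  have i2 : Integrable (fun a => f i a + g a - 2 * min (f i a) (g a)) μ :=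
    ifg.sub ((hmin i).const_mul 2)
  have i3 : Integrable (fun a => C * (f i a + g a - 2 * min (f i a) (g a))) μ := i2.const_mul C
  rw [← integral_add (hf i) hg, ← integral_const_mul 2, ← integral_sub ifg ((hmin i).const_mul 2),
    ← integral_const_mul, ← integral_add i3 icut]
  refine integral_mono_of_nonneg (Eventually.of_forall (hZ0 i)) (i3.add icut) ?_
  filter_upwards [hi] with a ha
  have h0 : 0 ≤ f i a + g a - 2 * min (f i a) (g a) := by
    linarith [min_le_left (f i a) (g a), min_le_right (f i a) (g a)]
  have h1 := mul_nonneg hC h0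
  rcases le_total (Z i a) (2 * C * g a + G a) with h | h
  · rw [min_eq_left h]; linarith
  · rw [min_eq_right h]
    have := mul_le_mul_of_nonneg_left (min_le_right (f i a) (g a)) hC
    nlinarith

section
variable [hd : Fact (4 ≤ d)] {p ζ E : ℝ} {v : Sp d → ℝ → ℝ}

theorem tendsto_Df_sub_tmap (hv : FE p ζ v) {q : Sp d × ℝ} (hq : q ∈ off d) :
    Tendsto (fun s => Df p 0 (v - tmap 1 s v) q) (𝓝 0) (𝓝 0) := by
  have hc : Continuous fun s : ℝ => (q.1, 1 * q.2 + s) := by fun_prop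
  have h0 : ((q.1, 1 * q.2 + 0) : Sp d × ℝ) = q := by simp
  have hn : off d ∈ 𝓝 ((q.1, 1 * q.2 + 0) : Sp d × ℝ) := by
    rw [h0]; exact isOpen_off.mem_nhds hq
  have key : ∀ {β : Type} [NormedAddCommGroup β] {F : Sp d × ℝ → β}, ContinuousOn F (off d) →
      Tendsto (fun s => F q - F (q.1, 1 * q.2 + s)) (𝓝 0) (𝓝 0) := by
    intro β _ F hF
    have h1 : ContinuousAt (fun s => F (q.1, 1 * q.2 + s)) 0 :=
      (hF.continuousAt hn).comp (f := fun s : ℝ => (q.1, 1 * q.2 + s)) hc.continuousAt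
    have h2 := (tendsto_const_nhds (x := F q)).sub h1.tendsto
    simp only [h0, sub_self] at h2
    exact h2
  have k1 := key (continuousOn_gr hv.reg)
  have k2 := key (continuousOn_vt hv.reg)
  have k3 := key hv.reg.cont.continuousOn
  have T := ((((((k1.norm.pow 2).const_mul (1 / 2)).add ((k2.pow 2).const_mul (1 / 2)))).add
    ((k3.pow 2).div_const (2 * ‖q.1‖)))).add ((k3.pow 2).div_const (‖q.1‖ ^ 2))
  simp only [norm_zero, ne_eq, OfNat.ofNat_ne_zero, not_false_eq_true, zero_pow, mul_zero, add_zero,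
    zero_div] at T
  refine T.congr fun s => ?_
  unfold Df eF
  rw [gr_sub hv.reg (hv.reg.tmap 1 s) hq, vt_sub hv.reg (hv.reg.tmap 1 s) hq, gr_tmap, vt_tmap]
  simp [tmap]

theorem exists_Df_sub_tmap_le (hv : FE p ζ v) (t1 t2 : ℝ) : ∃ C, 0 ≤ C ∧ ∀ s, |s| ≤ 1 →
    ∀ q ∈ off d, q.2 ∈ Icc t1 t2 → Df p 0 (v - tmap 1 s v) q
      ≤ 6 * (eF p ζ v (q.1, 1 * q.2 + s) + eF p ζ v q) + C * invSq q.1 := by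
  obtain ⟨B, hB0, hB⟩ := exists_bound_ball hv.reg.cont 1 (t1 - 1) (t2 + 1)
  refine ⟨4 * B ^ 2, by positivity, fun s hs q hq ht => ?_⟩
  have hp := norm_pos_of_mem_off hq
  have h1 := eF_zero_sub_le hv.reg (hv.reg.tmap 1 s) hv.adm hq
  rw [eF_tmap p ζ (one_pow 2)] at h1
  have hs' := abs_le.1 hs
  have hI := invSq_nonneg q.1
  have h2 : (v - tmap 1 s v) q.1 q.2 ^ 2 / ‖q.1‖ ^ 2
      ≤ 4 * B ^ 2 * invSq q.1 + 2 * eF p 0 (v - tmap 1 s v) q := by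
    have e0 := eF_nonneg (adm_zero p) (v - tmap 1 s v) q
    by_cases h : ‖q.1‖ ≤ 1
    · have b1 := hB q.1 h q.2 ⟨by linarith [ht.1], by linarith [ht.2]⟩
      have b2 := hB q.1 h (1 * q.2 + s) ⟨by linarith [ht.1], by linarith [ht.2]⟩
      have b3 : (v - tmap 1 s v) q.1 q.2 ^ 2 ≤ 4 * B ^ 2 := by
        have : |v q.1 q.2 - v q.1 (1 * q.2 + s)| ≤ 2 * B := (abs_sub _ _).trans (by linarith)
        have := sq_le_sq' (abs_le.1 this).1 (abs_le.1 this).2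
        simp only [Pi.sub_apply, tmap]
        linarith
      rw [invSq_of_le h, div_eq_mul_inv]
      have : 0 ≤ (‖q.1‖ ^ 2)⁻¹ := by positivity
      nlinarith [mul_le_mul_of_nonneg_right b3 this]
    · push Not at h
      have b1 : (v - tmap 1 s v) q.1 q.2 ^ 2 / ‖q.1‖ ^ 2 ≤ (v - tmap 1 s v) q.1 q.2 ^ 2 / ‖q.1‖ := by
        gcongr; nlinarith
      have b2 : (v - tmap 1 s v) q.1 q.2 ^ 2 / ‖q.1‖ ≤ 2 * eF p 0 (v - tmap 1 s v) q := by
        have : (v - tmap 1 s v) q.1 q.2 ^ 2 / ‖q.1‖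
          = 2 * ((v - tmap 1 s v) q.1 q.2 ^ 2 / (2 * ‖q.1‖)) := by field_simp
        rw [this]
        unfold eF
        have := sq_nonneg ‖gr (v - tmap 1 s v) q‖
        have := sq_nonneg (vt (v - tmap 1 s v) q)
        simp only [zero_mul, zero_div]
        linarith
      have : 0 ≤ 4 * B ^ 2 * invSq q.1 := by positivity
      linarith
  have : Df p 0 (v - tmap 1 s v) q = eF p 0 (v - tmap 1 s v) q
    + (v - tmap 1 s v) q.1 q.2 ^ 2 / ‖q.1‖ ^ 2 := rfl
  linarith

theorem tendsto_integral_Df_sub_tmap {α : Type*} [MeasurableSpace α] {μ : Measure α} (hv : FE p ζ v)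
    {π : α → Sp d × ℝ} {t1 t2 : ℝ} (hπ : ∀ᵐ a ∂μ, π a ∈ off d ∧ (π a).2 ∈ Icc t1 t2)
    (hm : ∀ F : Sp d × ℝ → ℝ, ContinuousOn F (off d) → AEStronglyMeasurable (fun a => F (π a)) μ)
    (hI : Integrable (fun a => invSq (π a).1) μ)
    (hi : ∀ s, Integrable (fun a => eF p ζ (tmap 1 s v) (π a)) μ)
    (he : ∀ s, ∫ a, eF p ζ (tmap 1 s v) (π a) ∂μ = E) :
    Tendsto (fun s => ∫ a, Df p 0 (v - tmap 1 s v) (π a) ∂μ) (𝓝 0) (𝓝 0) := by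
  obtain ⟨C, hC, h⟩ := exists_Df_sub_tmap_le hv t1 t2
  have h0 : tmap 1 0 v = v := by funext x t; simp [tmap]
  have hi0 := hi 0
  have he0 := he 0
  rw [h0] at hi0 he0
  refine tendsto_integral_zero_of_le_add (C := 6) (by norm_num) hi hi0 (hI.const_mul C)
    (fun s a => eF_nonneg hv.adm _ _) (fun a => eF_nonneg hv.adm _ _)
    (fun a => mul_nonneg hC (invSq_nonneg _)) (fun s a => Df_nonneg (adm_zero p) _ _)
    (fun s => hm _ (continuousOn_Df (hv.reg.sub (hv.reg.tmap 1 s)) (adm_zero p)))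
    (by simp only [he, he0]; exact tendsto_const_nhds) ?_ ?_ ?_
  · filter_upwards [hπ] with a ha
    have hc : Continuous fun s : ℝ => ((π a).1, 1 * (π a).2 + s) := by fun_prop
    have e0 : (((π a).1, 1 * (π a).2 + 0) : Sp d × ℝ) = π a := by simp
    have h1 : ContinuousAt (fun s : ℝ => eF p ζ v ((π a).1, 1 * (π a).2 + s)) 0 := by
      refine ContinuousAt.comp (g := eF p ζ v) (f := fun s : ℝ => ((π a).1, 1 * (π a).2 + s)) ?_
        hc.continuousAt
      rw [e0]
      exact (continuousOn_eF hv.reg hv.adm).continuousAt (isOpen_off.mem_nhds ha.1)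
    have h2 := h1.tendsto
    rw [e0] at h2
    exact h2.congr fun s => (eF_tmap p ζ (one_pow 2) s v _).symm
  · filter_upwards [hπ] with a ha using tendsto_Df_sub_tmap hv ha.1
  · filter_upwards [Metric.closedBall_mem_nhds (0 : ℝ) one_pos] with s hs
    filter_upwards [hπ] with a ha
    rw [eF_tmap p ζ (one_pow 2)]
    exact h s (by simpa using hs) _ ha.1 ha.2

variable (hv : Sol p ζ E v)
include hv

theorem integral_slab_eF {t1 t2 : ℝ} (h12 : t1 ≤ t2) :
    ∫ q, eF p ζ v q ∂slab d t1 t2 = (t2 - t1) * E := by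
  have h := integrable_slab_eF hv.toFE t1 t2
  unfold slab at h ⊢
  rw [integral_prod_symm _ h]
  simp only [hv.energy]
  simp [h12]

theorem Sol.eqn_zero {q : Sp d × ℝ} (hq : q ∈ off d) :
    Sf p 0 v q = -(ζ * |v q.1 q.2| ^ (p - 1) * v q.1 q.2) := by
  have := hv.eqn q hq
  unfold Sf at this ⊢
  linarith

theorem eventually_abs_Sf_sub_tmap_le (t1 t2 : ℝ) {ε : ℝ} (hε : 0 < ε) : ∀ᶠ s in 𝓝 (0 : ℝ),
    ∀ q ∈ off d, ‖q.1‖ ≤ 2 → q.2 ∈ Icc t1 t2 → |Sf p 0 (v - tmap 1 s v) q| ≤ ε := by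
  have hF : Continuous fun q : Sp d × ℝ => ζ * |v q.1 q.2| ^ (p - 1) * v q.1 q.2 :=
    (continuous_abs_rpow_mul hv.adm).comp hv.reg.cont
  have hK : IsCompact (Metric.closedBall (0 : Sp d) 2 ×ˢ Icc (t1 - 1) (t2 + 1)) :=
    (isCompact_closedBall _ _).prod isCompact_Icc
  obtain ⟨δ, hδ, h⟩ := Metric.uniformContinuousOn_iff.1
    (hK.uniformContinuousOn_of_continuous hF.continuousOn) ε hε
  filter_upwards [Metric.ball_mem_nhds (0 : ℝ) (lt_min hδ one_pos)] with s hs q hq h2 ht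
  have hs : |s| < min δ 1 := by simpa using hs
  have hs1 := abs_lt.1 (hs.trans_le (min_le_right _ _))
  have hsol := (hv.tmap (one_pow 2) s).eqn_zero hq
  rw [Sf_sub hv.reg (hv.reg.tmap 1 s) p hq, hv.eqn_zero hq, hsol]
  have := h (q.1, 1 * q.2 + s) ⟨by simpa using h2, by constructor <;> simp <;> linarith [ht.1, ht.2]⟩
    q ⟨by simpa using h2, by constructor <;> linarith [ht.1, ht.2]⟩ (by
      rw [Prod.dist_eq]
      simp only [dist_self, Real.dist_eq]
      rw [show 1 * q.2 + s - q.2 = s by ring]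
      exact max_lt hδ (hs.trans_le (min_le_left _ _)))
  rw [Real.dist_eq] at this
  simp only [tmap] at this ⊢
  rw [sub_neg_eq_add, neg_add_eq_sub]
  exact this.le

theorem eventually_integral_vt_sub_tmap_le {t1 t2 : ℝ} (h12 : t1 ≤ t2) {ε : ℝ} (hε : 0 < ε) :
    ∀ᶠ s in 𝓝 (0 : ℝ), ∀ ρ, 0 < ρ →
      ∫ q, ph' ρ ‖q.1‖ * eta ‖q.1‖ * vt (v - tmap 1 s v) q ^ 2 ∂slab d t1 t2 ≤ ε := by
  obtain ⟨C, hC, h⟩ := exists_vt_flux_bound d p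
  have hsl (t : ℝ) : Tendsto (fun s => ∫ x, Df p 0 (v - tmap 1 s v) (x, t)) (𝓝 0) (𝓝 0) := by
    refine tendsto_integral_Df_sub_tmap (E := E) hv.toFE (π := fun x => (x, t)) (t1 := t) (t2 := t)
      ?_ (fun F hF => aesm_slice hF t) integrable_invSq
      (fun s => (hv.tmap (one_pow 2) s).int t) (fun s => (hv.tmap (one_pow 2) s).energy t)
    filter_upwards [ae_ne_zero] with x hx using ⟨mem_off.2 hx, by simp⟩
  have hsb : Tendsto (fun s => ∫ q, Df p 0 (v - tmap 1 s v) q ∂slab d t1 t2) (𝓝 0) (𝓝 0) :=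
    tendsto_integral_Df_sub_tmap (E := (t2 - t1) * E) hv.toFE (π := fun q => q) (t1 := t1) (t2 := t2)
      (ae_slab_of_Icc fun q hq ht => ⟨hq, ht⟩) (fun F hF => aesm_slab hF t1 t2)
      (integrable_invSq_slab t1 t2)
      (fun s => integrable_slab_eF (hv.tmap (one_pow 2) s).toFE t1 t2)
      (fun s => integral_slab_eF (hv.tmap (one_pow 2) s) h12)
  have L := (((hsb.add (hsl t1)).add (hsl t2)).const_mul C)
  simp only [add_zero, mul_zero] at L
  set N := ∫ q : Sp d × ℝ, eta ‖q.1‖ ∂slab d t1 t2 with hN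
  have hN0 : 0 ≤ N := integral_nonneg fun q => eta_nonneg _
  have hK : 0 < √(ε / (8 * (N + 1))) := Real.sqrt_pos.2 (by positivity)
  filter_upwards [L.eventually_lt_const (half_pos hε),
    eventually_abs_Sf_sub_tmap_le hv t1 t2 hK] with s h1 h2 ρ hρ
  have := h _ (hv.toFE.sub (hv.toFE.tmap (one_pow 2) s)) t1 t2 _ h12 h2 ρ hρ
  refine this.trans ?_
  rw [Real.sq_sqrt (by positivity), ← hN]
  have h3 : 4 * (ε / (8 * (N + 1)) * N) ≤ ε / 2 := by
    rw [show 4 * (ε / (8 * (N + 1)) * N) = ε * N / (2 * (N + 1)) by field_simp; ring,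
      div_le_div_iff₀ (by positivity) (by positivity)]
    nlinarith
  linarith

end
end
end Coulomb
namespace Coulomb
section
open Set Topology
variable {d : ℕ}

section
variable [hd : Fact (4 ≤ d)] {p ζ E : ℝ} {v : Sp d → ℝ → ℝ}

theorem integral_vt_shift (hv : Reg v) {q : Sp d × ℝ} (hq : q ∈ off d) {h : ℝ} (h0 : 0 ≤ h) :
    ∫ s in Ioc 0 h, vt v (q.1, 1 * q.2 + s) = -((v - tmap 1 h v) q.1 q.2) := by
  have hq' (s : ℝ) : ((q.1, 1 * q.2 + s) : Sp d × ℝ) ∈ off d := mem_off.2 (mem_off.1 hq)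
  have hc : Continuous fun s : ℝ => vt v (q.1, 1 * q.2 + s) :=
    (continuousOn_vt hv).comp_continuous (by fun_prop) hq'
  rw [← intervalIntegral.integral_of_le h0,
    intervalIntegral.integral_eq_sub_of_hasDerivAt (f := fun s => v q.1 (1 * q.2 + s))
      (fun s _ => (hv.vt_eq (hq' s) ▸ hv.hasDerivAt_right (hq' s)).comp_const_add _ _) (hc.intervalIntegrable _ _)]
  simp [tmap]

theorem sq_vt_le (hv : FE p ζ v) (q : Sp d × ℝ) : vt v q ^ 2 ≤ 2 * eF p ζ v q := by
  have h2 : 0 ≤ v q.1 q.2 ^ 2 / (2 * ‖q.1‖) := by positivity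
  have h4 := sq_nonneg ‖gr v q‖
  have := potential_nonneg hv.adm (v q.1 q.2)
  unfold eF
  linarith

theorem ph'_eta_mul_abs_le (hv : FE p ζ v) {ρ : ℝ} (hρ : 0 < ρ) (s : ℝ) {q : Sp d × ℝ}
    (hq : q ∈ off d) :
    |ph' ρ ‖q.1‖ * eta ‖q.1‖ * (vt v q * vt v (q.1, 1 * q.2 + s))|
      ≤ 1 / ρ * (eF p ζ v q + eF p ζ (tmap 1 s v) q) := by
  have hp := norm_pos_of_mem_off hq
  have h1 := sq_vt_le hv q
  have h2 := sq_vt_le hv (q.1, 1 * q.2 + s)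
  rw [eF_tmap p ζ (one_pow 2), abs_mul, abs_of_nonneg (mul_nonneg (ph'_nonneg hρ hp) (eta_nonneg _))]
  refine mul_le_mul ?_ ?_ (abs_nonneg _) (by positivity)
  · exact (mul_le_of_le_one_right (ph'_nonneg hρ hp) (eta_le_one _)).trans (ph'_le_inv hρ hp)
  · rw [abs_mul]
    nlinarith [sq_nonneg (|vt v q| - |vt v (q.1, 1 * q.2 + s)|), sq_abs (vt v q),
      sq_abs (vt v (q.1, 1 * q.2 + s))]

variable (hv : Sol p ζ E v)
include hv

theorem integrable_slab_vt_mul_shift {ρ : ℝ} (hρ : 0 < ρ) (t1 t2 s : ℝ) :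
    Integrable (fun q => ph' ρ ‖q.1‖ * eta ‖q.1‖ * (vt v q * vt v (q.1, 1 * q.2 + s)))
      (slab d t1 t2) := by
  have hc : ContinuousOn (fun q : Sp d × ℝ => vt v (q.1, 1 * q.2 + s)) (off d) :=
    (continuousOn_vt hv.reg).comp (f := fun q : Sp d × ℝ => (q.1, 1 * q.2 + s)) (by fun_prop)
      fun q hq => mem_off.2 (mem_off.1 hq)
  have i1 := ((integrable_slab_eF hv.toFE t1 t2).add
    (integrable_slab_eF (hv.tmap (one_pow 2) s).toFE t1 t2)).const_mul (1 / ρ)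
  refine i1.mono' (aesm_slab (F := fun q => ph' ρ ‖q.1‖ * eta ‖q.1‖ * (vt v q * vt v (q.1, 1 * q.2 + s)))
    (((continuousOn_ph' hρ).mul (continuous_eta.comp (by fun_prop)).continuousOn).mul
      ((continuousOn_vt hv.reg).mul hc)) t1 t2) ?_
  filter_upwards [ae_mem_off t1 t2] with q hq using ph'_eta_mul_abs_le hv.toFE hρ s hq

theorem integrable_slab_prod_vt_mul_shift {ρ : ℝ} (hρ : 0 < ρ) {t1 t2 : ℝ} (h12 : t1 ≤ t2) (h : ℝ) :
    Integrable (fun z : (Sp d × ℝ) × ℝ =>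
      ph' ρ ‖z.1.1‖ * eta ‖z.1.1‖ * (vt v z.1 * vt v (z.1.1, 1 * z.1.2 + z.2)))
      ((slab d t1 t2).prod (volume.restrict (Ioc 0 h))) := by
  have hfin : SFinite (slab d t1 t2) := by unfold slab; infer_instance
  set U : Set ((Sp d × ℝ) × ℝ) := Prod.fst ⁻¹' off d with hU
  have hUo : IsOpen U := isOpen_off.preimage continuous_fst
  have hc : ContinuousOn (fun z : (Sp d × ℝ) × ℝ =>
      ph' ρ ‖z.1.1‖ * eta ‖z.1.1‖ * (vt v z.1 * vt v (z.1.1, 1 * z.1.2 + z.2))) U := by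
    have c1 : ContinuousOn (fun z : (Sp d × ℝ) × ℝ => ph' ρ ‖z.1.1‖) U :=
      (continuousOn_ph' hρ).comp continuous_fst.continuousOn fun z hz => hz
    have c2 : ContinuousOn (fun z : (Sp d × ℝ) × ℝ => vt v z.1) U :=
      (continuousOn_vt hv.reg).comp continuous_fst.continuousOn fun z hz => hz
    have c3 : ContinuousOn (fun z : (Sp d × ℝ) × ℝ => vt v (z.1.1, 1 * z.1.2 + z.2)) U :=
      (continuousOn_vt hv.reg).comp
        (f := fun z : (Sp d × ℝ) × ℝ => (z.1.1, 1 * z.1.2 + z.2)) (by fun_prop)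
        fun z hz => mem_off.2 (mem_off.1 (show z.1 ∈ off d from hz))
    exact (c1.mul (continuous_eta.comp (by fun_prop)).continuousOn).mul (c2.mul c3)
  have hm : AEStronglyMeasurable (fun z : (Sp d × ℝ) × ℝ =>
      ph' ρ ‖z.1.1‖ * eta ‖z.1.1‖ * (vt v z.1 * vt v (z.1.1, 1 * z.1.2 + z.2)))
      ((slab d t1 t2).prod (volume.restrict (Ioc 0 h))) := by
    have := hc.aestronglyMeasurable (μ := (slab d t1 t2).prod (volume.restrict (Ioc 0 h)))
      hUo.measurableSet
    rwa [Measure.restrict_eq_self_of_ae_mem] at this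
    exact Measure.quasiMeasurePreserving_fst.ae (ae_mem_off t1 t2)
  rw [integrable_prod_iff' hm]
  refine ⟨Eventually.of_forall fun s => integrable_slab_vt_mul_shift hv hρ t1 t2 s, ?_⟩
  have hm2 := hm.norm.prod_swap.integral_prod_right'
  refine Integrable.mono' (integrable_const (1 / ρ * ((t2 - t1) * E + (t2 - t1) * E))) hm2
    (Eventually.of_forall fun s => ?_)
  have i2 := integrable_slab_eF (hv.tmap (one_pow 2) s).toFE t1 t2
  rw [Real.norm_eq_abs, abs_of_nonneg (integral_nonneg fun _ => norm_nonneg _)]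
  rw [← integral_slab_eF hv h12]
  nth_rw 2 [integral_slab_eF hv h12]
  rw [← integral_slab_eF (hv.tmap (one_pow 2) s) h12]
  rw [← integral_add (integrable_slab_eF hv.toFE t1 t2) i2, ← integral_const_mul]
  refine integral_mono_of_nonneg (Eventually.of_forall fun _ => norm_nonneg _)
    (((integrable_slab_eF hv.toFE t1 t2).add i2).const_mul _) ?_
  filter_upwards [ae_mem_off t1 t2] with q hq using ph'_eta_mul_abs_le hv.toFE hρ s hq

theorem tendsto_integral_vt_mul_sub {t1 t2 : ℝ} (h : ℝ) : Tendsto (fun n : ℕ =>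
    ∫ q, ph' (1 / ((n : ℝ) + 1)) ‖q.1‖ * (eta ‖q.1‖ * (vt v q * (v - tmap 1 h v) q.1 q.2))
      ∂slab d t1 t2) atTop (𝓝 0) := by
  have hF := hv.toFE.sub (hv.toFE.tmap (one_pow 2) h)
  refine tendsto_integral_ph' (F := fun q : Sp d × ℝ =>
    eta ‖q.1‖ * (vt v q * (v - tmap 1 h v) q.1 q.2)) (r := fun q : Sp d × ℝ => ‖q.1‖)
    (fun ρ hρ => aesm_slab (F := fun q : Sp d × ℝ => ph' ρ ‖q.1‖ *
      (eta ‖q.1‖ * (vt v q * (v - tmap 1 h v) q.1 q.2)))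
      ((continuousOn_ph' hρ).mul ((continuous_eta.comp (by fun_prop)).continuousOn.mul
      ((continuousOn_vt hv.reg).mul hF.reg.cont.continuousOn))) t1 t2)
    ((integrable_slab_Df hv.toFE t1 t2).add (integrable_slab_Df hF t1 t2)) ?_
  filter_upwards [ae_mem_off t1 t2] with q hq
  have hp := norm_pos_of_mem_off hq
  refine ⟨hp, ?_⟩
  have h1 := (le_Df hv.adm v q).2.1
  have h2 := (le_Df hF.adm (v - tmap 1 h v) q).2.2.2.1
  rw [abs_mul, abs_of_nonneg (eta_nonneg _)]
  refine (mul_le_of_le_one_left (abs_nonneg _) (eta_le_one _)).trans ?_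
  set y := (v - tmap 1 h v) q.1 q.2 with hy
  have e : |vt v q * y| = ‖q.1‖ * (|vt v q| * |y / ‖q.1‖|) := by
    rw [abs_mul, abs_div, abs_of_pos hp]; field_simp
  rw [e]
  refine mul_le_mul_of_nonneg_left ?_ hp.le
  rw [← div_pow] at h2
  have := Df_nonneg hF.adm (v - tmap 1 h v) q
  simp only [Pi.add_apply]
  nlinarith [sq_nonneg (|vt v q| - |y / ‖q.1‖|), sq_abs (vt v q), sq_abs (y / ‖q.1‖)]

theorem integrable_slab_ph'_eta_vt {ρ : ℝ} (hρ : 0 < ρ) (t1 t2 : ℝ) :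
    Integrable (fun q => ph' ρ ‖q.1‖ * (eta ‖q.1‖ * vt v q ^ 2)) (slab d t1 t2) :=
  integrable_slab_ph'_mul hv.toFE hρ (F := fun q => eta ‖q.1‖ * vt v q ^ 2)
    ((continuous_eta.comp (by fun_prop)).continuousOn.mul ((continuousOn_vt hv.reg).pow 2)) (C := 2)
    (fun q _ => by
      rw [abs_of_nonneg (mul_nonneg (eta_nonneg _) (by positivity))]
      exact (mul_le_of_le_one_left (by positivity) (eta_le_one _)).trans (le_Df hv.adm v q).2.1)
    t1 t2

theorem exists_integral_eta_vt_le {t1 t2 : ℝ} (h12 : t1 ≤ t2) {ε : ℝ} (hε : 0 < ε) :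
    ∃ h, 0 < h ∧ ∀ ρ, 0 < ρ → h * ∫ q, ph' ρ ‖q.1‖ * (eta ‖q.1‖ * vt v q ^ 2) ∂slab d t1 t2
      ≤ h * ε - 2 * ∫ q, ph' ρ ‖q.1‖ * (eta ‖q.1‖ * (vt v q * (v - tmap 1 h v) q.1 q.2))
        ∂slab d t1 t2 := by
  have hfin : SFinite (slab d t1 t2) := by unfold slab; infer_instance
  obtain ⟨δ, hδ, hs⟩ := Metric.eventually_nhds_iff.1 (eventually_integral_vt_sub_tmap_le hv h12 hε)
  refine ⟨δ / 2, half_pos hδ, fun ρ hρ => ?_⟩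
  set h := δ / 2 with hh
  have h0 : 0 < h := half_pos hδ
  have iP := integrable_slab_prod_vt_mul_shift hv hρ h12 h
  have step : ∀ s ∈ Ioc 0 h, ∫ q, ph' ρ ‖q.1‖ * (eta ‖q.1‖ * vt v q ^ 2) ∂slab d t1 t2 ≤
      ε + 2 * ∫ q, ph' ρ ‖q.1‖ * eta ‖q.1‖ * (vt v q * vt v (q.1, 1 * q.2 + s)) ∂slab d t1 t2 := by
    intro s hsI
    have b1 := hs (y := s) (by rw [dist_zero_right, Real.norm_eq_abs, abs_of_pos hsI.1]; linarith [hsI.2])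
      ρ hρ
    have i1 := integrable_slab_ph'_eta_vt hv hρ t1 t2
    have i2 := integrable_slab_vt_mul_shift hv hρ t1 t2 s
    have b2 : ∫ q, (ph' ρ ‖q.1‖ * (eta ‖q.1‖ * vt v q ^ 2)
          - 2 * (ph' ρ ‖q.1‖ * eta ‖q.1‖ * (vt v q * vt v (q.1, 1 * q.2 + s)))) ∂slab d t1 t2
        ≤ ∫ q, ph' ρ ‖q.1‖ * eta ‖q.1‖ * vt (v - tmap 1 s v) q ^ 2 ∂slab d t1 t2 := by
      have hF := hv.toFE.sub (hv.toFE.tmap (one_pow 2) s)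
      have i3 : Integrable (fun q => ph' ρ ‖q.1‖ * eta ‖q.1‖ * vt (v - tmap 1 s v) q ^ 2)
          (slab d t1 t2) := by
        refine hF.integrable_slab (F := fun q => ph' ρ ‖q.1‖ * eta ‖q.1‖ * vt (v - tmap 1 s v) q ^ 2)
          (C := 1 / ρ * 2) (((continuousOn_ph' hρ).mul
            (continuous_eta.comp (by fun_prop)).continuousOn).mul ((continuousOn_vt hF.reg).pow 2))
          (fun q hq => ?_) t1 t2
        have hp := norm_pos_of_mem_off hq
        have a1 := mul_nonneg (ph'_nonneg hρ hp) (eta_nonneg ‖q.1‖)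
        rw [abs_of_nonneg (mul_nonneg a1 (sq_nonneg _)), mul_assoc (1 / ρ)]
        exact mul_le_mul ((mul_le_of_le_one_right (ph'_nonneg hρ hp) (eta_le_one _)).trans
          (ph'_le_inv hρ hp)) (le_Df hF.adm _ q).2.1 (sq_nonneg _) (by positivity)
      refine integral_mono_ae (i1.sub (i2.const_mul 2)) i3 ?_
      filter_upwards [ae_mem_off t1 t2] with q hq
      have a1 := mul_nonneg (ph'_nonneg hρ (norm_pos_of_mem_off hq)) (eta_nonneg ‖q.1‖)
      rw [vt_sub hv.reg (hv.reg.tmap 1 s) hq, vt_tmap]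
      nlinarith [mul_nonneg a1 (sq_nonneg (vt v (q.1, 1 * q.2 + s)))]
    rw [integral_sub i1 (i2.const_mul 2), integral_const_mul] at b2
    linarith
  have hswap : ∫ s in Ioc 0 h, ∫ q, ph' ρ ‖q.1‖ * eta ‖q.1‖ * (vt v q * vt v (q.1, 1 * q.2 + s))
      ∂slab d t1 t2
      = -∫ q, ph' ρ ‖q.1‖ * (eta ‖q.1‖ * (vt v q * (v - tmap 1 h v) q.1 q.2)) ∂slab d t1 t2 := by
    rw [← integral_prod_symm _ iP, integral_prod _ iP, ← integral_neg]
    refine integral_congr_ae ?_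
    filter_upwards [ae_mem_off t1 t2] with q hq
    rw [integral_const_mul, integral_const_mul, integral_vt_shift hv.reg hq h0.le]
    ring
  have iS : Integrable (fun s => ∫ q, ph' ρ ‖q.1‖ * eta ‖q.1‖ * (vt v q * vt v (q.1, 1 * q.2 + s))
      ∂slab d t1 t2) (volume.restrict (Ioc 0 h)) := iP.integral_prod_right
  have fin := setIntegral_mono_on (μ := volume) (s := Ioc 0 h)
    (integrable_const (∫ q, ph' ρ ‖q.1‖ * (eta ‖q.1‖ * vt v q ^ 2) ∂slab d t1 t2))
    ((integrable_const ε).add (iS.const_mul 2)) measurableSet_Ioc step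
  simp only [Pi.add_apply] at fin
  rw [integral_add (integrable_const ε) (iS.const_mul 2), integral_const_mul, hswap] at fin
  simp only [integral_const, MeasurableSet.univ, measureReal_restrict_apply, univ_inter,
    Real.volume_real_Ioc_of_le h0.le, sub_zero, smul_eq_mul] at fin
  linarith

theorem tendsto_integral_ph'_eta_vt {t1 t2 : ℝ} (h12 : t1 ≤ t2) : Tendsto (fun n : ℕ =>
    ∫ q, ph' (1 / ((n : ℝ) + 1)) ‖q.1‖ * (eta ‖q.1‖ * vt v q ^ 2) ∂slab d t1 t2) atTop (𝓝 0) := by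
  have hnn (n : ℕ) : 0 ≤ ∫ q, ph' (1 / ((n : ℝ) + 1)) ‖q.1‖ * (eta ‖q.1‖ * vt v q ^ 2)
      ∂slab d t1 t2 := by
    refine integral_nonneg_of_ae ?_
    filter_upwards [ae_mem_off t1 t2] with q hq
    exact mul_nonneg (ph'_nonneg (inv_succ_pos n) (norm_pos_of_mem_off hq))
      (mul_nonneg (eta_nonneg _) (sq_nonneg _))
  rw [Metric.tendsto_atTop']
  intro ε hε
  obtain ⟨h, h0, hle⟩ := exists_integral_eta_vt_le hv h12 (half_pos hε)
  have L := (tendsto_integral_vt_mul_sub hv (t1 := t1) (t2 := t2) h).eventually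
    (lt_mem_nhds (show -(h * ε / 4) < 0 by have := mul_pos h0 hε; linarith))
  obtain ⟨N, hN⟩ := eventually_atTop.1 L
  refine ⟨N, fun n hn => ?_⟩
  rw [dist_zero_right, Real.norm_eq_abs, abs_of_nonneg (hnn n)]
  have h1 := hle _ (inv_succ_pos n)
  have h2 := hN n hn.le
  refine lt_of_mul_lt_mul_left ?_ h0.le
  linarith

theorem tendsto_integral_ph'_vt {t1 t2 : ℝ} (h12 : t1 ≤ t2) : Tendsto (fun n : ℕ =>
    ∫ q, ph' (1 / ((n : ℝ) + 1)) ‖q.1‖ * vt v q ^ 2 ∂slab d t1 t2) atTop (𝓝 0) := by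
  have h2 : Tendsto (fun n : ℕ => ∫ q, ph' (1 / ((n : ℝ) + 1)) ‖q.1‖ *
      ((1 - eta ‖q.1‖) * vt v q ^ 2) ∂slab d t1 t2) atTop (𝓝 0) := by
    refine tendsto_integral_ph' (F := fun q : Sp d × ℝ => (1 - eta ‖q.1‖) * vt v q ^ 2)
      (r := fun q : Sp d × ℝ => ‖q.1‖)
      (fun ρ hρ => aesm_slab (F := fun q : Sp d × ℝ => ph' ρ ‖q.1‖ *
        ((1 - eta ‖q.1‖) * vt v q ^ 2)) ((continuousOn_ph' hρ).mul
        ((continuousOn_const.sub (continuous_eta.comp (by fun_prop)).continuousOn).mul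
        ((continuousOn_vt hv.reg).pow 2))) t1 t2)
      ((integrable_slab_Df hv.toFE t1 t2).const_mul 2) ?_
    filter_upwards [ae_mem_off t1 t2] with q hq
    refine ⟨norm_pos_of_mem_off hq, ?_⟩
    have e0 := eta_nonneg ‖q.1‖
    have e1 := eta_le_one ‖q.1‖
    have b := (le_Df hv.adm v q).2.1
    rw [abs_of_nonneg (mul_nonneg (by linarith) (sq_nonneg _))]
    rcases le_total ‖q.1‖ 1 with h | h
    · rw [eta_of_le h]
      have := Df_nonneg hv.adm v q
      have := norm_nonneg q.1
      simp only [sub_self, zero_mul]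
      positivity
    · have h1 : (1 - eta ‖q.1‖) * vt v q ^ 2 ≤ vt v q ^ 2 :=
        mul_le_of_le_one_left (sq_nonneg _) (by linarith)
      have h2 := le_mul_of_one_le_left ((sq_nonneg _).trans b) h
      linarith
  have h3 := (tendsto_integral_ph'_eta_vt hv h12).add h2
  rw [add_zero] at h3
  refine h3.congr fun n => ?_
  have i1 := integrable_slab_ph'_eta_vt hv (inv_succ_pos n) t1 t2
  have i0 := integrable_slab_ph'_vt hv.toFE (inv_succ_pos n) t1 t2
  have i2 : Integrable (fun q => ph' (1 / ((n : ℝ) + 1)) ‖q.1‖ * ((1 - eta ‖q.1‖) * vt v q ^ 2))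
      (slab d t1 t2) := (i0.sub i1).congr (Eventually.of_forall fun q => by
        simp only [Pi.sub_apply]; ring)
  rw [← integral_add i1 i2]
  congr 1
  funext q
  ring

end
end
end Coulomb
namespace Coulomb
section
open Set Topology
variable {d : ℕ}

section
variable [hd : Fact (4 ≤ d)] {p ζ E : ℝ} {v : Sp d → ℝ → ℝ} (hv : Sol p ζ E v)
include hv

theorem tendsto_integral_ph'_sq_div {t1 t2 : ℝ} (h12 : t1 ≤ t2) : Tendsto (fun n : ℕ =>
    ∫ q, ph' (1 / ((n : ℝ) + 1)) ‖q.1‖ * (v q.1 q.2 ^ 2 / ‖q.1‖ ^ 2) ∂slab d t1 t2)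
    atTop (𝓝 0) := by
  refine tendsto_integral_ph' (F := fun q : Sp d × ℝ => v q.1 q.2 ^ 2 / ‖q.1‖ ^ 2)
    (r := fun q : Sp d × ℝ => ‖q.1‖)
    (fun ρ hρ => (integrable_slab_ph'_sq_div hv.toFE hρ t1 t2).1)
    ((Mf_integrable_slab hv h12).1.const_mul (4 / lam d)) ?_
  filter_upwards [ae_mem_off t1 t2] with q hq
  refine ⟨norm_pos_of_mem_off hq, ?_⟩
  have hl := lam_pos (d := d)
  have h1 := half_ef_le hv.adm hv.cond (v := v) hq
  have h2 := Qf_sq_le v q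
  have h3 := potential_nonneg hv.adm (v q.1 q.2)
  have h4 : 0 ≤ v q.1 q.2 ^ 2 / (2 * ‖q.1‖) := by positivity
  have h5 : lam d / 4 * (v q.1 q.2 ^ 2 / ‖q.1‖ ^ 2) ≤ ‖q.1‖ * Mf p ζ v q := by
    refine le_trans ?_ h1
    unfold ef
    rw [mul_div_assoc (lam d / 2)]
    linarith
  rw [abs_of_nonneg (by positivity), mul_left_comm]
  rw [div_mul_eq_mul_div, le_div_iff₀ hl]
  linarith

theorem tendsto_integral_ph'_gr {t1 t2 : ℝ} (h12 : t1 ≤ t2) : Tendsto (fun n : ℕ =>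
    ∫ q, ph' (1 / ((n : ℝ) + 1)) ‖q.1‖ * ‖gr v q‖ ^ 2 ∂slab d t1 t2) atTop (𝓝 0) := by
  have L := ((((tendsto_integral_ph'_vt hv h12).const_mul 2).add
    ((tendsto_integral_ph'_sq_div hv h12).const_mul 4)).add
    (((tendsto_ph'_mul_vt hv.toFE t1).sub (tendsto_ph'_mul_vt hv.toFE t2)).const_mul 2))
  simp only [mul_zero, add_zero, sub_zero] at L
  refine squeeze_zero (fun n => ?_) (fun n => caccioppoli hv.toFE hv.eqn (inv_succ_pos n) h12) L
  refine integral_nonneg_of_ae ?_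
  filter_upwards [ae_mem_off t1 t2] with q hq
  exact mul_nonneg (ph'_nonneg (inv_succ_pos n) (norm_pos_of_mem_off hq)) (sq_nonneg _)

theorem tendsto_integral_ph'_Lf {t1 t2 : ℝ} (h12 : t1 ≤ t2) : Tendsto (fun n : ℕ =>
    ∫ q, ph' (1 / ((n : ℝ) + 1)) ‖q.1‖ * (1 / 4 * Lf 1 v q ^ 2) ∂slab d t1 t2) atTop (𝓝 0) := by
  have L := (((tendsto_integral_ph'_gr hv h12).add
    ((tendsto_integral_ph'_sq_div hv h12).const_mul (((d : ℝ) - 1) ^ 2 / 4))).add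
    (tendsto_integral_ph'_vt hv h12))
  simp only [mul_zero, add_zero] at L
  refine squeeze_zero (fun n => ?_) (fun n => ?_) L
  · refine integral_nonneg_of_ae ?_
    filter_upwards [ae_mem_off t1 t2] with q hq
    exact mul_nonneg (ph'_nonneg (inv_succ_pos n) (norm_pos_of_mem_off hq)) (by positivity)
  · have hρ := inv_succ_pos n
    have i1 := integrable_slab_ph'_gr hv.toFE hρ t1 t2
    have i2 := (integrable_slab_ph'_sq_div hv.toFE hρ t1 t2).const_mul (((d : ℝ) - 1) ^ 2 / 4)
    have i3 := integrable_slab_ph'_vt hv.toFE hρ t1 t2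
    have i12 : Integrable (fun q => ph' (1 / ((n : ℝ) + 1)) ‖q.1‖ * ‖gr v q‖ ^ 2 +
      ((d : ℝ) - 1) ^ 2 / 4 * (ph' (1 / ((n : ℝ) + 1)) ‖q.1‖ * (v q.1 q.2 ^ 2 / ‖q.1‖ ^ 2)))
      (slab d t1 t2) := i1.add i2
    rw [← integral_const_mul, ← integral_add i1 i2, ← integral_add i12 i3]
    refine integral_mono_ae (integrable_slab_ph'_Lf hv hρ t1 t2) (i12.add i3) ?_
    filter_upwards [ae_mem_off t1 t2] with q hq
    have hp := norm_pos_of_mem_off hq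
    have h1 := Qf_sq_le v q
    have h2 : 1 / 4 * Lf 1 v q ^ 2 ≤ ‖gr v q‖ ^ 2
        + ((d : ℝ) - 1) ^ 2 / 4 * (v q.1 q.2 ^ 2 / ‖q.1‖ ^ 2) + vt v q ^ 2 := by
      have e : ((d : ℝ) - 1) ^ 2 / 4 * (v q.1 q.2 ^ 2 / ‖q.1‖ ^ 2)
          = (((d : ℝ) - 1) / 2 * v q.1 q.2 / ‖q.1‖) ^ 2 := by field_simp; ring
      rw [e]
      unfold Lf
      set A := Qf v q / ‖q.1‖
      set B := ((d : ℝ) - 1) / 2 * v q.1 q.2 / ‖q.1‖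
      nlinarith [sq_nonneg (A - B), sq_nonneg (A - vt v q), sq_nonneg (B - vt v q)]
    have := mul_le_mul_of_nonneg_left h2 (ph'_nonneg hρ hp)
    linarith

theorem integral_slab_Mf {t1 t2 : ℝ} (h12 : t1 ≤ t2) : ∫ q, Mf p ζ v q ∂slab d t1 t2
    = (∫ x, eS p ζ 1 v (x, t1)) - ∫ x, eS p ζ 1 v (x, t2) := by
  have hM := (Mf_integrable_slab hv h12).1
  have L1 : Tendsto (fun n : ℕ => ∫ q, ph' (1 / ((n : ℝ) + 1)) ‖q.1‖ * (1 / 2 * ef p ζ v q)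
      ∂slab d t1 t2) atTop (𝓝 0) := by
    refine tendsto_integral_ph' (F := fun q : Sp d × ℝ => 1 / 2 * ef p ζ v q)
      (r := fun q : Sp d × ℝ => ‖q.1‖) (fun ρ hρ => (integrable_slab_ph'_ef hv hρ t1 t2).1) hM ?_
    filter_upwards [ae_mem_off t1 t2] with q hq
    refine ⟨norm_pos_of_mem_off hq, ?_⟩
    have := ef_nonneg hv.adm v q
    rw [abs_of_nonneg (by positivity)]
    exact half_ef_le hv.adm hv.cond hq
  have L2 : Tendsto (fun n : ℕ => ∫ q, ph (1 / ((n : ℝ) + 1)) ‖q.1‖ * Mf p ζ v q ∂slab d t1 t2)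
      atTop (𝓝 (∫ q, Mf p ζ v q ∂slab d t1 t2)) := by
    refine tendsto_integral_of_dominated_convergence (Mf p ζ v)
      (fun n => (integrable_slab_ph_Mf hv (inv_succ_pos n) t1 t2).1) hM (fun n => ?_) ?_
    · filter_upwards [ae_mem_off t1 t2] with q hq
      have hp := norm_pos_of_mem_off hq
      have h0 := Mf_nonneg hv.adm hv.cond (v := v) hq
      rw [Real.norm_eq_abs, abs_of_nonneg (mul_nonneg (ph_nonneg (inv_succ_pos n) hp) h0)]
      exact mul_le_of_le_one_left h0 (ph_le_one (inv_succ_pos n) hp)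
    · filter_upwards [ae_mem_off t1 t2] with q hq
      simpa using (tendsto_ph (norm_pos_of_mem_off hq)).mul_const (Mf p ζ v q)
  have L3 := ((tendsto_integral_ph'_Lf hv h12).sub L1).add L2
  rw [sub_zero, zero_add] at L3
  refine tendsto_nhds_unique L3 (((tendsto_inw_small hv t1).sub (tendsto_inw_small hv t2)).congr
    fun n => inw_sub hv (inv_succ_pos n) h12)

theorem tendsto_inward_atBot : Tendsto (fun t => ∫ x, eS p ζ 1 v (x, t)) atBot (𝓝 E) := by
  have h1 := (tendsto_inward_atTop (hv.tmap (a := -1) (by norm_num) 0)).comp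
    tendsto_neg_atBot_atTop
  have h2 := (tendsto_const_nhds (x := E)).sub h1
  rw [sub_zero] at h2
  refine h2.congr fun t => ?_
  have h3 := integral_eS_add hv.toFE t
  rw [hv.energy] at h3
  have h4 : ∫ x, eS p ζ 1 (tmap (-1) 0 v) (x, -t) = ∫ x, eS p ζ (-1) v (x, t) := by
    simp only [eS_tmap]
    norm_num
  simp only [Function.comp]
  rw [h4]
  linarith

theorem lintegral_Mf : ∫⁻ t, ∫⁻ x, ENNReal.ofReal (Mf p ζ v (x, t)) = ENNReal.ofReal E := by
  set g : ℝ → ENNReal := fun t => ∫⁻ x, ENNReal.ofReal (Mf p ζ v (x, t)) with hg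
  have hstep (n : ℕ) : ∫⁻ t in Ioc (-(n : ℝ)) n, g t
      = ENNReal.ofReal ((∫ x, eS p ζ 1 v (x, -(n : ℝ))) - ∫ x, eS p ζ 1 v (x, (n : ℝ))) := by
    have h12 : -(n : ℝ) ≤ n := by linarith [Nat.cast_nonneg (α := ℝ) n]
    have hM := (Mf_integrable_slab hv h12).1
    have h0 : 0 ≤ᵐ[slab d (-(n : ℝ)) n] Mf p ζ v := by
      filter_upwards [ae_mem_off (-(n : ℝ)) n] with q hq using Mf_nonneg hv.adm hv.cond hq
    rw [← integral_slab_Mf hv h12, ofReal_integral_eq_lintegral_ofReal hM h0]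
    have hm := hM.1.aemeasurable.ennreal_ofReal
    unfold slab at hm ⊢
    rw [lintegral_prod_symm _ hm]
  have hU : (⋃ n : ℕ, Ioc (-(n : ℝ)) n) = univ := by
    refine eq_univ_of_forall fun t => ?_
    obtain ⟨n, hn⟩ := exists_nat_gt |t|
    exact mem_iUnion.2 ⟨n, (abs_lt.1 hn).1, (abs_lt.1 hn).2.le⟩
  have hmono : Monotone fun n : ℕ => Ioc (-(n : ℝ)) (n : ℝ) := fun a b hab => by
    have : (a : ℝ) ≤ b := by exact_mod_cast hab
    exact Ioc_subset_Ioc (by linarith) this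
  have L : Tendsto (fun n : ℕ => ∫⁻ t in Ioc (-(n : ℝ)) n, g t) atTop (𝓝 (∫⁻ t, g t)) := by
    have := setLIntegral_iUnion_of_directed (μ := volume) g (hmono.directed_le)
    rw [hU, Measure.restrict_univ] at this
    rw [this]
    exact tendsto_atTop_iSup fun a b hab => lintegral_mono_set (hmono hab)
  have R : Tendsto (fun n : ℕ => (∫ x, eS p ζ 1 v (x, -(n : ℝ))) - ∫ x, eS p ζ 1 v (x, (n : ℝ)))
      atTop (𝓝 (E - 0)) :=
    ((tendsto_inward_atBot hv).comp (tendsto_neg_atTop_atBot.comp tendsto_natCast_atTop_atTop)).sub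
      ((tendsto_inward_atTop hv).comp tendsto_natCast_atTop_atTop)
  rw [sub_zero] at R
  refine tendsto_nhds_unique L ?_
  simp only [hstep]
  exact (ENNReal.continuous_ofReal.tendsto _).comp R

end
end
end Coulomb
theorem Coulomb.sol_of_isCoulombSolution {d : ℕ} (hd : 4 ≤ d) {p ζ E : ℝ} (hζ : ζ = 0 ∨ ζ = 1)
    (hp : ζ = 1 → 1 + 4 / ((d : ℝ) - 1) ≤ p) {u : EuclideanSpace ℝ (Fin d) → ℝ → ℝ}
    (hu : IsCoulombSolution p ζ u E) : Coulomb.Sol p ζ E u := by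
  obtain ⟨hc, hs, heq, hi, hE⟩ := hu
  have hd1 : (0 : ℝ) < d - 1 := by
    have : (4 : ℝ) ≤ d := by exact_mod_cast hd
    linarith
  have hpos : 0 < 4 / ((d : ℝ) - 1) := by positivity
  refine ⟨⟨⟨hc, hs⟩, ⟨?_, hζ.imp_right fun h => ?_⟩, hi, E, fun t => (hE t).le⟩,
    fun q hq => heq q.1 (Coulomb.mem_off.1 hq) q.2, hζ.imp_right fun h => ?_, hE⟩
  · rcases hζ with h | h <;> rw [h] <;> norm_num
  · linarith [hp h]
  · have h1 : 4 / ((d : ℝ) - 1) ≤ p - 1 := by linarith [hp h]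
    rw [div_le_iff₀ hd1] at h1
    linarith

/-- Monotonicity and limits of the inward energy
`E₋(t) = ∫ e₋(x,t) dx`, and the Morawetz identity `∫∫ M dx dt = E`,
for classical finite-energy solutions in dimension `d ≥ 4`. -/
theorem stmt14 (d : ℕ) (hd : 4 ≤ d) (p ζ : ℝ) (hζ : ζ = 0 ∨ ζ = 1)
    (hζ1 : ζ = 1 →
      d ≤ 5 ∧ 1 + 4 / ((d : ℝ) - 1) ≤ p ∧ p ≤ 1 + 4 / ((d : ℝ) - 2))
    (u : EuclideanSpace ℝ (Fin d) → ℝ → ℝ) (E : ℝ)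
    (hu : IsCoulombSolution p ζ u E) :
    Antitone (fun t : ℝ => ∫ x, eMinus p ζ u x t) ∧
    Tendsto (fun t : ℝ => ∫ x, eMinus p ζ u x t) atTop (nhds 0) ∧
    Tendsto (fun t : ℝ => ∫ x, eMinus p ζ u x t) atBot (nhds E) ∧
    ∫⁻ t : ℝ, ∫⁻ x : EuclideanSpace ℝ (Fin d),
        ENNReal.ofReal (Mden p ζ u x t)
      = ENNReal.ofReal E := by
  have hs := Coulomb.sol_of_isCoulombSolution hd hζ (fun h => (hζ1 h).2.1) hu
  have : Fact (4 ≤ d) := ⟨hd⟩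
  simp only [Coulomb.eMinus_eq, Coulomb.Mden_eq]
  exact ⟨Coulomb.inward_antitone hs, Coulomb.tendsto_inward_atTop hs,
    Coulomb.tendsto_inward_atBot hs, Coulomb.lintegral_Mf hs⟩
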